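/- Fix C > 0, an integer m ≥ 1, and a set S ⊆ ℤ^5 that is a union of residue classes modulo m and is invariant under the GL_2(ℤ)-action on integral binary quartic forms. For i = 0, 1, 2, let N_C(S ∩ V^{(i)}; X) denote the number of GL_2(ℤ)-equivalence classes of irreducible integral binary quartic forms f ∈ S with exactly 4 − 2i distinct real roots in P^1(ℂ) and height h_C(f) = max(|I(f)|, |J(f)|/C) < X, and let N_C(V^{(i)}; X) be the same count without the condition f ∈ S. Let d(S) = #(S ∩ {0,1,…,m−1}^5)/m^5 be the density of S. Then N_C(S ∩ V^{(i)}; X) = d(S) · N_C(V^{(i)}; X) + o(X^2) as X → ∞. -/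

import Mathlib

open Filter

/-- An integral binary quartic form `a x⁴ + b x³y + c x²y² + d xy³ + e y⁴`. -/
structure BQF where
  a : ℤ
  b : ℤ
  c : ℤ
  d : ℤ
  e : ℤ

namespace BQF

/-- The invariant `I` of a binary quartic form. -/
def I (f : BQF) : ℤ := 12 * f.a * f.e - 3 * f.b * f.d + f.c ^ 2

/-- The invariant `J` of a binary quartic form. -/
def J (f : BQF) : ℤ :=
  72 * f.a * f.c * f.e + 9 * f.b * f.c * f.d - 27 * f.a * f.d ^ 2 -
    27 * f.e * f.b ^ 2 - 2 * f.c ^ 3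

/-- Evaluation of the form at a pair of integers. -/
def evalZ (f : BQF) (x y : ℤ) : ℤ :=
  f.a * x ^ 4 + f.b * x ^ 3 * y + f.c * x ^ 2 * y ^ 2 + f.d * x * y ^ 3 + f.e * y ^ 4

/-- Evaluation of the form at a pair of reals. -/
noncomputable def evalR (f : BQF) (x y : ℝ) : ℝ :=
  (f.a : ℝ) * x ^ 4 + (f.b : ℝ) * x ^ 3 * y + (f.c : ℝ) * x ^ 2 * y ^ 2 +
    (f.d : ℝ) * x * y ^ 3 + (f.e : ℝ) * y ^ 4

/-- `GL₂(ℤ)`-equivalence: `g = γ · f` where `(γ · f)(x,y) = f((x,y)γ)` for some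
integer matrix `γ` with unit (i.e. `±1`) determinant. -/
def Equivalent (f g : BQF) : Prop :=
  ∃ γ : Matrix (Fin 2) (Fin 2) ℤ, IsUnit γ.det ∧
    ∀ x y : ℤ, g.evalZ x y = f.evalZ (x * γ 0 0 + y * γ 1 0) (x * γ 0 1 + y * γ 1 1)

/-- Irreducibility of the form over `ℚ`: it has no factor of positive degree with
rational coefficients.  Equivalently, `a ≠ 0` (no root at infinity, i.e. no factor `y`)
and the dehomogenized quartic polynomial is irreducible over `ℚ`. -/
def Irred (f : BQF) : Prop :=
  f.a ≠ 0 ∧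
    Irreducible (Polynomial.C (f.a : ℚ) * Polynomial.X ^ 4 +
      Polynomial.C (f.b : ℚ) * Polynomial.X ^ 3 +
      Polynomial.C (f.c : ℚ) * Polynomial.X ^ 2 +
      Polynomial.C (f.d : ℚ) * Polynomial.X + Polynomial.C (f.e : ℚ))

/-- The set of real roots of `f`; for a form with `a ≠ 0` all roots of `f` in `ℙ¹(ℝ)`
have the shape `(z : 1)` with `z` real. -/
def realRoots (f : BQF) : Set ℝ := {z : ℝ | f.evalR z 1 = 0}

end BQF

/-- The number of `GL₂(ℤ)`-equivalence classes of integral binary quartic forms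
satisfying the predicate `P`. -/
noncomputable def classCount (P : BQF → Prop) : ℕ :=
  Nat.card (Quot fun f g : {h : BQF // P h} => BQF.Equivalent f.1 g.1)



namespace BQFC

noncomputable def E (x : ℝ) : ℂ := Complex.exp (Complex.I * ((2 * Real.pi * x : ℝ) : ℂ))

lemma E_add (x y : ℝ) : E (x + y) = E x * E y := by
  unfold E; rw [← Complex.exp_add]; congr 1; push_cast; ring

lemma E_norm (x : ℝ) : ‖E x‖ = 1 := by
  unfold E; rw [mul_comm]; exact Complex.norm_exp_ofReal_mul_I _

lemma E_conj (x : ℝ) : (starRingEnd ℂ) (E x) = E (-x) := by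
  unfold E; rw [← Complex.exp_conj, map_mul, Complex.conj_I, Complex.conj_ofReal]; congr 1; push_cast; ring

lemma E_nat_mul (n : ℕ) (x : ℝ) : E (n * x) = E x ^ n := by
  unfold E; rw [← Complex.exp_nat_mul]; congr 1; push_cast; ring

lemma E_sub_one (θ : ℝ) (h : |θ| ≤ 1 / 2) : 4 * |θ| ≤ ‖E θ - 1‖ := by
  unfold E
  rw [Complex.norm_exp_I_mul_ofReal_sub_one, norm_mul, Real.norm_eq_abs, Real.norm_eq_abs]
  have hp := Real.pi_pos
  have h1 : |2 * Real.pi * θ / 2| ≤ Real.pi / 2 := by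
    rw [show 2 * Real.pi * θ / 2 = Real.pi * θ by ring, abs_mul, abs_of_pos hp]; nlinarith
  have := Real.mul_abs_le_abs_sin h1
  rw [show 2 * Real.pi * θ / 2 = Real.pi * θ by ring, abs_mul, abs_of_pos hp] at this
  rw [show 2 * Real.pi * θ / 2 = Real.pi * θ by ring, abs_of_pos (by norm_num : (0:ℝ) < 2)]
  have e : 2 / Real.pi * (Real.pi * |θ|) = 2 * |θ| := by field_simp
  linarith

lemma geom_bound (θ : ℝ) (h0 : θ ≠ 0) (h : |θ| ≤ 1 / 2) (N : ℕ) :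
    ‖∑ k ∈ Finset.range N, E (k * θ)‖ ≤ 1 / (2 * |θ|) := by
  have hpos : 0 < |θ| := abs_pos.mpr h0
  have h1 := E_sub_one θ h
  have hne : E θ ≠ 1 := by
    intro hh; rw [hh] at h1; simp at h1; first | exact h0 h1 | linarith
  simp_rw [E_nat_mul]
  rw [geom_sum_eq hne, norm_div]
  have h2 : ‖E θ ^ N - 1‖ ≤ 2 := by
    calc _ ≤ ‖E θ ^ N‖ + ‖(1:ℂ)‖ := norm_sub_le _ _
      _ = 2 := by rw [norm_pow, E_norm]; norm_num
  calc _ ≤ 2 / (4 * |θ|) := by gcongr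
    _ = _ := by field_simp; norm_num

lemma shift_sum (u : ℕ → ℂ) (hu : ∀ k, ‖u k‖ ≤ 1) (N j : ℕ) :
    ‖∑ k ∈ Finset.range N, u k - ∑ k ∈ Finset.range N, u (k + j)‖ ≤ 2 * j := by
  have h1 : ∑ k ∈ Finset.range (N + j), u k
      = ∑ k ∈ Finset.range N, u k + ∑ k ∈ Finset.range j, u (N + k) := Finset.sum_range_add _ _ _
  have h2 : ∑ k ∈ Finset.range (N + j), u k
      = ∑ k ∈ Finset.range j, u k + ∑ k ∈ Finset.range N, u (k + j) := by
    rw [add_comm N j, Finset.sum_range_add]; congr 1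
    exact Finset.sum_congr rfl fun k _ => by rw [add_comm]
  have h3 : ∑ k ∈ Finset.range N, u k - ∑ k ∈ Finset.range N, u (k + j)
     = ∑ k ∈ Finset.range j, u k - ∑ k ∈ Finset.range j, u (N + k) := by
    have := h1.symm.trans h2
    linear_combination this
  rw [h3]
  have b : ∀ v : ℕ → ℂ, (∀ k, ‖v k‖ ≤ 1) → ‖∑ k ∈ Finset.range j, v k‖ ≤ j := by
    intro v hv
    calc _ ≤ ∑ k ∈ Finset.range j, ‖v k‖ := norm_sum_le _ _
      _ ≤ ∑ k ∈ Finset.range j, (1:ℝ) := Finset.sum_le_sum fun k _ => hv k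
      _ = j := by simp
  calc _ ≤ _ := norm_sub_le _ _
    _ ≤ j + j := add_le_add (b _ hu) (b _ fun k => hu _)
    _ = _ := by ring

/-- quadratic Weyl sums -/
lemma weyl (c1 c2 : ℝ) (hc1 : 0 < c1) (ε : ℝ) (hε : 0 < ε) :
    ∃ N0 : ℕ, ∀ N : ℕ, N0 ≤ N → ∀ α β : ℝ, c1 ≤ |α| * N → |α| * N ≤ c2 →
      ‖∑ k ∈ Finset.range N, E (α * k ^ 2 + β * k)‖ ≤ ε * N := by
  obtain ⟨H, hH⟩ := exists_nat_gt (4 * (1 + 1 / (4 * c1)) / ε ^ 2 + 1)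
  have hA : 0 < 1 + 1 / (4 * c1) := by positivity
  have hH1 : (1:ℝ) < H := lt_of_le_of_lt (by have : 0 < 4 * (1 + 1 / (4 * c1)) / ε ^ 2 := by positivity
                                             linarith) hH
  have hH2 : (1 + 1 / (4 * c1)) / H ≤ (ε / 2) ^ 2 := by
    have : 4 * (1 + 1 / (4 * c1)) / ε ^ 2 < H := by linarith
    rw [div_lt_iff₀ (by positivity)] at this
    rw [div_le_iff₀ (by linarith)]; linarith
  obtain ⟨N0, hN0⟩ := exists_nat_gt (4 * |c2| * H ^ 2 + 4 * H ^ 2 / ε + 1)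
  refine ⟨N0, fun N hN α β h1 h2 => ?_⟩
  have hNR : 4 * |c2| * H ^ 2 + 4 * H ^ 2 / ε + 1 < N := lt_of_lt_of_le hN0 (by exact_mod_cast hN)
  have hc2 : c2 ≤ |c2| := le_abs_self _
  have t1 : 0 ≤ 4 * |c2| * (H:ℝ) ^ 2 := by positivity
  have t2 : 0 ≤ 4 * (H:ℝ) ^ 2 / ε := by positivity
  have hNpos : (0:ℝ) < N := by linarith
  have hαpos : 0 < |α| := by
    by_contra hh
    have : |α| = 0 := le_antisymm (not_lt.mp hh) (abs_nonneg _)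
    rw [this] at h1; linarith
  set u : ℕ → ℂ := fun k => E (α * k ^ 2 + β * k) with hu
  have hu1 : ∀ k, ‖u k‖ ≤ 1 := fun k => (E_norm _).le
  set S := ∑ k ∈ Finset.range N, u k with hS
  -- averaged
  set D := ∑ k ∈ Finset.range N, ∑ j ∈ Finset.range H, u (k + j * H) with hD
  have hSD : ‖H * S - D‖ ≤ 2 * (H:ℝ) ^ 3 := by
    have : H * S - D = ∑ j ∈ Finset.range H, (S - ∑ k ∈ Finset.range N, u (k + j * H)) := by
      rw [Finset.sum_sub_distrib, hD, Finset.sum_comm]; simp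
    rw [this]
    calc _ ≤ ∑ j ∈ Finset.range H, ‖S - ∑ k ∈ Finset.range N, u (k + j * H)‖ := norm_sum_le _ _
      _ ≤ ∑ j ∈ Finset.range H, (2 * (H:ℝ) ^ 2) := by
        refine Finset.sum_le_sum fun j hj => ?_
        refine (shift_sum u hu1 N (j * H)).trans ?_
        have : (j:ℝ) ≤ H := by exact_mod_cast (Finset.mem_range.mp hj).le
        push_cast; linarith [mul_le_mul_of_nonneg_right this (by linarith : (0:ℝ) ≤ H)]
      _ = _ := by simp; ring
  have hcs : ‖D‖ ^ 2 ≤ N * ∑ k ∈ Finset.range N, ‖∑ j ∈ Finset.range H, u (k + j * H)‖ ^ 2 := by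
    calc ‖D‖ ^ 2 ≤ (∑ k ∈ Finset.range N, ‖∑ j ∈ Finset.range H, u (k + j * H)‖) ^ 2 := by
          gcongr; exact norm_sum_le _ _
      _ ≤ _ := by
        have := sq_sum_le_card_mul_sum_sq (s := Finset.range N)
          (f := fun k => ‖∑ j ∈ Finset.range H, u (k + j * H)‖)
        simpa using this
  have hexp : ((∑ k ∈ Finset.range N, ‖∑ j ∈ Finset.range H, u (k + j * H)‖ ^ 2 : ℝ) : ℂ)
      = ∑ j ∈ Finset.range H, ∑ j' ∈ Finset.range H, ∑ k ∈ Finset.range N,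
          u (k + j * H) * (starRingEnd ℂ) (u (k + j' * H)) := by
    push_cast
    have : ∀ k, ((‖∑ j ∈ Finset.range H, u (k + j * H)‖ : ℂ)) ^ 2
        = ∑ j ∈ Finset.range H, ∑ j' ∈ Finset.range H,
          u (k + j * H) * (starRingEnd ℂ) (u (k + j' * H)) := by
      intro k
      rw [← Complex.mul_conj', map_sum, Finset.sum_mul_sum]
    simp_rw [this]
    rw [Finset.sum_comm]
    refine Finset.sum_congr rfl fun j _ => Finset.sum_comm
  have hpair : ∀ j ∈ Finset.range H, ∀ j' ∈ Finset.range H,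
      ‖∑ k ∈ Finset.range N, u (k + j * H) * (starRingEnd ℂ) (u (k + j' * H))‖
        ≤ (if j = j' then (N:ℝ) else 0) + N / (4 * c1 * H) := by
    intro j hj j' hj'
    have hnn : 0 ≤ (N:ℝ) / (4 * c1 * H) := by positivity
    split_ifs with hjj
    · have : ‖∑ k ∈ Finset.range N, u (k + j * H) * (starRingEnd ℂ) (u (k + j' * H))‖ ≤ N := by
        calc _ ≤ ∑ k ∈ Finset.range N, ‖u (k + j * H) * (starRingEnd ℂ) (u (k + j' * H))‖ :=
              norm_sum_le _ _
          _ = N := by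
            simp only [norm_mul, RCLike.norm_conj, hu, E_norm]; simp
      linarith
    · set dj : ℝ := (j:ℝ) - j' with hdj
      have hd1 : 1 ≤ |dj| := by
        have : (1:ℤ) ≤ |(j:ℤ) - j'| := Int.one_le_abs (by omega)
        rw [hdj]; exact_mod_cast this
      have hd2 : |dj| ≤ H := by
        have a1 := Finset.mem_range.mp hj
        have a2 := Finset.mem_range.mp hj'
        have : |(j:ℤ) - j'| ≤ H := by rw [abs_le]; constructor <;> omega
        rw [hdj]; exact_mod_cast this
      set θ : ℝ := 2 * α * H * dj with hθ
      have hθa : |θ| = 2 * |α| * H * |dj| := by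
        rw [hθ, abs_mul, abs_mul, abs_mul]; simp
      have e1 : ∀ k : ℕ, u (k + j * H) * (starRingEnd ℂ) (u (k + j' * H))
          = E (α * ((j * H) ^ 2 - (j' * H) ^ 2) + β * (j * H - j' * H)) * E (k * θ) := by
        intro k
        simp only [hu]
        rw [E_conj, ← E_add, ← E_add]; congr 1; push_cast; rw [hθ, hdj]; ring
      simp_rw [e1]
      rw [← Finset.mul_sum, norm_mul, E_norm, one_mul]
      have hθ0 : θ ≠ 0 := by
        rw [← abs_pos, hθa]; have : 0 < |dj| := by linarith
        positivity
      have hθs : |θ| ≤ 1 / 2 := by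
        rw [hθa]
        have : 4 * |α| * H * |dj| ≤ 1 := by
          have a1 : 4 * |α| * H * |dj| ≤ 4 * |α| * H * H := by gcongr
          have a2 : (4 * |α| * H * H) * N ≤ 1 * N := by
            calc _ = 4 * (|α| * N) * (H:ℝ) ^ 2 := by ring
              _ ≤ 4 * |c2| * (H:ℝ) ^ 2 := by gcongr; linarith
              _ ≤ _ := by linarith
          exact a1.trans (le_of_mul_le_mul_right a2 hNpos)
        linarith
      refine (geom_bound θ hθ0 hθs N).trans ?_
      rw [zero_add, hθa, div_le_div_iff₀ (by have : 0 < |dj| := by linarith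
                                             positivity) (by positivity)]
      calc 1 * (4 * c1 * H) ≤ 4 * (|α| * N) * H * 1 := by linarith [mul_le_mul_of_nonneg_right h1 (by linarith : (0:ℝ) ≤ H)]
        _ ≤ 4 * (|α| * N) * H * |dj| := by gcongr
        _ = _ := by ring
  have hsum : ∑ k ∈ Finset.range N, ‖∑ j ∈ Finset.range H, u (k + j * H)‖ ^ 2
      ≤ N * H * (1 + 1 / (4 * c1)) := by
    have e0 : ∑ k ∈ Finset.range N, ‖∑ j ∈ Finset.range H, u (k + j * H)‖ ^ 2
      = ‖((∑ k ∈ Finset.range N, ‖∑ j ∈ Finset.range H, u (k + j * H)‖ ^ 2 : ℝ) : ℂ)‖ := by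
      rw [Complex.norm_real, Real.norm_eq_abs, abs_of_nonneg (by positivity)]
    rw [e0, hexp]
    calc _ ≤ ∑ j ∈ Finset.range H, ∑ j' ∈ Finset.range H,
          ((if j = j' then (N:ℝ) else 0) + N / (4 * c1 * H)) := by
          refine (norm_sum_le _ _).trans (Finset.sum_le_sum fun j hj => ?_)
          exact (norm_sum_le _ _).trans (Finset.sum_le_sum fun j' hj' => hpair j hj j' hj')
      _ = _ := by
          simp only [Finset.sum_add_distrib, Finset.sum_ite_eq, Finset.sum_const, Finset.card_range,
            nsmul_eq_mul]
          rw [Finset.sum_congr rfl (g := fun _ => (N:ℝ)) (fun x hx => by rw [if_pos hx])]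
          simp; field_simp
  have hD2 : ‖D‖ ≤ H * N * (ε / 2) := by
    refine (pow_le_pow_iff_left₀ (norm_nonneg _) (by positivity) two_ne_zero).mp ?_
    calc ‖D‖ ^ 2 ≤ N * (N * H * (1 + 1 / (4 * c1))) := hcs.trans (by gcongr)
      _ = (H * N) ^ 2 * ((1 + 1 / (4 * c1)) / H) := by field_simp
      _ ≤ (H * N) ^ 2 * (ε / 2) ^ 2 := by gcongr
      _ = _ := by ring
  have hfin : H * ‖S‖ ≤ H * (ε * N) := by
    have : ‖(H:ℂ) * S‖ = H * ‖S‖ := by rw [norm_mul]; simp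
    rw [← this]
    calc ‖(H:ℂ) * S‖ = ‖(H * S - D) + D‖ := by ring_nf
      _ ≤ 2 * (H:ℝ) ^ 3 + H * N * (ε / 2) := (norm_add_le _ _).trans (add_le_add hSD hD2)
      _ ≤ _ := by
        have : 4 * (H:ℝ) ^ 2 / ε < N := by linarith
        rw [div_lt_iff₀ hε] at this
        linarith [mul_le_mul_of_nonneg_left this.le (by linarith : (0:ℝ) ≤ H)]
  exact le_of_mul_le_mul_left hfin (by linarith)

end BQFC


namespace BQFC
open MeasureTheory

lemma equi_cont (c1 c2 : ℝ) (hc1 : 0 < c1) (h : C(UnitAddCircle, ℂ)) (ε : ℝ) (hε : 0 < ε) :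
    ∃ N0 : ℕ, ∀ N : ℕ, N0 ≤ N → ∀ α β γ : ℝ, c1 ≤ |α| * N → |α| * N ≤ c2 →
      ‖∑ k ∈ Finset.range N, h ((α * k ^ 2 + β * k + γ : ℝ) : UnitAddCircle)
        - N * ∫ t, h t‖ ≤ ε * N := by
  have hint : ∀ g : C(UnitAddCircle, ℂ), Integrable (fun t => g t) (volume : Measure UnitAddCircle) :=
    fun g => g.continuous.integrable_of_hasCompactSupport (HasCompactSupport.of_compactSpace _)
  have hspan : ∀ g ∈ Submodule.span ℂ (Set.range (@fourier (1:ℝ))), ∀ ε : ℝ, 0 < ε →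
      ∃ N0 : ℕ, ∀ N : ℕ, N0 ≤ N → ∀ α β γ : ℝ, c1 ≤ |α| * N → |α| * N ≤ c2 →
      ‖∑ k ∈ Finset.range N, g ((α * k ^ 2 + β * k + γ : ℝ) : UnitAddCircle)
        - N * ∫ t : UnitAddCircle, g t‖ ≤ ε * N := by
    intro g hg
    induction hg using Submodule.span_induction with
    | mem x hx =>
      obtain ⟨n, rfl⟩ := hx
      intro ε hε
      by_cases hn : n = 0
      · subst hn
        refine ⟨0, fun N _ α β γ _ _ => ?_⟩
        have : (0:ℝ) ≤ ε * N := by positivity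
        simpa [Measure.real, AddCircle.measure_univ] using this
      · have hi : ∫ t : UnitAddCircle, fourier n t = 0 :=
          integral_eq_zero_of_add_right_eq_neg (μ := volume)
            (fourier_add_half_inv_index hn one_pos)
        have hn' : 0 < |(n:ℝ)| := by simpa using hn
        obtain ⟨N0, hN0⟩ := weyl (c1 * |(n:ℝ)|) (c2 * |(n:ℝ)|) (by positivity) ε hε
        refine ⟨N0, fun N hN α β γ h1 h2 => ?_⟩
        rw [hi, mul_zero, sub_zero]
        have e : ∀ k : ℕ, (fourier n ((α * k ^ 2 + β * k + γ : ℝ) : UnitAddCircle))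
            = E (n * γ) * E ((n * α) * k ^ 2 + (n * β) * k) := by
          intro k
          rw [fourier_coe_apply, ← E_add]; unfold E; congr 1; push_cast; ring
        simp_rw [e]
        rw [← Finset.mul_sum, norm_mul, E_norm, one_mul]
        apply hN0 N hN
        · rw [abs_mul]; nlinarith
        · rw [abs_mul]; nlinarith
    | zero => intro ε hε; exact ⟨0, fun N _ α β γ _ _ => by simp; positivity⟩
    | add x y hx hy ihx ihy =>
      intro ε hε
      obtain ⟨N1, h1⟩ := ihx (ε / 2) (by positivity)
      obtain ⟨N2, h2⟩ := ihy (ε / 2) (by positivity)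
      refine ⟨max N1 N2, fun N hN α β γ ha hb => ?_⟩
      have a1 := h1 N (le_trans (le_max_left _ _) hN) α β γ ha hb
      have a2 := h2 N (le_trans (le_max_right _ _) hN) α β γ ha hb
      simp only [ContinuousMap.add_apply]
      rw [integral_add (hint x) (hint y), Finset.sum_add_distrib, mul_add, add_sub_add_comm]
      refine (norm_add_le _ _).trans ?_
      linarith
    | smul c x hx ih =>
      intro ε hε
      obtain ⟨N1, h1⟩ := ih (ε / (‖c‖ + 1)) (by positivity)
      refine ⟨N1, fun N hN α β γ ha hb => ?_⟩
      have a1 := h1 N hN α β γ ha hb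
      simp only [ContinuousMap.smul_apply]
      rw [integral_smul, ← Finset.smul_sum, smul_eq_mul, smul_eq_mul,
        show ∀ a b d : ℂ, c * a - b * (c * d) = c * (a - b * d) by intros; ring, norm_mul]
      calc _ ≤ (‖c‖ + 1) * (ε / (‖c‖ + 1) * N) := by gcongr; linarith
        _ = _ := by field_simp
  have hcl : h ∈ closure ((Submodule.span ℂ (Set.range (@fourier (1:ℝ))) : Submodule ℂ _) : Set C(UnitAddCircle, ℂ)) := by
    have := span_fourier_closure_eq_top (T := 1)
    rw [← Submodule.topologicalClosure_coe, this]; trivial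
  obtain ⟨g, hg, hgd⟩ := Metric.mem_closure_iff.mp hcl (ε / 3) (by positivity)
  obtain ⟨N0, hN0⟩ := hspan g hg (ε / 3) (by positivity)
  refine ⟨N0, fun N hN α β γ h1 h2 => ?_⟩
  have a1 := hN0 N hN α β γ h1 h2
  have hd : ∀ t, ‖h t - g t‖ ≤ ε / 3 := fun t => by
    rw [← dist_eq_norm]; exact (ContinuousMap.dist_apply_le_dist t).trans hgd.le
  have b1 : ‖∑ k ∈ Finset.range N, h ((α * k ^ 2 + β * k + γ : ℝ) : UnitAddCircle)
      - ∑ k ∈ Finset.range N, g ((α * k ^ 2 + β * k + γ : ℝ) : UnitAddCircle)‖ ≤ N * (ε / 3) := by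
    rw [← Finset.sum_sub_distrib]
    refine (norm_sum_le_of_le _ (fun k _ => hd _)).trans ?_
    simp
  have b2 : ‖(∫ t : UnitAddCircle, g t) - ∫ t : UnitAddCircle, h t‖ ≤ ε / 3 := by
    rw [← integral_sub (hint g) (hint h)]
    have := norm_integral_le_of_norm_le_const (μ := (volume : Measure UnitAddCircle))
      (f := fun t => g t - h t) (C := ε / 3)
      (Filter.Eventually.of_forall fun t => by rw [norm_sub_rev]; exact hd t)
    simpa [Measure.real] using this
  calc _ = ‖(∑ k ∈ Finset.range N, h ((α * k ^ 2 + β * k + γ : ℝ) : UnitAddCircle)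
      - ∑ k ∈ Finset.range N, g ((α * k ^ 2 + β * k + γ : ℝ) : UnitAddCircle))
      + (∑ k ∈ Finset.range N, g ((α * k ^ 2 + β * k + γ : ℝ) : UnitAddCircle)
        - N * ∫ t : UnitAddCircle, g t) + N * ((∫ t : UnitAddCircle, g t) - ∫ t : UnitAddCircle, h t)‖ := by
        congr 1; ring
    _ ≤ N * (ε / 3) + ε / 3 * N + N * (ε / 3) := by
        refine (norm_add₃_le).trans (add_le_add_three b1 a1 ?_)
        rw [norm_mul]; simp only [Complex.norm_natCast]; gcongr
    _ = _ := by ring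

lemma arc_count (c1 c2 : ℝ) (hc1 : 0 < c1) (r : ℝ) (hr : 0 ≤ r) (ε : ℝ) (hε : 0 < ε) :
    ∃ N0 : ℕ, ∀ N : ℕ, N0 ≤ N → ∀ α β γ : ℝ, c1 ≤ |α| * N → |α| * N ≤ c2 →
      (((Finset.range N).filter (fun k : ℕ =>
        ‖((α * k ^ 2 + β * k + γ : ℝ) : UnitAddCircle)‖ ≤ r)).card : ℝ) ≤ (2 * r + ε) * N := by
  set τ := ε / 4 with hτ
  have hτ0 : 0 < τ := by positivity
  let hr' : UnitAddCircle → ℝ := fun y => max 0 (1 - max 0 (‖y‖ - r) / τ)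
  have hcont : Continuous hr' := by fun_prop
  let h : C(UnitAddCircle, ℂ) := ⟨fun y => (hr' y : ℂ), Complex.continuous_ofReal.comp hcont⟩
  obtain ⟨N0, hN0⟩ := equi_cont c1 c2 hc1 h (ε / 2) (by positivity)
  refine ⟨N0, fun N hN α β γ h1 h2 => ?_⟩
  have a1 := hN0 N hN α β γ h1 h2
  have hI : ∫ t : UnitAddCircle, h t = ((∫ t : UnitAddCircle, hr' t : ℝ) : ℂ) := integral_ofReal
  have hle : ∫ t : UnitAddCircle, hr' t ≤ 2 * (r + τ) := by
    have hh : ∀ t, hr' t ≤ Set.indicator (Metric.closedBall (0:UnitAddCircle) (r + τ)) (fun _ => (1:ℝ)) t := by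
      intro t
      by_cases ht : t ∈ Metric.closedBall (0:UnitAddCircle) (r + τ)
      · rw [Set.indicator_of_mem ht]
        apply max_le zero_le_one
        have : 0 ≤ max 0 (‖t‖ - r) / τ := by positivity
        linarith
      · rw [Set.indicator_of_notMem ht]
        apply max_le le_rfl
        rw [mem_closedBall_zero_iff, not_le] at ht
        have : 1 ≤ max 0 (‖t‖ - r) / τ := by
          rw [le_div_iff₀ hτ0]; exact le_trans (by linarith) (le_max_right _ _)
        linarith
    calc _ ≤ ∫ t : UnitAddCircle, Set.indicator (Metric.closedBall (0:UnitAddCircle) (r + τ)) (fun _ => (1:ℝ)) t := by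
          apply integral_mono _ _ hh
          · exact hcont.integrable_of_hasCompactSupport (HasCompactSupport.of_compactSpace _)
          · exact (integrable_const _).indicator Metric.isClosed_closedBall.measurableSet
      _ = (volume (Metric.closedBall (0:UnitAddCircle) (r + τ))).toReal := by
          rw [integral_indicator Metric.isClosed_closedBall.measurableSet]; simp [Measure.real]
      _ ≤ _ := by
          rw [AddCircle.volume_closedBall, ENNReal.toReal_ofReal (by positivity)]
          exact min_le_right _ _
  have hs : (((Finset.range N).filter (fun k : ℕ =>
        ‖((α * k ^ 2 + β * k + γ : ℝ) : UnitAddCircle)‖ ≤ r)).card : ℝ) ≤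
        ∑ k ∈ Finset.range N, hr' ((α * k ^ 2 + β * k + γ : ℝ) : UnitAddCircle) := by
    rw [Finset.card_filter]; push_cast
    refine Finset.sum_le_sum fun k _ => ?_
    split_ifs with hk
    · refine le_trans ?_ (le_max_right _ _)
      rw [max_eq_left (by linarith)]; simp
    · exact le_max_left _ _
  have hsum : ∑ k ∈ Finset.range N, h ((α * k ^ 2 + β * k + γ : ℝ) : UnitAddCircle)
     = ((∑ k ∈ Finset.range N, hr' ((α * k ^ 2 + β * k + γ : ℝ) : UnitAddCircle) : ℝ) : ℂ) := by
    push_cast; rfl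
  rw [hI, hsum] at a1
  have : |∑ k ∈ Finset.range N, hr' ((α * k ^ 2 + β * k + γ : ℝ) : UnitAddCircle)
      - N * ∫ t : UnitAddCircle, hr' t| ≤ ε / 2 * N := by
    rw [← Real.norm_eq_abs, ← Complex.norm_real]; push_cast; push_cast at a1; exact a1
  have := (abs_le.mp this).2
  have hNn : (0:ℝ) ≤ N := by positivity
  have : (N:ℝ) * ∫ t : UnitAddCircle, hr' t ≤ N * (2 * (r + τ)) := by gcongr
  rw [hτ] at this
  linarith

lemma icc_count (c1 c2 : ℝ) (hc1 : 0 < c1) (W : ℝ) (hW : 0 ≤ W) (ε : ℝ) (hε : 0 < ε) :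
    ∃ N0 : ℕ, ∀ N : ℕ, N0 ≤ N → ∀ α β γ : ℝ, c1 ≤ |α| * N → |α| * N ≤ c2 →
      ∀ w, 0 ≤ w → w ≤ W →
      ∑ k ∈ Finset.range N, ((Finset.Icc ⌈(α * k ^ 2 + β * k + γ : ℝ)⌉
         ⌊α * k ^ 2 + β * k + γ + w⌋).card : ℝ) ≤ (w + ε) * N := by
  obtain ⟨Q, hQ⟩ := exists_nat_gt (2 / ε + 2)
  have hQ0 : (2:ℝ) < Q := by have : 0 < 2 / ε := by positivity
                             linarith
  have hQ1 : 1 / (Q:ℝ) < ε / 2 := by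
    rw [div_lt_div_iff₀ (by linarith) (by norm_num)]
    have : 2 / ε < Q := by linarith
    rw [div_lt_iff₀ hε] at this; linarith
  obtain ⟨N0, hN0⟩ := arc_count c1 c2 hc1 (1 / (2 * Q)) (by positivity) (ε / (2 * (W * Q + 1)))
    (by positivity)
  refine ⟨N0, fun N hN α β γ h1 h2 w hw hwW => ?_⟩
  set n := ⌊w * Q⌋₊ + 1 with hn
  have hQp : (0:ℝ) < Q := by linarith
  have hnle : (n:ℝ) ≤ w * Q + 1 := by
    rw [hn]; push_cast; linarith [Nat.floor_le (by positivity : 0 ≤ w * Q)]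
  have key : ∀ x : ℝ, (Finset.Icc ⌈x⌉ ⌊x + w⌋).card ≤
      ((Finset.range n).filter (fun i : ℕ => ‖((x + (i + 1/2) / Q : ℝ) : UnitAddCircle)‖ ≤ 1 / (2 * Q))).card := by
    intro x
    have hfl : ∀ l : ℤ, l ∈ Finset.Icc ⌈x⌉ ⌊x + w⌋ → x ≤ l ∧ (l:ℝ) ≤ x + w ∧
        (⌊(l - x) * Q⌋₊ : ℝ) ≤ (l - x) * Q ∧ (l - x) * Q < ⌊(l - x) * Q⌋₊ + 1 := by
      intro l hl
      rw [Finset.mem_Icc, Int.ceil_le, Int.le_floor] at hl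
      refine ⟨hl.1, hl.2, Nat.floor_le (mul_nonneg (by linarith [hl.1]) hQp.le), Nat.lt_floor_add_one _⟩
    refine Finset.card_le_card_of_injOn (fun l : ℤ => ⌊(l - x) * Q⌋₊) ?_ ?_
    · intro l hl
      obtain ⟨a1, a2, a3, a4⟩ := hfl l hl
      simp only [Finset.coe_filter, Finset.mem_range, Set.mem_ofPred_eq]
      constructor
      · rw [hn, Nat.lt_add_one_iff]
        apply Nat.floor_mono; gcongr; linarith
      · have e : ((x + ((⌊(l - x) * Q⌋₊:ℝ) + 1/2) / Q : ℝ) : UnitAddCircle)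
            = ((x + ((⌊(l - x) * Q⌋₊:ℝ) + 1/2) / Q - l : ℝ) : UnitAddCircle) := by
          rw [eq_comm, ← sub_eq_zero, ← AddCircle.coe_sub, AddCircle.coe_eq_zero_iff]
          exact ⟨-l, by simp⟩
        rw [e]
        refine le_trans (QuotientAddGroup.norm_mk_le_norm) ?_
        rw [Real.norm_eq_abs]
        have : x + ((⌊(l - x) * Q⌋₊:ℝ) + 1/2) / Q - l = (⌊(l - x) * Q⌋₊ + 1/2 - (l - x) * Q) / Q := by
          field_simp; ring
        rw [this, abs_div, abs_of_pos hQp, show 1 / (2 * (Q:ℝ)) = (1/2) / Q by field_simp]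
        gcongr
        rw [abs_le]; constructor <;> linarith
    · intro l hl l' hl' hll
      obtain ⟨a1, a2, a3, a4⟩ := hfl l hl
      obtain ⟨b1, b2, b3, b4⟩ := hfl l' hl'
      simp only at hll
      rw [← hll] at b3 b4
      have c1 : (l:ℝ) - l' < 1 := by
        by_contra hh; push Not at hh; nlinarith
      have c2 : (l':ℝ) - l < 1 := by
        by_contra hh; push Not at hh; nlinarith
      have c1' : l - l' < 1 := by exact_mod_cast c1
      have c2' : l' - l < 1 := by exact_mod_cast c2
      omega
  calc _ ≤ ∑ k ∈ Finset.range N, ∑ i ∈ Finset.range n,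
        (if ‖((α * k ^ 2 + β * k + (γ + (i + 1/2) / Q) : ℝ) : UnitAddCircle)‖ ≤ 1 / (2 * Q) then (1:ℝ) else 0) := by
        refine Finset.sum_le_sum fun k _ => ?_
        refine (Nat.cast_le.mpr (key _)).trans ?_
        rw [Finset.card_filter]; push_cast
        simp only [add_assoc]; rfl
    _ = ∑ i ∈ Finset.range n, (((Finset.range N).filter (fun k : ℕ =>
        ‖((α * k ^ 2 + β * k + (γ + (i + 1/2) / Q) : ℝ) : UnitAddCircle)‖ ≤ 1 / (2 * Q))).card : ℝ) := by
        rw [Finset.sum_comm]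
        refine Finset.sum_congr rfl fun i _ => ?_
        rw [Finset.card_filter]; push_cast; rfl
    _ ≤ ∑ i ∈ Finset.range n, (2 * (1 / (2 * Q)) + ε / (2 * (W * Q + 1))) * N :=
        Finset.sum_le_sum fun i _ => hN0 N hN α β _ h1 h2
    _ = n * (1 / Q + ε / (2 * (W * Q + 1))) * N := by
        rw [Finset.sum_const, Finset.card_range, nsmul_eq_mul]; field_simp
    _ ≤ (w + ε) * N := by
        gcongr
        calc _ ≤ (w * Q + 1) * (1 / Q + ε / (2 * (W * Q + 1))) := by gcongr
          _ = w + 1 / Q + (ε / 2) * ((w * Q + 1) / (W * Q + 1)) := by field_simp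
          _ ≤ w + ε / 2 + (ε / 2) * 1 := by
            gcongr
            rw [div_le_one (by positivity)]; gcongr
          _ = _ := by ring

/-- number of integers strictly within `ρ` of `x` -/
noncomputable def cnt (x ρ : ℝ) : ℕ := (Finset.Ioo ⌊x - ρ⌋ ⌈x + ρ⌉).card

lemma cnt_equi (c1 c2 : ℝ) (hc1 : 0 < c1) (R : ℝ) (hR : 0 ≤ R) (ε : ℝ) (hε : 0 < ε) :
    ∃ N0 : ℕ, ∀ N : ℕ, N0 ≤ N → ∀ α β γ : ℝ, c1 ≤ |α| * N → |α| * N ≤ c2 →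
      ∀ ρ, 0 ≤ ρ → ρ ≤ R →
      |∑ k ∈ Finset.range N, ((cnt (α * k ^ 2 + β * k + γ) ρ : ℝ) - 2 * ρ)| ≤ ε * N := by
  obtain ⟨n, hn⟩ := exists_nat_gt (2 * R)
  obtain ⟨N0, hN0⟩ := icc_count c1 c2 hc1 (2 * R + n) (by positivity) ε hε
  refine ⟨N0, fun N hN α β γ h1 h2 ρ hρ hρR => ?_⟩
  have hn0 : (0:ℝ) ≤ n := by positivity
  have u := hN0 N hN α β (γ - ρ) h1 h2 (2 * ρ) (by linarith) (by linarith)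
  have l := hN0 N hN α β (γ + ρ) h1 h2 (n - 2 * ρ) (by linarith) (by linarith)
  rw [Finset.sum_sub_distrib, abs_le]
  simp only [Finset.sum_const, Finset.card_range, nsmul_eq_mul]
  have hu : ∀ x : ℝ, cnt x ρ ≤ (Finset.Icc ⌈x - ρ⌉ ⌊x - ρ + 2 * ρ⌋).card := by
    intro x
    apply Finset.card_le_card
    intro z hz
    rw [Finset.mem_Ioo, Int.floor_lt, Int.lt_ceil] at hz
    rw [Finset.mem_Icc, Int.ceil_le, Int.le_floor]
    constructor <;> linarith
  have hl : ∀ x : ℝ, n ≤ cnt x ρ + (Finset.Icc ⌈x + ρ⌉ ⌊x + ρ + (n - 2 * ρ)⌋).card := by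
    intro x
    have : ⌊x + ρ + (n - 2 * ρ)⌋ = ⌊x - ρ⌋ + n := by
      rw [← Int.floor_add_natCast]; congr 1; ring
    rw [this, cnt, Int.card_Ioo, Int.card_Icc]
    omega
  constructor
  · have : ∑ k ∈ Finset.range N, (n:ℝ) ≤ ∑ k ∈ Finset.range N, ((cnt (α * k ^ 2 + β * k + γ) ρ : ℝ)
       + ((Finset.Icc ⌈(α * k ^ 2 + β * k + (γ + ρ) : ℝ)⌉
         ⌊α * k ^ 2 + β * k + (γ + ρ) + (n - 2 * ρ)⌋).card : ℝ)) := by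
      refine Finset.sum_le_sum fun k _ => ?_
      have hh := hl (α * k ^ 2 + β * k + γ)
      rw [add_assoc (α * (k:ℝ) ^ 2 + β * k) γ ρ] at hh
      exact (Nat.cast_le.mpr hh).trans (Nat.cast_add _ _).le
    rw [Finset.sum_add_distrib, Finset.sum_const, Finset.card_range, nsmul_eq_mul] at this
    linarith
  · have : ∑ k ∈ Finset.range N, (cnt (α * k ^ 2 + β * k + γ) ρ : ℝ) ≤
       ∑ k ∈ Finset.range N, ((Finset.Icc ⌈(α * k ^ 2 + β * k + (γ - ρ) : ℝ)⌉
         ⌊α * k ^ 2 + β * k + (γ - ρ) + 2 * ρ⌋).card : ℝ) := by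
      refine Finset.sum_le_sum fun k _ => ?_
      have hh := hu (α * k ^ 2 + β * k + γ)
      rw [add_sub_assoc (α * (k:ℝ) ^ 2 + β * k) γ ρ] at hh
      exact Nat.cast_le.mpr hh
    linarith

end BQFC


namespace BQFC

lemma shift_avg (ψ D : ℤ → ℝ) (L N : ℕ) (hN : 1 ≤ N) (B K ω ε : ℝ) (hB0 : 0 ≤ B)
    (hω : 0 ≤ ω)
    (hsupp : ∀ d, ψ d ≠ 0 → |d| ≤ L) (hB : ∀ d, |ψ d| ≤ B) (hK : ∀ d, |D d| ≤ K)
    (hw : ∀ d, ∀ k < N, |ψ (d + (k:ℕ)) - ψ d| ≤ ω)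
    (hD : ∀ d, |∑ k ∈ Finset.range N, D (d + k)| ≤ ε * N) :
    |∑ d ∈ Finset.Icc (-(L:ℤ)) L, ψ d * D d| ≤ (2 * L + N + 1) * (B * ε + ω * K) := by
  have hK0 : 0 ≤ K := (abs_nonneg _).trans (hK 0)
  have hNp : (0:ℝ) < N := by exact_mod_cast hN
  set A := Finset.Icc (-(L:ℤ) - N) L with hA
  have hcard : (A.card : ℝ) = 2 * L + N + 1 := by
    rw [hA, Int.card_Icc]
    have : ((L:ℤ) + 1 - (-(L:ℤ) - N)).toNat = 2 * L + N + 1 := by omega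
    rw [this]; push_cast; ring
  have h1 : ∀ k ∈ Finset.range N, ∑ d ∈ Finset.Icc (-(L:ℤ)) L, ψ d * D d
      = ∑ d ∈ A, ψ (d + k) * D (d + k) := by
    intro k hk
    rw [Finset.mem_range] at hk
    refine Finset.sum_of_injOn (fun d => d - k) ?_ ?_ ?_ ?_
    · intro x _ y _ h; simpa using h
    · intro x hx; simp only [hA, Finset.coe_Icc, Set.mem_Icc] at hx ⊢; omega
    · intro x hx hx'
      have : ψ (x + k) = 0 := by
        by_contra hh
        have h2 := abs_le.mp (hsupp _ hh)
        exact hx' ⟨x + k, by simp only [Finset.coe_Icc, Set.mem_Icc]; omega, by simp⟩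
      rw [this, zero_mul]
    · intro x _; simp
  have h2 : N * ∑ d ∈ Finset.Icc (-(L:ℤ)) L, ψ d * D d
      = ∑ d ∈ A, ∑ k ∈ Finset.range N, ψ (d + k) * D (d + k) := by
    rw [Finset.sum_comm, ← Finset.sum_congr rfl h1]; simp
  have h3 : ∀ d ∈ A, |∑ k ∈ Finset.range N, ψ (d + k) * D (d + k)| ≤ N * (B * ε + ω * K) := by
    intro d _
    have : ∑ k ∈ Finset.range N, ψ (d + k) * D (d + k) = ψ d * ∑ k ∈ Finset.range N, D (d + k)
       + ∑ k ∈ Finset.range N, (ψ (d + k) - ψ d) * D (d + k) := by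
      rw [Finset.mul_sum, ← Finset.sum_add_distrib]
      exact Finset.sum_congr rfl fun k _ => by ring
    rw [this]
    calc _ ≤ B * (ε * N) + ∑ k ∈ Finset.range N, ω * K := by
          refine (abs_add_le _ _).trans (add_le_add ?_ ?_)
          · rw [abs_mul]; exact mul_le_mul (hB d) (hD d) (abs_nonneg _) hB0
          · refine (Finset.abs_sum_le_sum_abs _ _).trans (Finset.sum_le_sum fun k hk => ?_)
            rw [abs_mul]
            exact mul_le_mul (hw d k (Finset.mem_range.mp hk)) (hK _) (abs_nonneg _) hω
      _ = _ := by simp; ring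
  have h4 : N * |∑ d ∈ Finset.Icc (-(L:ℤ)) L, ψ d * D d| ≤ N * ((2 * L + N + 1) * (B * ε + ω * K)) := by
    rw [← abs_of_pos hNp, ← abs_mul, abs_of_pos hNp, h2]
    refine (Finset.abs_sum_le_sum_abs _ _).trans ((Finset.sum_le_sum h3).trans ?_)
    rw [Finset.sum_const, nsmul_eq_mul, hcard]; apply le_of_eq; ring
  exact le_of_mul_le_mul_left h4 hNp

abbrev V := ℝ × ℝ × ℝ × ℝ × ℝ

def pf (a b c : ℝ) : ℝ := 3 * b ^ 2 - 8 * a * c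
def qn (a b c d : ℝ) : ℝ := 9 * b * c * d - 27 * a * d ^ 2 - 2 * c ^ 3
def Jr (a b c d e : ℝ) : ℝ :=
  72 * a * c * e + 9 * b * c * d - 27 * a * d ^ 2 - 27 * e * b ^ 2 - 2 * c ^ 3
def Ir (a b c d e : ℝ) : ℝ := 12 * a * e - 3 * b * d + c ^ 2
noncomputable def qt (κ a b c d : ℝ) : ℝ := qn a b c d * pf a b c / (9 * max (pf a b c ^ 2) (κ ^ 2))

noncomputable def Ps (Φ : V → ℝ) (κ : ℝ) (v : ℝ × ℝ × ℝ × ℝ) : ℝ :=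
  Φ (v.1, v.2.1, v.2.2.1, v.2.2.2, qt κ v.1 v.2.1 v.2.2.1 v.2.2.2)

/-- test functions -/
structure Tst (Φ : V → ℝ) (M κ : ℝ) : Prop where
  cont : Continuous Φ
  M1 : 1 ≤ M
  κ0 : 0 < κ
  κ1 : κ ≤ 1
  bd : ∀ a b c d e, Φ (a, b, c, d, e) ≠ 0 → |a| ≤ M ∧ |b| ≤ M ∧ |c| ≤ M ∧ |d| ≤ M ∧ |e| ≤ M
  ka : ∀ a b c d e, Φ (a, b, c, d, e) ≠ 0 → κ ≤ |a|
  kp : ∀ a b c d e, Φ (a, b, c, d, e) ≠ 0 → κ ≤ |pf a b c|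

lemma Tst.compact {Φ M κ} (h : Tst Φ M κ) : HasCompactSupport Φ := by
  refine HasCompactSupport.intro (isCompact_closedBall (0:V) M) fun v hv => ?_
  by_contra hh
  apply hv
  obtain ⟨a, b, c, d, e⟩ := v
  obtain ⟨h1, h2, h3, h4, h5⟩ := h.bd a b c d e hh
  rw [mem_closedBall_zero_iff]
  simp only [Prod.norm_def, Real.norm_eq_abs]
  simp [*]

lemma qt_eq {κ a b c d : ℝ} (hκ : 0 < κ) (h : κ ≤ |pf a b c|) :
    qt κ a b c d = qn a b c d / (9 * pf a b c) := by
  have hp : pf a b c ≠ 0 := by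
    intro hh; rw [hh] at h; simp at h; linarith
  unfold qt
  rw [max_eq_left, pow_two]
  · field_simp
  · rw [← sq_abs (pf a b c)]; gcongr

lemma Ps_cont {Φ M κ} (h : Tst Φ M κ) : Continuous (Ps Φ κ) := by
  have hκ := h.κ0
  unfold Ps
  refine h.cont.comp ?_
  have : Continuous fun v : ℝ × ℝ × ℝ × ℝ => qt κ v.1 v.2.1 v.2.2.1 v.2.2.2 := by
    unfold qt qn pf
    refine Continuous.div (by fun_prop) (by fun_prop) fun v => ?_
    have : 0 < max ((3 * v.2.1 ^ 2 - 8 * v.1 * v.2.2.1) ^ 2) (κ ^ 2) := lt_max_of_lt_right (by positivity)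
    positivity
  fun_prop

/-- continuous compactly supported functions -/
lemma unif4 (Ψ : ℝ × ℝ × ℝ × ℝ → ℝ) (hc : Continuous Ψ) (M : ℝ)
    (hb : ∀ a b c d, Ψ (a, b, c, d) ≠ 0 → |a| ≤ M ∧ |b| ≤ M ∧ |c| ≤ M ∧ |d| ≤ M) (ω : ℝ) (hω : 0 < ω) :
    ∃ δ > 0, ∀ a b c d a' b' c' d', |a - a'| ≤ δ → |b - b'| ≤ δ → |c - c'| ≤ δ → |d - d'| ≤ δ →
      |Ψ (a, b, c, d) - Ψ (a', b', c', d')| ≤ ω := by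
  have hcs : HasCompactSupport Ψ := by
    refine HasCompactSupport.intro (isCompact_closedBall (0:ℝ × ℝ × ℝ × ℝ) M) fun v hv => ?_
    by_contra hh
    apply hv
    obtain ⟨a, b, c, d⟩ := v
    obtain ⟨h1, h2, h3, h4⟩ := hb a b c d hh
    rw [mem_closedBall_zero_iff]
    simp only [Prod.norm_def, Real.norm_eq_abs]
    simp [*]
  have hu := hcs.uniformContinuous_of_continuous hc
  obtain ⟨δ, hδ, h⟩ := Metric.uniformContinuous_iff.mp hu ω hω
  refine ⟨δ / 2, by positivity, fun a b c d a' b' c' d' h1 h2 h3 h4 => ?_⟩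
  rw [← Real.dist_eq]
  refine (h ?_).le
  simp only [Prod.dist_eq, Real.dist_eq, max_lt_iff]
  refine ⟨?_, ?_, ?_, ?_⟩ <;> linarith

lemma unif5 {Φ M κ} (h : Tst Φ M κ) (ω : ℝ) (hω : 0 < ω) :
    ∃ δ > 0, ∀ a b c d e e', |e - e'| ≤ δ →
      |Φ (a, b, c, d, e) - Φ (a, b, c, d, e')| ≤ ω := by
  have hu := h.compact.uniformContinuous_of_continuous h.cont
  obtain ⟨δ, hδ, h⟩ := Metric.uniformContinuous_iff.mp hu ω hω
  refine ⟨δ / 2, by positivity, fun a b c d e e' h1 => ?_⟩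
  rw [← Real.dist_eq]
  refine (h ?_).le
  simp only [Prod.dist_eq, Real.dist_eq, max_lt_iff, sub_self, abs_zero]
  refine ⟨hδ, hδ, hδ, hδ, ?_⟩; linarith

lemma Tst.bound {Φ M κ} (h : Tst Φ M κ) : ∃ B, 0 ≤ B ∧ ∀ v, |Φ v| ≤ B := by
  obtain ⟨B, hB⟩ := h.cont.bounded_above_of_compact_support h.compact
  exact ⟨B, (norm_nonneg _).trans (hB 0), hB⟩

lemma cnt_le (x ρ : ℝ) (hρ : 0 ≤ ρ) : (cnt x ρ : ℝ) ≤ 2 * ρ + 1 := by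
  unfold cnt
  rw [Int.card_Ioo]
  have h1 := Int.lt_floor_add_one (x - ρ)
  have h2 := Int.ceil_lt_add_one (x + ρ)
  have h3 : 0 ≤ 2 * ρ + 1 := by linarith
  rcases le_total 0 (⌈x + ρ⌉ - ⌊x - ρ⌋ - 1) with hh | hh
  · have : (((⌈x + ρ⌉ - ⌊x - ρ⌋ - 1).toNat : ℤ) : ℝ) = ((⌈x + ρ⌉ - ⌊x - ρ⌋ - 1 : ℤ) : ℝ) := by
      rw [Int.toNat_of_nonneg hh]
    rw [Int.cast_natCast] at this
    rw [this]; push_cast; linarith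
  · rw [Int.toNat_of_nonpos hh]; simpa using h3

lemma Jr_eq (a b c d e : ℝ) : Jr a b c d e = qn a b c d - 9 * pf a b c * e := by
  unfold Jr qn pf; ring

lemma J_iff {C s a b c d e : ℝ} (hp : pf a b c ≠ 0) :
    |Jr a b c d e| < C * s ^ 2 ↔ |e - qn a b c d / (9 * pf a b c)| < C * s ^ 2 / (9 * |pf a b c|) := by
  have hp' : 0 < |pf a b c| := abs_pos.mpr hp
  rw [lt_div_iff₀ (by positivity), Jr_eq]
  have : qn a b c d - 9 * pf a b c * e = -((e - qn a b c d / (9 * pf a b c)) * (9 * pf a b c)) := by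
    field_simp; ring
  rw [this, abs_neg, abs_mul, abs_mul (9:ℝ), abs_of_pos (by norm_num : (0:ℝ) < 9)]

open Classical in
noncomputable def w (Φ : V → ℝ) (C s a b c d e : ℝ) : ℝ :=
  if |Jr a b c d e| < C * s ^ 2 then Φ (a / s, b / s, c / s, d / s, e / s) else 0

lemma pf_scale (s a b c : ℝ) (hs : s ≠ 0) : pf (a / s) (b / s) (c / s) = pf a b c / s ^ 2 := by
  unfold pf; field_simp

lemma qn_scale (s a b c d : ℝ) (hs : s ≠ 0) :
    qn (a / s) (b / s) (c / s) (d / s) = qn a b c d / s ^ 3 := by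
  unfold qn; field_simp

/-- sum over `e` -/
lemma e_sum {Φ M κ} (h : Tst Φ M κ) (C : ℝ) (hC : 0 < C) (m : ℕ) (hm : 1 ≤ m) (ω : ℝ) (hω : 0 < ω) :
    ∃ s0 : ℝ, 1 ≤ s0 ∧ ∀ s, s0 ≤ s → ∀ a b c d : ℝ, κ * s ^ 2 ≤ |pf a b c| → ∀ r : ℤ, 0 ≤ r → r < m →
      ∀ L : ℕ, M * s + 1 ≤ L →
      |∑ e ∈ Finset.Icc (-(L:ℤ)) L, w Φ C s a b c d (r + m * e) -
        Ps Φ κ (a / s, b / s, c / s, d / s) *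
          cnt ((qn a b c d / (9 * pf a b c) - r) / m) (C * s ^ 2 / (9 * |pf a b c|) / m)| ≤
        ω * (2 * (C / (9 * κ)) + 1) := by
  obtain ⟨δ, hδ, hu⟩ := unif5 h ω hω
  have hκ := h.κ0
  refine ⟨1 + C / (9 * κ * δ), by have : 0 < C / (9 * κ * δ) := by positivity
                                  linarith, fun s hs a b c d hp r hr0 hrm L hL => ?_⟩
  have hs1 : 1 ≤ s := by have : 0 < C / (9 * κ * δ) := by positivity
                         linarith
  have hs0 : 0 < s := by linarith
  have hm0 : (0:ℝ) < m := by exact_mod_cast hm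
  have hm1 : (1:ℝ) ≤ m := by exact_mod_cast hm
  have hpp : 0 < |pf a b c| := lt_of_lt_of_le (by positivity) hp
  have hp0 : pf a b c ≠ 0 := abs_pos.mp hpp
  set q := qn a b c d / (9 * pf a b c) with hq
  set ρ := C * s ^ 2 / (9 * |pf a b c|) with hρ
  have hρ0 : 0 ≤ ρ := by positivity
  have hρ1 : ρ ≤ C / (9 * κ) := by
    rw [hρ, div_le_div_iff₀ (by positivity) (by positivity)]
    have : C * (κ * s ^ 2) ≤ C * |pf a b c| := by gcongr
    linarith
  have hsd : C / (9 * κ) / s ≤ δ := by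
    rw [div_div, div_le_iff₀ (by positivity)]
    have : C / (9 * κ * δ) ≤ s := by linarith
    rw [div_le_iff₀ (by positivity)] at this
    linarith
  -- Ps value
  have hPs : Ps Φ κ (a / s, b / s, c / s, d / s) = Φ (a / s, b / s, c / s, d / s, q / s) := by
    unfold Ps
    simp only
    rw [qt_eq hκ, pf_scale _ _ _ _ hs0.ne', qn_scale _ _ _ _ _ hs0.ne', hq]
    · congr 5; field_simp
    · rw [pf_scale _ _ _ _ hs0.ne', abs_div, abs_of_pos (by positivity : 0 < s ^ 2), le_div_iff₀ (by positivity)]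
      exact hp
  set F := Finset.Ioo ⌊(q - r) / m - ρ / m⌋ ⌈(q - r) / m + ρ / m⌉ with hF
  have hmem : ∀ e : ℤ, e ∈ F ↔ |Jr a b c d (r + m * e)| < C * s ^ 2 := by
    intro e
    rw [J_iff hp0, hF, Finset.mem_Ioo, Int.floor_lt, Int.lt_ceil, ← hq, ← hρ, abs_lt, ← sub_div, ← add_div,
      div_lt_iff₀ hm0, lt_div_iff₀ hm0]
    constructor <;> rintro ⟨h1, h2⟩ <;> constructor <;> linarith
  have hsum : ∑ e ∈ Finset.Icc (-(L:ℤ)) L, w Φ C s a b c d (r + m * e)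
      = ∑ e ∈ F, Φ (a / s, b / s, c / s, d / s, (r + m * e) / s) := by
    have e1 : ∀ e : ℤ, w Φ C s a b c d (r + m * e)
       = if e ∈ F then Φ (a / s, b / s, c / s, d / s, (r + m * e) / s) else 0 := by
      intro e; unfold w; simp only [hmem]
    simp_rw [e1]
    rw [← Finset.sum_filter, Finset.filter_mem_eq_inter, Finset.inter_comm]
    refine Finset.sum_subset Finset.inter_subset_left fun e heF he => ?_
    by_contra hh
    apply he
    rw [Finset.mem_inter]
    refine ⟨heF, ?_⟩
    have := (h.bd _ _ _ _ _ hh).2.2.2.2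
    rw [abs_div, abs_of_pos hs0, div_le_iff₀ hs0, abs_le] at this
    rw [Finset.mem_Icc]
    have hrm' : (r:ℝ) ≤ m := by exact_mod_cast hrm.le
    have hr0' : (0:ℝ) ≤ r := by exact_mod_cast hr0
    have hM := h.M1
    have hL0 : (0:ℝ) ≤ M * s := by positivity
    have b1 : -(L:ℝ) ≤ e := by
      by_contra h1; push Not at h1
      nlinarith
    have b2 : (e:ℝ) ≤ L := by
      by_contra h1; push Not at h1
      nlinarith
    constructor <;> [exact_mod_cast b1; exact_mod_cast b2]
  have hcnt : cnt ((q - r) / m) (ρ / m) = F.card := rfl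
  rw [hsum, hcnt, hPs, mul_comm, ← nsmul_eq_mul, ← Finset.sum_const, ← Finset.sum_sub_distrib]
  calc _ ≤ ∑ e ∈ F, ω := by
        refine (Finset.abs_sum_le_sum_abs _ _).trans (Finset.sum_le_sum fun e he => ?_)
        apply hu
        rw [← sub_div, abs_div, abs_of_pos hs0]
        refine le_trans ?_ hsd
        gcongr
        have := (hmem e).mp he
        rw [J_iff hp0] at this
        exact this.le.trans hρ1
    _ = F.card * ω := by simp
    _ ≤ (2 * (C / (9 * κ)) + 1) * ω := by
        gcongr
        rw [← hcnt]
        refine (cnt_le _ _ (by positivity)).trans ?_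
        have : ρ / m ≤ C / (9 * κ) := (div_le_self hρ0 hm1).trans hρ1
        linarith
    _ = _ := by ring

end BQFC


namespace BQFC

noncomputable def Ps2 (Φ : V → ℝ) (κ C : ℝ) (m : ℕ) (v : ℝ × ℝ × ℝ × ℝ) : ℝ :=
  Ps Φ κ v * (2 * C / (9 * m * max |pf v.1 v.2.1 v.2.2.1| κ))

lemma range_aux {m L : ℕ} {r d : ℤ} {x : ℝ} (hm : 1 ≤ m) (hr0 : 0 ≤ r) (hrm : r < m) (hL : x + 1 ≤ L)
    (h : |(r:ℝ) + m * d| ≤ x) : |d| ≤ L := by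
  have hm0 : (1:ℝ) ≤ m := by exact_mod_cast hm
  have hrm1 : (r:ℝ) ≤ m := by exact_mod_cast hrm.le
  have hr01 : (0:ℝ) ≤ r := by exact_mod_cast hr0
  have hx : 0 ≤ x := (abs_nonneg _).trans h
  rw [abs_le] at h
  have b1 : -(L:ℝ) ≤ d := by
    by_contra h1; push Not at h1
    nlinarith
  have b2 : (d:ℝ) ≤ L := by
    by_contra h1; push Not at h1
    nlinarith
  rw [abs_le]
  constructor <;> [exact_mod_cast b1; exact_mod_cast b2]

set_option maxHeartbeats 1000000 in
lemma d_sum {Φ M κ} (h : Tst Φ M κ) (C : ℝ) (hC : 0 < C) (m : ℕ) (hm : 1 ≤ m) (ε : ℝ) (hε : 0 < ε) :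
    ∃ s0 : ℝ, 1 ≤ s0 ∧ ∀ s, s0 ≤ s → ∀ a b c : ℝ, ∀ r r' : ℤ, 0 ≤ r → r < m → 0 ≤ r' → r' < m →
      ∀ L : ℕ, M * s + 1 ≤ L → L ≤ (M + 3) * s →
      |∑ d ∈ Finset.Icc (-(L:ℤ)) L, (∑ e ∈ Finset.Icc (-(L:ℤ)) L, w Φ C s a b c (r + m * d) (r' + m * e) -
        Ps2 Φ κ C m (a / s, b / s, c / s, (r + m * d) / s))| ≤ ε * s := by
  have hκ := h.κ0
  have hM := h.M1
  obtain ⟨B, hB0, hB⟩ := h.bound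
  have hm0 : (0:ℝ) < m := by exact_mod_cast hm
  have hm1 : (1:ℝ) ≤ m := by exact_mod_cast hm
  set R := C / (9 * κ) with hR
  have hR0 : 0 < R := by positivity
  set ω := ε / (4 * (2 * M + 9) * (2 * R + 1)) with hω
  have hω0 : 0 < ω := by positivity
  set ε' := ε / (4 * (2 * M + 9) * (B + 1)) with hε'
  have hε0 : 0 < ε' := by positivity
  have hPb : ∀ a b c d, Ps Φ κ (a, b, c, d) ≠ 0 → |a| ≤ M ∧ |b| ≤ M ∧ |c| ≤ M ∧ |d| ≤ M := by
    intro a b c d hh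
    have := h.bd _ _ _ _ _ hh
    exact ⟨this.1, this.2.1, this.2.2.1, this.2.2.2.1⟩
  obtain ⟨δ, hδ, hu⟩ := unif4 (Ps Φ κ) (Ps_cont h) M hPb ω hω0
  set η := min 1 (δ / m) with hη
  have hη0 : 0 < η := by positivity
  have hη1 : η ≤ 1 := min_le_left _ _
  have hη2 : η * m ≤ δ := by
    rw [← le_div_iff₀ hm0]; exact min_le_right _ _
  obtain ⟨N0, hN0⟩ := cnt_equi (3 * κ * η / (11 * M ^ 2)) (6 * M * m / κ) (by positivity) R hR0.le ε' hε0
  obtain ⟨s1, hs11, hs1⟩ := e_sum h C hC m hm ω hω0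
  refine ⟨max s1 (N0 / η + 1 / η), le_trans hs11 (le_max_left _ _),
    fun s hs a b c r r' hr0 hrm hr0' hrm' L hL1 hL2 => ?_⟩
  have hs2 : s1 ≤ s := (le_max_left _ _).trans hs
  have hsp : 1 ≤ s := hs11.trans hs2
  have hs0 : 0 < s := by linarith
  have hs3 : N0 / η + 1 / η ≤ s := (le_max_right _ _).trans hs
  by_cases hex : ∃ d e, Φ (a / s, b / s, c / s, d, e) ≠ 0
  swap
  · push Not at hex
    have z1 : ∀ d e, w Φ C s a b c d e = 0 := by
      intro d e; unfold w; rw [hex]; simp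
    have z2 : ∀ d, Ps2 Φ κ C m (a / s, b / s, c / s, d) = 0 := by
      intro d; unfold Ps2 Ps; simp only; rw [hex]; simp
    simp only [z1, z2]; simp; positivity
  obtain ⟨d0, e0, hde⟩ := hex
  obtain ⟨ba, bb, bc, -, -⟩ := h.bd _ _ _ _ _ hde
  have ka := h.ka _ _ _ _ _ hde
  have kp := h.kp _ _ _ _ _ hde
  have hs2p : 0 < s ^ 2 := by positivity
  rw [pf_scale _ _ _ _ hs0.ne', abs_div, abs_of_pos hs2p, le_div_iff₀ hs2p] at kp
  rw [abs_div, abs_of_pos hs0, le_div_iff₀ hs0] at ka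
  rw [abs_div, abs_of_pos hs0, div_le_iff₀ hs0] at ba bb bc
  have hpp : 0 < |pf a b c| := lt_of_lt_of_le (by positivity) kp
  have hp0 : pf a b c ≠ 0 := abs_pos.mp hpp
  have hpu : |pf a b c| ≤ 11 * M ^ 2 * s ^ 2 := by
    unfold pf
    calc _ ≤ |3 * b ^ 2| + |8 * a * c| := abs_sub _ _
      _ = 3 * |b| ^ 2 + 8 * (|a| * |c|) := by
        rw [abs_mul, abs_mul, abs_mul, abs_pow]; norm_num; ring
      _ ≤ 3 * (M * s) ^ 2 + 8 * ((M * s) * (M * s)) := by gcongr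
      _ = _ := by ring
  set ρ := C * s ^ 2 / (9 * |pf a b c|) with hρ
  have hρ0 : 0 ≤ ρ := by positivity
  have hρ1 : ρ ≤ R := by
    rw [hρ, hR, div_le_div_iff₀ (by positivity) (by positivity)]
    have : C * (κ * s ^ 2) ≤ C * |pf a b c| := by gcongr
    linarith
  have hρm : ρ / m ≤ R := (div_le_self hρ0 hm1).trans hρ1
  have hρm0 : 0 ≤ ρ / m := by positivity
  set N := ⌈η * s⌉₊ with hN
  have hηs : N0 + 1 ≤ η * s := by
    have := mul_le_mul_of_nonneg_left hs3 hη0.le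
    have e : η * (N0 / η + 1 / η) = N0 + 1 := by field_simp
    linarith
  have hNl : η * s ≤ N := Nat.le_ceil _
  have hNu : (N:ℝ) ≤ 2 * s := by
    have := Nat.ceil_lt_add_one (by positivity : 0 ≤ η * s)
    linarith [mul_le_mul_of_nonneg_right hη1 hs0.le]
  have hN0N : N0 ≤ N := by
    have : (N0:ℝ) ≤ N := by linarith
    exact_mod_cast this
  have hN1 : 1 ≤ N := by
    have : (1:ℝ) ≤ N := by have : (0:ℝ) ≤ N0 := by positivity
                           linarith
    exact_mod_cast this
  set ψ : ℤ → ℝ := fun d => Ps Φ κ (a / s, b / s, c / s, (r + m * d) / s) with hψ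
  set x : ℤ → ℝ := fun d => (qn a b c (r + m * d) / (9 * pf a b c) - r') / m with hx
  set D : ℤ → ℝ := fun d => cnt (x d) (ρ / m) - 2 * (ρ / m) with hD
  have hrm1 : (r:ℝ) ≤ m := by exact_mod_cast hrm.le
  have hr01 : (0:ℝ) ≤ r := by exact_mod_cast hr0
  have hsecond : |∑ d ∈ Finset.Icc (-(L:ℤ)) L, ψ d * D d| ≤ (2 * L + N + 1) * (B * ε' + ω * (2 * R + 1)) := by
    refine shift_avg ψ D L N hN1 B (2 * R + 1) ω ε' hB0 hω0.le ?_ ?_ ?_ ?_ ?_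
    · intro d hd
      have := (hPb _ _ _ _ hd).2.2.2
      rw [abs_div, abs_of_pos hs0, div_le_iff₀ hs0] at this
      exact range_aux hm hr0 hrm hL1 this
    · intro d; exact hB _
    · intro d
      have := cnt_le (x d) (ρ / m) hρm0
      have h0 : (0:ℝ) ≤ cnt (x d) (ρ / m) := by positivity
      simp only [hD]
      rw [abs_le]; constructor <;> linarith
    · intro d k hk
      refine hu _ _ _ _ _ _ _ _ (by simpa using hδ.le) (by simpa using hδ.le) (by simpa using hδ.le) ?_
      · rw [← sub_div]
        have : ((r:ℝ) + m * ((d + (k:ℕ) : ℤ) : ℝ) - (r + m * d)) = m * k := by push_cast; ring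
        rw [this, abs_of_nonneg (by positivity), div_le_iff₀ hs0]
        have : (k:ℝ) < η * s := Nat.lt_ceil.mp hk
        linarith [mul_le_mul_of_nonneg_left this.le hm0.le, mul_le_mul_of_nonneg_right hη2 hs0.le]
    · intro d
      set α := -3 * a * m / pf a b c with hα
      set q0 := (qn a b c (r + m * d) / (9 * pf a b c) - r') / m
      have hαabs : |α| = 3 * |a| * m / |pf a b c| := by
        rw [hα, abs_div, abs_mul, abs_mul, Nat.abs_cast]; norm_num
      have := hN0 N hN0N α (b * c / pf a b c - 6 * a * (r + m * d) / pf a b c) q0 ?_ ?_ (ρ / m) hρm0 hρm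
      · refine le_trans (le_of_eq ?_) this
        congr 1
        refine Finset.sum_congr rfl fun k _ => ?_
        simp only [hD, hx]
        congr 3
        simp only [q0, hα]
        unfold qn
        push_cast
        field_simp
        ring
      · rw [hαabs, div_mul_eq_mul_div, div_le_div_iff₀ (by positivity) hpp]
        calc 3 * κ * η * |pf a b c| ≤ 3 * κ * η * (11 * M ^ 2 * s ^ 2) := by gcongr
          _ = 3 * (κ * s) * 1 * (η * s) * (11 * M ^ 2) := by ring
          _ ≤ 3 * |a| * m * N * (11 * M ^ 2) := by gcongr
      · rw [hαabs, div_mul_eq_mul_div, div_le_div_iff₀ hpp hκ]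
        calc 3 * |a| * m * N * κ ≤ 3 * (M * s) * m * (2 * s) * κ := by gcongr
          _ = 6 * M * m * (κ * s ^ 2) := by ring
          _ ≤ _ := by gcongr
  have hsplit : ∑ d ∈ Finset.Icc (-(L:ℤ)) L, (∑ e ∈ Finset.Icc (-(L:ℤ)) L, w Φ C s a b c (r + m * d) (r' + m * e) -
        Ps2 Φ κ C m (a / s, b / s, c / s, (r + m * d) / s))
      = ∑ d ∈ Finset.Icc (-(L:ℤ)) L, (∑ e ∈ Finset.Icc (-(L:ℤ)) L, w Φ C s a b c (r + m * d) (r' + m * e) -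
        ψ d * cnt (x d) (ρ / m)) + ∑ d ∈ Finset.Icc (-(L:ℤ)) L, ψ d * D d := by
    rw [← Finset.sum_add_distrib]
    refine Finset.sum_congr rfl fun d _ => ?_
    have : Ps2 Φ κ C m (a / s, b / s, c / s, (r + m * d) / s) = ψ d * (2 * (ρ / m)) := by
      unfold Ps2
      simp only [hψ]
      congr 1
      rw [pf_scale _ _ _ _ hs0.ne', abs_div, abs_of_pos hs2p, max_eq_left, hρ]
      · field_simp
      · rw [le_div_iff₀ hs2p]; exact kp
    rw [this]; simp only [hD]; ring
  have hfirst : |∑ d ∈ Finset.Icc (-(L:ℤ)) L, (∑ e ∈ Finset.Icc (-(L:ℤ)) L, w Φ C s a b c (r + m * d) (r' + m * e) -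
        ψ d * cnt (x d) (ρ / m))| ≤ (2 * L + 1) * (ω * (2 * R + 1)) := by
    refine (Finset.abs_sum_le_sum_abs _ _).trans ?_
    calc _ ≤ ∑ d ∈ Finset.Icc (-(L:ℤ)) L, ω * (2 * R + 1) :=
          Finset.sum_le_sum fun d _ => hs1 s hs2 a b c (r + m * d) kp r' hr0' hrm' L hL1
      _ = _ := by
        rw [Finset.sum_const, Int.card_Icc, nsmul_eq_mul]
        have : ((L:ℤ) + 1 - -(L:ℤ)).toNat = 2 * L + 1 := by omega
        rw [this]; push_cast; ring
  rw [hsplit]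
  have hLN : (2 * (L:ℝ) + N + 1) ≤ (2 * M + 9) * s := by linarith
  have hLN' : (2 * (L:ℝ) + 1) ≤ (2 * M + 9) * s := by
    have : (0:ℝ) ≤ N := by positivity
    linarith
  calc _ ≤ (2 * L + 1) * (ω * (2 * R + 1)) + (2 * L + N + 1) * (B * ε' + ω * (2 * R + 1)) :=
        (abs_add_le _ _).trans (add_le_add hfirst hsecond)
    _ ≤ (2 * M + 9) * s * (ω * (2 * R + 1)) + (2 * M + 9) * s * ((B + 1) * ε' + ω * (2 * R + 1)) := by
        gcongr; linarith
    _ = 3 / 4 * ε * s := by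
        rw [hω, hε']; field_simp; ring
    _ ≤ _ := by linarith [mul_pos hε hs0]

end BQFC


namespace BQFC

def mk5 : (ℤ × ℤ × ℤ × ℤ × ℤ) ≃ BQF where
  toFun v := ⟨v.1, v.2.1, v.2.2.1, v.2.2.2.1, v.2.2.2.2⟩
  invFun f := (f.a, f.b, f.c, f.d, f.e)
  left_inv _ := rfl
  right_inv _ := rfl

noncomputable instance : DecidableEq BQF := fun _ _ => Classical.propDecidable _

/-- forms with all coefficients in a finite set -/
def box (A : Finset ℤ) : Finset BQF := (A ×ˢ A ×ˢ A ×ˢ A ×ˢ A).map mk5.toEmbedding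

lemma mem_box {A : Finset ℤ} {f : BQF} :
    f ∈ box A ↔ f.a ∈ A ∧ f.b ∈ A ∧ f.c ∈ A ∧ f.d ∈ A ∧ f.e ∈ A := by
  unfold box
  simp only [Finset.mem_map_equiv, Finset.mem_product]
  rfl

lemma sum_box (A : Finset ℤ) (F : BQF → ℝ) :
    ∑ f ∈ box A, F f = ∑ a ∈ A, ∑ b ∈ A, ∑ c ∈ A, ∑ d ∈ A, ∑ e ∈ A, F ⟨a, b, c, d, e⟩ := by
  unfold box
  rw [Finset.sum_map]
  simp only [Finset.sum_product]
  rfl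

noncomputable def wf (Φ : V → ℝ) (C s : ℝ) (f : BQF) : ℝ := w Φ C s f.a f.b f.c f.d f.e

lemma wf_supp {Φ M κ} (h : Tst Φ M κ) {C s : ℝ} (hs : 0 < s) {f : BQF} (hf : wf Φ C s f ≠ 0) :
    |(f.a:ℝ)| ≤ M * s ∧ |(f.b:ℝ)| ≤ M * s ∧ |(f.c:ℝ)| ≤ M * s ∧ |(f.d:ℝ)| ≤ M * s ∧ |(f.e:ℝ)| ≤ M * s := by
  have : Φ (f.a / s, f.b / s, f.c / s, f.d / s, f.e / s) ≠ 0 := by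
    unfold wf w at hf; split_ifs at hf; · exact hf
    · exact absurd rfl hf
  have := h.bd _ _ _ _ _ this
  simpa only [abs_div, abs_of_pos hs, div_le_iff₀ hs] using this

lemma wf_box {Φ M κ} (h : Tst Φ M κ) {C s : ℝ} (hs : 0 < s) {L : ℕ} (hL : M * s ≤ L)
    {f : BQF} (hf : f ∉ box (Finset.Icc (-(L:ℤ)) L)) : wf Φ C s f = 0 := by
  by_contra hh
  obtain ⟨h1, h2, h3, h4, h5⟩ := wf_supp h hs hh
  have key : ∀ z : ℤ, |(z:ℝ)| ≤ M * s → z ∈ Finset.Icc (-(L:ℤ)) L := by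
    intro z hz
    have : |(z:ℝ)| ≤ L := hz.trans hL
    rw [Finset.mem_Icc, ← abs_le]; exact_mod_cast this
  exact hf (mem_box.mpr ⟨key _ h1, key _ h2, key _ h3, key _ h4, key _ h5⟩)

open Classical in
/-- weighted count -/
noncomputable def T (Φ : V → ℝ) (C s : ℝ) (S : Set BQF) : ℝ := ∑' f : BQF, if f ∈ S then wf Φ C s f else 0

open Classical in
lemma T_eq {Φ M κ} (h : Tst Φ M κ) {C s : ℝ} (hs : 0 < s) {L : ℕ} (hL : M * s ≤ L) (S : Set BQF) :
    T Φ C s S = ∑ f ∈ box (Finset.Icc (-(L:ℤ)) L), if f ∈ S then wf Φ C s f else 0 :=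
  tsum_eq_sum fun f hf => by rw [wf_box h hs hL hf]; simp

def aff (m : ℕ) (r f : BQF) : BQF :=
  ⟨r.a + m * f.a, r.b + m * f.b, r.c + m * f.c, r.d + m * f.d, r.e + m * f.e⟩

def res (m : ℕ) (r : BQF) : Set BQF := {f | (m:ℤ) ∣ f.a - r.a ∧ (m:ℤ) ∣ f.b - r.b ∧ (m:ℤ) ∣ f.c - r.c ∧
  (m:ℤ) ∣ f.d - r.d ∧ (m:ℤ) ∣ f.e - r.e}

noncomputable def rbox (m : ℕ) : Finset BQF := box (Finset.Ico 0 (m:ℤ))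

open Classical in
lemma T_res {Φ M κ} (h : Tst Φ M κ) {C s : ℝ} (hs : 0 < s) {L : ℕ} (hL : M * s + 1 ≤ L) {m : ℕ} (hm : 1 ≤ m)
    {r : BQF} (hr : r ∈ rbox m) :
    T Φ C s (res m r) = ∑ f ∈ box (Finset.Icc (-(L:ℤ)) L), wf Φ C s (aff m r f) := by
  have hm0 : (m:ℤ) ≠ 0 := by omega
  have inj : Function.Injective (aff m r) := by
    rintro ⟨a, b, c, d, e⟩ ⟨a', b', c', d', e'⟩ hfg
    simp only [aff, BQF.mk.injEq, add_right_inj, mul_eq_mul_left_iff, hm0, or_false] at hfg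
    obtain ⟨rfl, rfl, rfl, rfl, rfl⟩ := hfg; rfl
  unfold T
  rw [tsum_eq_sum (s := (box (Finset.Icc (-(L:ℤ)) L)).map ⟨aff m r, inj⟩), Finset.sum_map]
  · refine Finset.sum_congr rfl fun f _ => ?_
    rw [if_pos]; · rfl
    simp [res, aff]
  · intro f hf
    split_ifs with hfr
    swap; · rfl
    by_contra hh
    apply hf
    obtain ⟨⟨a, ha⟩, ⟨b, hb⟩, ⟨c, hc⟩, ⟨d, hd⟩, ⟨e, he⟩⟩ := hfr
    obtain ⟨h1, h2, h3, h4, h5⟩ := wf_supp h hs hh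
    unfold rbox at hr
    rw [mem_box] at hr
    simp only [Finset.mem_Ico] at hr
    have key : ∀ z r a : ℤ, 0 ≤ r ∧ r < m → z - r = m * a → |(z:ℝ)| ≤ M * s → a ∈ Finset.Icc (-(L:ℤ)) L := by
      intro z r a hr hz hzz
      rw [Finset.mem_Icc, ← abs_le]
      refine range_aux hm hr.1 hr.2 hL ?_
      have : z = r + m * a := by omega
      rw [this] at hzz; push_cast at hzz; exact hzz
    rw [Finset.mem_map]
    refine ⟨⟨a, b, c, d, e⟩, mem_box.mpr ⟨key _ _ _ hr.1 ha h1, key _ _ _ hr.2.1 hb h2, key _ _ _ hr.2.2.1 hc h3,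
      key _ _ _ hr.2.2.2.1 hd h4, key _ _ _ hr.2.2.2.2 he h5⟩, ?_⟩
    obtain ⟨fa, fb, fc, fd, fe⟩ := f
    simp only [Function.Embedding.coeFn_mk, aff, BQF.mk.injEq]
    simp only at ha hb hc hd he
    refine ⟨?_, ?_, ?_, ?_, ?_⟩ <;> omega

lemma Ps2_cont {Φ M κ} (h : Tst Φ M κ) (C : ℝ) (m : ℕ) (hm : 1 ≤ m) : Continuous (Ps2 Φ κ C m) := by
  have hm0 : (0:ℝ) < m := by exact_mod_cast hm
  unfold Ps2
  refine (Ps_cont h).mul ?_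
  unfold pf
  refine Continuous.div (by fun_prop) (by fun_prop) fun v => ?_
  have : 0 < max |3 * v.2.1 ^ 2 - 8 * v.1 * v.2.2.1| κ := lt_max_of_lt_right h.κ0
  positivity

noncomputable def Mn (Φ : V → ℝ) (κ C s : ℝ) (m L : ℕ) (r : BQF) : ℝ :=
  ∑ a ∈ Finset.Icc (-(L:ℤ)) L, ∑ b ∈ Finset.Icc (-(L:ℤ)) L, ∑ c ∈ Finset.Icc (-(L:ℤ)) L,
   ∑ d ∈ Finset.Icc (-(L:ℤ)) L, Ps2 Φ κ C m ((r.a + m * a) / s, (r.b + m * b) / s, (r.c + m * c) / s, (r.d + m * d) / s)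

lemma sum_icc_le (L : ℕ) (F : ℤ → ℝ) (K B : ℝ) (hB0 : 0 ≤ B) (hK : (2 * L + 1 : ℝ) ≤ K) (hB : ∀ z, |F z| ≤ B) :
    |∑ z ∈ Finset.Icc (-(L:ℤ)) L, F z| ≤ K * B := by
  refine (Finset.abs_sum_le_sum_abs _ _).trans ?_
  calc _ ≤ ∑ d ∈ Finset.Icc (-(L:ℤ)) L, B := Finset.sum_le_sum fun d _ => hB d
    _ = (2 * L + 1) * B := by
      rw [Finset.sum_const, Int.card_Icc, nsmul_eq_mul]
      have : ((L:ℤ) + 1 - -(L:ℤ)).toNat = 2 * L + 1 := by omega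
      rw [this]; push_cast; ring
    _ ≤ _ := by gcongr

lemma L_exists {M s : ℝ} (hM : 1 ≤ M) (hs : 1 ≤ s) : ∃ L : ℕ, M * s + 1 ≤ L ∧ L ≤ (M + 3) * s ∧
    (2 * L + 1 : ℝ) ≤ (2 * M + 7) * s := by
  refine ⟨⌈M * s + 1⌉₊, Nat.le_ceil _, ?_, ?_⟩ <;>
  · have := Nat.ceil_lt_add_one (by positivity : 0 ≤ M * s + 1)
    linarith

lemma T_main {Φ M κ} (h : Tst Φ M κ) (C : ℝ) (hC : 0 < C) (m : ℕ) (hm : 1 ≤ m) (ε : ℝ) (hε : 0 < ε) :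
    ∃ s0 : ℝ, 1 ≤ s0 ∧ ∀ s, s0 ≤ s → ∀ L : ℕ, M * s + 1 ≤ L → L ≤ (M + 3) * s →
      (2 * L + 1 : ℝ) ≤ (2 * M + 7) * s → ∀ r ∈ rbox m,
      |T Φ C s (res m r) - Mn Φ κ C s m L r| ≤ ε * s ^ 4 := by
  have hM := h.M1
  obtain ⟨s0, hs01, hs0⟩ := d_sum h C hC m hm (ε / (2 * M + 7) ^ 3) (by positivity)
  refine ⟨s0, hs01, fun s hs L hL1 hL2 hL3 r hr => ?_⟩
  have hs1 : 1 ≤ s := hs01.trans hs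
  have hsp : 0 < s := by linarith
  rw [T_res h hsp hL1 hm hr, sum_box]
  unfold Mn
  have hr' := hr
  unfold rbox at hr'
  rw [mem_box] at hr'
  simp only [Finset.mem_Ico] at hr'
  simp only [← Finset.sum_sub_distrib]
  have hb0 : 0 ≤ ε / (2 * M + 7) ^ 3 * s := by positivity
  have hK0 : 0 ≤ (2 * M + 7) * s := by positivity
  have := sum_icc_le L _ _ _ (by positivity) hL3 fun a =>
    sum_icc_le L _ _ _ (by positivity) hL3 fun b =>
    sum_icc_le L _ _ _ hb0 hL3 fun c =>
    hs0 s hs (r.a + m * a) (r.b + m * b) (r.c + m * c) r.d r.e hr'.2.2.2.1.1 hr'.2.2.2.1.2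
      hr'.2.2.2.2.1 hr'.2.2.2.2.2 L hL1 hL2
  refine le_trans (le_of_eq ?_) (this.trans (le_of_eq ?_))
  · simp only [wf, aff]; push_cast; rfl
  · field_simp

lemma T_diff {Φ M κ} (h : Tst Φ M κ) (C : ℝ) (hC : 0 < C) (m : ℕ) (hm : 1 ≤ m) (ε : ℝ) (hε : 0 < ε) :
    ∃ s0 : ℝ, 1 ≤ s0 ∧ ∀ s, s0 ≤ s → ∀ r ∈ rbox m, ∀ r' ∈ rbox m,
      |T Φ C s (res m r) - T Φ C s (res m r')| ≤ ε * s ^ 4 := by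
  have hM := h.M1
  have hm0 : (0:ℝ) < m := by exact_mod_cast hm
  obtain ⟨s0, hs01, hs0⟩ := T_main h C hC m hm (ε / 3) (by positivity)
  have hPb : ∀ a b c d, Ps2 Φ κ C m (a, b, c, d) ≠ 0 → |a| ≤ M ∧ |b| ≤ M ∧ |c| ≤ M ∧ |d| ≤ M := by
    intro a b c d hh
    have := h.bd _ _ _ _ _ (left_ne_zero_of_mul hh)
    exact ⟨this.1, this.2.1, this.2.2.1, this.2.2.2.1⟩
  obtain ⟨δ, hδ, hu⟩ := unif4 _ (Ps2_cont h C m hm) M hPb (ε / 3 / (2 * M + 7) ^ 4) (by positivity)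
  refine ⟨max s0 (m / δ), le_trans hs01 (le_max_left _ _), fun s hs r hr r' hr' => ?_⟩
  have hs2 := (le_max_left _ _).trans hs
  have hs3 := (le_max_right _ _).trans hs
  have hs1 : 1 ≤ s := hs01.trans hs2
  have hsp : 0 < s := by linarith
  obtain ⟨L, hL1, hL2, hL3⟩ := L_exists hM hs1
  have a1 := hs0 s hs2 L hL1 hL2 hL3 r hr
  have a2 := hs0 s hs2 L hL1 hL2 hL3 r' hr'
  have a3 : |Mn Φ κ C s m L r - Mn Φ κ C s m L r'| ≤ ε / 3 * s ^ 4 := by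
    unfold Mn
    simp only [← Finset.sum_sub_distrib]
    unfold rbox at hr hr'
    rw [mem_box] at hr hr'
    simp only [Finset.mem_Ico] at hr hr'
    have key : ∀ z z' a : ℤ, 0 ≤ z ∧ z < m → 0 ≤ z' ∧ z' < m → |((z:ℝ) + m * a) / s - (z' + m * a) / s| ≤ δ := by
      intro z z' a h1 h2
      rw [← sub_div, abs_div, abs_of_pos hsp, div_le_iff₀ hsp, show (z:ℝ) + m * a - (z' + m * a) = z - z' by ring]
      have : |z - z'| ≤ m := by rw [abs_le]; constructor <;> omega
      have : |(z:ℝ) - z'| ≤ m := by exact_mod_cast this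
      rw [div_le_iff₀ hδ] at hs3; linarith
    have hb0 : 0 ≤ ε / 3 / (2 * M + 7) ^ 4 := by positivity
    have hK0 : 0 ≤ (2 * M + 7) * s := by positivity
    have := sum_icc_le L _ _ _ (by positivity) hL3 fun a =>
      sum_icc_le L _ _ _ (by positivity) hL3 fun b =>
      sum_icc_le L _ _ _ (by positivity) hL3 fun c =>
      sum_icc_le L _ _ _ hb0 hL3 fun d =>
      hu _ _ _ _ _ _ _ _ (key r.a r'.a a hr.1 hr'.1) (key r.b r'.b b hr.2.1 hr'.2.1)
        (key r.c r'.c c hr.2.2.1 hr'.2.2.1) (key r.d r'.d d hr.2.2.2.1 hr'.2.2.2.1)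
    refine this.trans (le_of_eq ?_)
    field_simp
  have : T Φ C s (res m r) - T Φ C s (res m r') = (T Φ C s (res m r) - Mn Φ κ C s m L r)
    + (Mn Φ κ C s m L r - Mn Φ κ C s m L r') - (T Φ C s (res m r') - Mn Φ κ C s m L r') := by ring
  rw [this]
  refine (abs_sub _ _).trans ((add_le_add_left (abs_add_le _ _) _).trans ?_)
  linarith

lemma T_univ_bound {Φ M κ} (h : Tst Φ M κ) (C : ℝ) (hC : 0 < C) :
    ∃ K s0 : ℝ, 0 < K ∧ 1 ≤ s0 ∧ ∀ s, s0 ≤ s → |T Φ C s Set.univ| ≤ K * s ^ 4 := by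
  have hM := h.M1
  have hκ := h.κ0
  obtain ⟨s0, hs01, hs0⟩ := T_main h C hC 1 le_rfl 1 one_pos
  obtain ⟨B, hB0, hB⟩ := h.bound
  refine ⟨1 + (2 * M + 7) ^ 4 * (B * (2 * C / (9 * κ))), s0, by positivity, hs01, fun s hs => ?_⟩
  have hs1 : 1 ≤ s := hs01.trans hs
  have hsp : 0 < s := by linarith
  obtain ⟨L, hL1, hL2, hL3⟩ := L_exists hM hs1
  have hr : (⟨0, 0, 0, 0, 0⟩ : BQF) ∈ rbox 1 := by unfold rbox; rw [mem_box]; simp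
  have a1 := hs0 s hs L hL1 hL2 hL3 _ hr
  have e : res 1 ⟨0, 0, 0, 0, 0⟩ = Set.univ := by ext f; simp [res]
  rw [e] at a1
  have hP : ∀ v, |Ps2 Φ κ C 1 v| ≤ B * (2 * C / (9 * κ)) := by
    intro v
    unfold Ps2
    rw [abs_mul]
    refine mul_le_mul (hB _) ?_ (abs_nonneg _) hB0
    have : 0 < max |pf v.1 v.2.1 v.2.2.1| κ := lt_max_of_lt_right hκ
    rw [abs_of_nonneg (by positivity)]
    rw [Nat.cast_one, mul_one]
    gcongr
    exact le_max_right _ _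
  have hb0 : 0 ≤ B * (2 * C / (9 * κ)) := by positivity
  have hK0 : 0 ≤ (2 * M + 7) * s := by positivity
  have a2 : |Mn Φ κ C s 1 L ⟨0, 0, 0, 0, 0⟩| ≤ (2 * M + 7) ^ 4 * (B * (2 * C / (9 * κ))) * s ^ 4 := by
    have := sum_icc_le L _ _ _ (by positivity) hL3 fun a =>
      sum_icc_le L _ _ _ (by positivity) hL3 fun b =>
      sum_icc_le L _ _ _ (by positivity) hL3 fun c =>
      sum_icc_le L _ _ _ hb0 hL3 fun d => hP ((((0:ℤ):ℝ) + (1:ℕ) * a) / s, (((0:ℤ):ℝ) + (1:ℕ) * b) / s, (((0:ℤ):ℝ) + (1:ℕ) * c) / s, (((0:ℤ):ℝ) + (1:ℕ) * d) / s)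
    unfold Mn
    refine this.trans (le_of_eq ?_)
    ring
  have := abs_sub_abs_le_abs_sub (T Φ C s Set.univ) (Mn Φ κ C s 1 L ⟨0, 0, 0, 0, 0⟩)
  linarith

def SMod (m : ℕ) (S : Set BQF) : Prop := ∀ f g : BQF, (m : ℤ) ∣ f.a - g.a → (m : ℤ) ∣ f.b - g.b →
  (m : ℤ) ∣ f.c - g.c → (m : ℤ) ∣ f.d - g.d → (m : ℤ) ∣ f.e - g.e → (f ∈ S ↔ g ∈ S)

open Classical in
noncomputable def dens (m : ℕ) (S : Set BQF) : ℝ := (((rbox m).filter (· ∈ S)).card : ℝ) / (m:ℝ) ^ 5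

lemma card_rbox (m : ℕ) : (rbox m).card = m ^ 5 := by
  unfold rbox box
  simp only [Finset.card_map, Finset.card_product, Int.card_Ico]
  simp; ring

def rd (m : ℕ) (f : BQF) : BQF := ⟨f.a % m, f.b % m, f.c % m, f.d % m, f.e % m⟩

lemma rd_mem {m : ℕ} (hm : 1 ≤ m) (f : BQF) : rd m f ∈ rbox m := by
  unfold rbox; rw [mem_box]
  simp only [Finset.mem_Ico, rd]
  have : (m:ℤ) ≠ 0 := by omega
  have h2 : (0:ℤ) < m := by omega
  exact ⟨⟨Int.emod_nonneg _ this, Int.emod_lt_of_pos _ h2⟩, ⟨Int.emod_nonneg _ this, Int.emod_lt_of_pos _ h2⟩,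
   ⟨Int.emod_nonneg _ this, Int.emod_lt_of_pos _ h2⟩, ⟨Int.emod_nonneg _ this, Int.emod_lt_of_pos _ h2⟩,
   ⟨Int.emod_nonneg _ this, Int.emod_lt_of_pos _ h2⟩⟩

lemma mem_res_rd {m : ℕ} (f : BQF) : f ∈ res m (rd m f) :=
  ⟨Int.dvd_self_sub_emod, Int.dvd_self_sub_emod, Int.dvd_self_sub_emod, Int.dvd_self_sub_emod,
   Int.dvd_self_sub_emod⟩

lemma res_eq_rd {m : ℕ} {f r : BQF} (hr : r ∈ rbox m) (h : f ∈ res m r) : rd m f = r := by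
  unfold rbox at hr
  rw [mem_box] at hr
  simp only [Finset.mem_Ico] at hr
  have key : ∀ x y : ℤ, 0 ≤ y ∧ y < m → (m:ℤ) ∣ x - y → x % m = y := by
    intro x y hy hxy
    exact (Int.emod_eq_emod_iff_emod_sub_eq_zero.mpr (Int.emod_eq_zero_of_dvd hxy)).trans (Int.emod_eq_of_lt hy.1 hy.2)
  obtain ⟨h1, h2, h3, h4, h5⟩ := h
  obtain ⟨a, b, c, d, e⟩ := r
  simp only [rd, BQF.mk.injEq]
  exact ⟨key _ _ hr.1 h1, key _ _ hr.2.1 h2, key _ _ hr.2.2.1 h3, key _ _ hr.2.2.2.1 h4, key _ _ hr.2.2.2.2 h5⟩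

open Classical in
lemma T_split {Φ M κ} (h : Tst Φ M κ) {C s : ℝ} (hs : 0 < s) {m : ℕ} (hm : 1 ≤ m) {S : Set BQF} (hS : SMod m S) :
    T Φ C s S = ∑ r ∈ (rbox m).filter (· ∈ S), T Φ C s (res m r) := by
  obtain ⟨L, hL⟩ := exists_nat_ge (M * s)
  simp only [T_eq h hs hL]
  rw [Finset.sum_comm]
  refine Finset.sum_congr rfl fun f _ => ?_
  have hfS : f ∈ S ↔ rd m f ∈ S := by
    obtain ⟨h1, h2, h3, h4, h5⟩ := mem_res_rd (m := m) f
    exact hS _ _ h1 h2 h3 h4 h5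
  by_cases hf : f ∈ S
  · rw [if_pos hf, Finset.sum_eq_single (rd m f)]
    · rw [if_pos (mem_res_rd f)]
    · intro r hr hne
      rw [if_neg]
      intro hh
      exact hne (res_eq_rd (Finset.mem_filter.mp hr).1 hh).symm
    · intro hh
      exact absurd (Finset.mem_filter.mpr ⟨rd_mem hm f, hfS.mp hf⟩) hh
  · rw [if_neg hf, Finset.sum_eq_zero]
    intro r hr
    rw [if_neg]
    intro hh
    rw [Finset.mem_filter] at hr
    exact hf (hfS.mpr (by rw [res_eq_rd hr.1 hh]; exact hr.2))

lemma equidist {Φ M κ} (h : Tst Φ M κ) (C : ℝ) (hC : 0 < C) (m : ℕ) (hm : 1 ≤ m) (S : Set BQF) (hS : SMod m S)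
    (ε : ℝ) (hε : 0 < ε) :
    ∃ s0 : ℝ, 1 ≤ s0 ∧ ∀ s, s0 ≤ s →
      |T Φ C s S - dens m S * T Φ C s Set.univ| ≤ ε * s ^ 4 := by
  classical
  have hm0 : (0:ℝ) < m := by exact_mod_cast hm
  obtain ⟨s0, hs01, hs0⟩ := T_diff h C hC m hm (ε / m ^ 5) (by positivity)
  refine ⟨s0, hs01, fun s hs => ?_⟩
  have hs1 : 1 ≤ s := hs01.trans hs
  have hsp : 0 < s := by linarith
  rw [T_split h hsp hm hS, T_split h hsp hm (S := Set.univ) (fun f g _ _ _ _ _ => by simp)]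
  simp only [Set.mem_univ, Finset.filter_true]
  have e : ∑ r ∈ (rbox m).filter (· ∈ S), T Φ C s (res m r) - dens m S * ∑ r ∈ rbox m, T Φ C s (res m r)
      = ∑ r ∈ (rbox m).filter (· ∈ S), (1 / (m:ℝ) ^ 5) * ∑ r' ∈ rbox m, (T Φ C s (res m r) - T Φ C s (res m r')) := by
    simp only [Finset.sum_sub_distrib, Finset.sum_const, card_rbox, mul_sub]
    unfold dens
    simp only [nsmul_eq_mul]
    push_cast
    congr 1
    · exact Finset.sum_congr rfl fun r _ => by field_simp
    · ring
  rw [e]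
  refine (Finset.abs_sum_le_sum_abs _ _).trans ?_
  calc _ ≤ ∑ r ∈ (rbox m).filter (· ∈ S), (ε / m ^ 5) * s ^ 4 := by
        refine Finset.sum_le_sum fun r hr => ?_
        rw [abs_mul, abs_of_nonneg (by positivity)]
        have hr1 := (Finset.mem_filter.mp hr).1
        have : |∑ r' ∈ rbox m, (T Φ C s (res m r) - T Φ C s (res m r'))| ≤ m ^ 5 * ((ε / m ^ 5) * s ^ 4) := by
          refine (Finset.abs_sum_le_sum_abs _ _).trans ((Finset.sum_le_sum fun r' hr' => hs0 s hs r hr1 r' hr').trans ?_)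
          rw [Finset.sum_const, card_rbox, nsmul_eq_mul]; push_cast; exact le_rfl
        calc _ ≤ 1 / (m:ℝ) ^ 5 * (m ^ 5 * ((ε / m ^ 5) * s ^ 4)) := by gcongr
          _ = _ := by field_simp
    _ = (((rbox m).filter (· ∈ S)).card : ℝ) * ((ε / m ^ 5) * s ^ 4) := by rw [Finset.sum_const, nsmul_eq_mul]
    _ ≤ (m:ℝ) ^ 5 * ((ε / m ^ 5) * s ^ 4) := by
        gcongr
        have := Finset.card_filter_le (rbox m) (· ∈ S)
        rw [card_rbox] at this
        exact_mod_cast this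
    _ = _ := by field_simp

end BQFC


namespace BQFC
open Polynomial

noncomputable def Q4 {R : Type*} [CommRing R] (a b c d e : R) : R[X] :=
  C a * X ^ 4 + C b * X ^ 3 + C c * X ^ 2 + C d * X + C e

lemma Q4_map {R S : Type*} [CommRing R] [CommRing S] (φ : R →+* S) (a b c d e : R) :
    (Q4 a b c d e).map φ = Q4 (φ a) (φ b) (φ c) (φ d) (φ e) := by
  simp [Q4]

lemma Q4_natDegree {R : Type*} [CommRing R] {a b c d e : R} (ha : a ≠ 0) : (Q4 a b c d e).natDegree = 4 := by
  unfold Q4; compute_degree!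

lemma Q4_monic {R : Type*} [CommRing R] {b c d e : R} : (Q4 1 b c d e).Monic := by
  unfold Q4; monicity!

lemma Q4_irr {K : Type*} [Field K] {a b c d e : K} (ha : a ≠ 0) :
    Irreducible (Q4 a b c d e) ↔ Irreducible (Q4 1 (b / a) (c / a) (d / a) (e / a)) := by
  have : Q4 a b c d e = C a * Q4 1 (b / a) (c / a) (d / a) (e / a) := by
    simp only [Q4, mul_add, ← mul_assoc, ← C_mul]
    field_simp
  rw [this]
  exact irreducible_isUnit_mul (isUnit_C.mpr ha.isUnit)

def Good (p : ℕ) (f : BQF) : Prop :=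
  (f.a : ZMod p) ≠ 0 ∧ Irreducible (Q4 (f.a : ZMod p) f.b f.c f.d f.e)

lemma good_irred {p : ℕ} (hp : p.Prime) {f : BQF} (h : Good p f) : f.Irred := by
  have := Fact.mk hp
  obtain ⟨ha, hi⟩ := h
  have ha0 : f.a ≠ 0 := by rintro h; simp [h] at ha
  refine ⟨ha0, ?_⟩
  change Irreducible (Q4 (f.a:ℚ) f.b f.c f.d f.e)
  have haQ : (f.a:ℚ) ≠ 0 := by exact_mod_cast ha0
  rw [Q4_irr haQ]
  have hu : IsUnit (f.a : ℤ_[p]) := by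
    rw [PadicInt.isUnit_iff]
    by_contra hh
    have h1 : ‖(f.a : ℤ_[p])‖ < 1 := lt_of_le_of_ne (PadicInt.norm_le_one _) hh
    rw [PadicInt.norm_intCast_lt_one_iff] at h1
    exact ha ((ZMod.intCast_zmod_eq_zero_iff_dvd _ _).mpr h1)
  obtain ⟨u, hu⟩ := hu
  have hv : (f.a : ℤ_[p]) * ↑u⁻¹ = 1 := by rw [← hu]; simp
  set v : ℤ_[p] := ↑u⁻¹ with hvd
  have hvz : (f.a : ZMod p) * PadicInt.toZMod v = 1 := by
    have := congrArg PadicInt.toZMod hv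
    simpa using this
  have hvq : (f.a : ℚ_[p]) * (algebraMap ℤ_[p] ℚ_[p] v) = 1 := by
    have := congrArg (algebraMap ℤ_[p] ℚ_[p]) hv
    simpa using this
  have e1 : Irreducible ((Q4 (1:ℤ_[p]) (f.b * v) (f.c * v) (f.d * v) (f.e * v)).map PadicInt.toZMod) := by
    rw [Q4_irr ha] at hi
    rw [Q4_map]
    have : PadicInt.toZMod v = (f.a : ZMod p)⁻¹ := (eq_inv_of_mul_eq_one_right hvz)
    simpa [this, div_eq_mul_inv] using hi
  have e2 := Monic.irreducible_of_irreducible_map _ _ Q4_monic e1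
  rw [Monic.irreducible_iff_irreducible_map_fraction_map (K := ℚ_[p]) Q4_monic, Q4_map] at e2
  refine Monic.irreducible_of_irreducible_map (algebraMap ℚ ℚ_[p]) _ Q4_monic ?_
  rw [Q4_map]
  have : (algebraMap ℤ_[p] ℚ_[p] v) = (f.a : ℚ_[p])⁻¹ := (eq_inv_of_mul_eq_one_right hvq)
  simp only [map_mul, this] at e2
  simpa [div_eq_mul_inv] using e2

lemma good_SMod (p : ℕ) : SMod p {f | ¬ Good p f} := by
  intro f g h1 h2 h3 h4 h5
  have key : ∀ x y : ℤ, (p:ℤ) ∣ x - y → (x : ZMod p) = y := fun x y h =>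
    (ZMod.intCast_eq_intCast_iff_dvd_sub _ _ _).mpr (by rw [← neg_sub]; exact (dvd_neg.mpr h))
  simp only [Set.mem_ofPred_eq, Good, key _ _ h1, key _ _ h2, key _ _ h3, key _ _ h4, key _ _ h5]

open Classical in
lemma good_count {p : ℕ} (hp : p.Prime) : (p - 1) * (p ^ 4 - p ^ 2) ≤ 4 * ((rbox p).filter (Good p)).card := by
  have := Fact.mk hp
  let K := GaloisField p 4
  have : Fintype K := Fintype.ofFinite K
  let A : Finset K := Finset.univ.filter fun α => α ^ p ^ 2 ≠ α
  have hA : p ^ 4 - p ^ 2 ≤ A.card := by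
    have h1 : Fintype.card K = p ^ 4 := by
      rw [← Nat.card_eq_fintype_card]; exact GaloisField.card p 4 (by norm_num)
    have h2 : (Finset.univ.filter fun α : K => α ^ p ^ 2 = α).card ≤ p ^ 2 := by
      have hn := FiniteField.X_pow_card_pow_sub_X_ne_zero K (n := 2) (p := p) (by norm_num) hp.one_lt
      have hd := FiniteField.X_pow_card_pow_sub_X_natDegree_eq K (n := 2) (p := p) (by norm_num) hp.one_lt
      calc _ ≤ (X ^ p ^ 2 - X : K[X]).roots.toFinset.card := by
            refine Finset.card_le_card fun α hα => ?_
            rw [Finset.mem_filter] at hα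
            rw [Multiset.mem_toFinset, mem_roots hn]
            simp [hα.2]
        _ ≤ _ := (Multiset.toFinset_card_le _).trans (card_roots' _)
        _ = _ := hd
    have h3 := Finset.card_filter_add_card_filter_not (s := (Finset.univ : Finset K)) (fun α : K => α ^ p ^ 2 = α)
    rw [Finset.card_univ, h1] at h3
    simp only [A, ne_eq]
    omega
  let B : Finset (ZMod p) := Finset.univ.filter fun a => a ≠ 0
  have hB : B.card = p - 1 := by
    simp only [B]
    rw [Finset.filter_ne' , Finset.card_erase_of_mem (Finset.mem_univ _), Finset.card_univ, ZMod.card]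
  have hdeg : ∀ α ∈ A, (minpoly (ZMod p) α).natDegree = 4 := by
    intro α hα
    have hint : IsIntegral (ZMod p) α := Algebra.IsIntegral.isIntegral α
    have h1 : (minpoly (ZMod p) α).natDegree ∣ 4 := by
      have := minpoly.degree_dvd hint
      rwa [GaloisField.finrank p (n := 4) (by norm_num)] at this
    have h2 : ¬ (minpoly (ZMod p) α).natDegree ∣ 2 := by
      rw [(minpoly.irreducible hint).natDegree_dvd_iff_dvd_X_pow_card_pow_sub_X]
      intro hh
      have := (minpoly.dvd_iff.mp hh)
      simp only [Nat.card_zmod, map_sub, map_pow, aeval_X, sub_eq_zero] at this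
      exact (Finset.mem_filter.mp hα).2 this
    have h3 : (minpoly (ZMod p) α).natDegree ≤ 4 := Nat.le_of_dvd (by norm_num) h1
    interval_cases h : (minpoly (ZMod p) α).natDegree
    · norm_num at h1
    · norm_num at h2
    · norm_num at h2
    · norm_num at h1
    · rfl
  let u (α : K) (i : ℕ) : ZMod p := (minpoly (ZMod p) α).coeff i
  let φ (x : ZMod p × K) : BQF := ⟨x.1.val, (x.1 * u x.2 3).val, (x.1 * u x.2 2).val, (x.1 * u x.2 1).val, (x.1 * u x.2 0).val⟩
  have hmp : ∀ α ∈ A, minpoly (ZMod p) α = Q4 1 (u α 3) (u α 2) (u α 1) (u α 0) := by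
    intro α hα
    have hm : (minpoly (ZMod p) α).Monic := minpoly.monic (Algebra.IsIntegral.isIntegral α)
    conv_lhs => rw [hm.as_sum, hdeg α hα]
    simp only [Finset.sum_range_succ, Finset.sum_range_zero, u, Q4]
    simp; ring
  have hred : ∀ x : ZMod p × K, Q4 ((φ x).a : ZMod p) (φ x).b (φ x).c (φ x).d (φ x).e =
      C x.1 * Q4 1 (u x.2 3) (u x.2 2) (u x.2 1) (u x.2 0) := by
    intro x
    simp [φ, Q4, mul_add, mul_assoc]
  rw [← hB, mul_comm 4]
  refine (Nat.mul_le_mul le_rfl hA).trans ?_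
  rw [← Finset.card_product, mul_comm]
  refine Finset.card_le_mul_card_image_of_maps_to (f := φ) ?_ 4 ?_
  · rintro ⟨a, α⟩ hx
    rw [Finset.mem_product] at hx
    have ha := (Finset.mem_filter.mp hx.1).2
    rw [Finset.mem_filter]
    constructor
    · unfold rbox; rw [mem_box]
      simp only [Finset.mem_Ico, φ, Nat.cast_lt, Nat.cast_nonneg, ZMod.val_lt, and_true]
    · refine ⟨by simpa [φ] using ha, ?_⟩
      rw [hred, ← hmp α hx.2]
      exact (irreducible_isUnit_mul (isUnit_C.mpr ha.isUnit)).mpr (minpoly.irreducible (Algebra.IsIntegral.isIntegral α))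
  · intro f hf
    have ha := (Finset.mem_filter.mp hf).2.1
    set P : K[X] := (Q4 (f.a : ZMod p) f.b f.c f.d f.e).map (algebraMap (ZMod p) K) with hP
    have hPd : P.natDegree = 4 := by rw [hP, natDegree_map, Q4_natDegree ha]
    have hP0 : P ≠ 0 := by rintro h; simp [h] at hPd
    calc _ ≤ P.roots.toFinset.card := by
          refine Finset.card_le_card_of_injOn Prod.snd ?_ ?_
          · rintro ⟨a, α⟩ hx
            simp only [Finset.coe_filter, Set.mem_ofPred_eq, Finset.mem_product] at hx
            obtain ⟨hx1, rfl⟩ := hx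
            rw [Finset.mem_coe, Multiset.mem_toFinset, mem_roots hP0, hP, hred, ← hmp α hx1.2]
            simp [IsRoot, eval_map_algebraMap, minpoly.aeval]
          · rintro ⟨a, α⟩ hx ⟨a', α'⟩ hx' hh
            simp only [Finset.coe_filter, Set.mem_ofPred_eq, Finset.mem_product] at hx hx'
            have h1 := congrArg BQF.a (hx.2.trans hx'.2.symm)
            simp only [φ, Nat.cast_inj] at h1
            rw [ZMod.val_injective p h1]
            exact congrArg _ hh
      _ ≤ _ := (Multiset.toFinset_card_le _).trans (card_roots' _)
      _ = 4 := hPd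

open Classical in
lemma dens_good {p : ℕ} (hp : p.Prime) : dens p {f | ¬ Good p f} ≤ 29 / 32 := by
  have h := good_count hp
  have h3 := Finset.card_filter_add_card_filter_not (s := rbox p) (Good p)
  rw [card_rbox] at h3
  have hp2 : (2:ℝ) ≤ p := by exact_mod_cast hp.two_le
  unfold dens
  simp only [Set.mem_ofPred_eq]
  rw [div_le_iff₀ (by positivity)]
  have h' : ((p:ℝ) - 1) * ((p:ℝ) ^ 4 - (p:ℝ) ^ 2) ≤ 4 * (((rbox p).filter (Good p)).card : ℝ) := by
    have e1 : ((p - 1 : ℕ):ℝ) = (p:ℝ) - 1 := by rw [Nat.cast_sub hp.one_le]; simp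
    have e2 : ((p ^ 4 - p ^ 2 : ℕ):ℝ) = (p:ℝ) ^ 4 - (p:ℝ) ^ 2 := by
      rw [Nat.cast_sub (Nat.pow_le_pow_right hp.pos (by norm_num))]; simp
    rw [← e1, ← e2]; exact_mod_cast h
  have h3' : (((rbox p).filter (Good p)).card : ℝ) + (((rbox p).filter (fun f => ¬ Good p f)).card : ℝ) = (p:ℝ) ^ 5 := by
    exact_mod_cast h3
  have : 3 / 8 * (p:ℝ) ^ 5 ≤ ((p:ℝ) - 1) * ((p:ℝ) ^ 4 - (p:ℝ) ^ 2) := by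
    have hq : (p:ℝ) ^ 4 - (p:ℝ) ^ 2 = (p:ℝ) ^ 2 * ((p:ℝ) ^ 2 - 1) := by ring
    have a1 : (p:ℝ) / 2 ≤ (p:ℝ) - 1 := by linarith
    have a2 : 3 / 4 * (p:ℝ) ^ 2 ≤ (p:ℝ) ^ 2 - 1 := by nlinarith
    rw [hq]
    calc _ = (p:ℝ) / 2 * ((p:ℝ) ^ 2 * (3 / 4 * (p:ℝ) ^ 2)) := by ring
      _ ≤ _ := by gcongr; linarith
  linarith

open Classical in
lemma dens_inter {m p : ℕ} (hm : 1 ≤ m) (hp : 1 ≤ p) (hc : Nat.Coprime m p) {S S' : Set BQF} (hS : SMod m S)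
    (hS' : SMod p S') : dens (m * p) (S ∩ S') ≤ dens m S * dens p S' := by
  have key : ((rbox (m * p)).filter (· ∈ S ∩ S')).card ≤
      ((rbox m).filter (· ∈ S)).card * ((rbox p).filter (· ∈ S')).card := by
    rw [← Finset.card_product]
    refine Finset.card_le_card_of_injOn (fun f => (rd m f, rd p f)) ?_ ?_
    · intro f hf
      rw [Finset.mem_coe, Finset.mem_filter] at hf
      rw [Finset.mem_coe, Finset.mem_product, Finset.mem_filter, Finset.mem_filter]
      obtain ⟨h1, h2, h3, h4, h5⟩ := mem_res_rd (m := m) f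
      obtain ⟨k1, k2, k3, k4, k5⟩ := mem_res_rd (m := p) f
      exact ⟨⟨rd_mem hm f, (hS _ _ h1 h2 h3 h4 h5).mp hf.2.1⟩, ⟨rd_mem hp f, (hS' _ _ k1 k2 k3 k4 k5).mp hf.2.2⟩⟩
    · intro f hf g hg hfg
      rw [Finset.mem_coe, Finset.mem_filter] at hf hg
      simp only [Prod.mk.injEq] at hfg
      have hc' : IsCoprime (m:ℤ) (p:ℤ) := Nat.isCoprime_iff_coprime.mpr hc
      have k : ∀ x y : ℤ, x % (m:ℤ) = y % m → x % (p:ℤ) = y % p → ((m * p : ℕ):ℤ) ∣ x - y := by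
        intro x y h1 h2
        push_cast
        exact hc'.mul_dvd (Int.ModEq.dvd (Int.ModEq.symm h1)) (Int.ModEq.dvd (Int.ModEq.symm h2))
      have hfg1 := hfg.1
      have hfg2 := hfg.2
      simp only [rd, BQF.mk.injEq] at hfg1 hfg2
      obtain ⟨h1, h2, h3, h4, h5⟩ := hfg1
      obtain ⟨k1, k2, k3, k4, k5⟩ := hfg2
      have e1 : rd (m * p) f = g := res_eq_rd hg.1 ⟨k _ _ h1 k1, k _ _ h2 k2, k _ _ h3 k3, k _ _ h4 k4, k _ _ h5 k5⟩
      have e2 : rd (m * p) f = f := res_eq_rd hf.1 (by simp [res])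
      exact e2.symm.trans e1
  have hm0 : (0:ℝ) < m := by exact_mod_cast hm
  have hp0 : (0:ℝ) < p := by exact_mod_cast hp
  unfold dens
  rw [div_mul_div_comm, ← mul_pow, Nat.cast_mul]
  gcongr
  rw [← Nat.cast_mul, Nat.cast_le]
  convert key

lemma sieve_set (k : ℕ) : ∃ m : ℕ, 1 ≤ m ∧ ∃ S : Set BQF, SMod m S ∧ (∀ f : BQF, ¬ f.Irred → f ∈ S) ∧
    dens m S ≤ (29 / 32) ^ k := by
  classical
  induction k with
  | zero =>
    refine ⟨1, le_rfl, Set.univ, fun _ _ _ _ _ _ _ => by simp, fun _ _ => trivial, ?_⟩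
    unfold dens; simp [card_rbox]
  | succ k ih =>
    obtain ⟨m, hm, S, hS, hi, hd⟩ := ih
    obtain ⟨p, hpm, hp⟩ := Nat.exists_infinite_primes (m + 1)
    have hc : Nat.Coprime m p := ((Nat.Prime.coprime_iff_not_dvd hp).mpr fun h => by have := Nat.le_of_dvd hm h; omega).symm
    refine ⟨m * p, Nat.mul_pos hm hp.pos, S ∩ {f | ¬ Good p f}, ?_, ?_, ?_⟩
    · intro f g h1 h2 h3 h4 h5
      have k1 : (m:ℤ) ∣ ((m * p : ℕ):ℤ) := by push_cast; exact dvd_mul_right _ _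
      have k2 : (p:ℤ) ∣ ((m * p : ℕ):ℤ) := by push_cast; exact dvd_mul_left _ _
      rw [Set.mem_inter_iff, Set.mem_inter_iff,
        hS f g (k1.trans h1) (k1.trans h2) (k1.trans h3) (k1.trans h4) (k1.trans h5),
        good_SMod p f g (k2.trans h1) (k2.trans h2) (k2.trans h3) (k2.trans h4) (k2.trans h5)]
    · intro f hf
      exact ⟨hi f hf, fun hg => hf (good_irred hp hg)⟩
    · refine (dens_inter hm hp.one_le hc hS (good_SMod p)).trans ?_
      rw [pow_succ]
      have : 0 ≤ dens m S := by unfold dens; positivity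
      exact mul_le_mul hd (dens_good hp) (by unfold dens; positivity) (by positivity)

lemma T_mono {Φ M κ} (h : Tst Φ M κ) (h0 : ∀ v, 0 ≤ Φ v) {C s : ℝ} (hs : 0 < s) {S S' : Set BQF} (hSS : S ⊆ S') :
    T Φ C s S ≤ T Φ C s S' := by
  classical
  obtain ⟨L, hL⟩ := exists_nat_ge (M * s)
  rw [T_eq h hs hL, T_eq h hs hL]
  refine Finset.sum_le_sum fun f _ => ?_
  have : 0 ≤ wf Φ C s f := by unfold wf w; split_ifs; exacts [h0 _, le_rfl]
  by_cases hf : f ∈ S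
  · rw [if_pos hf, if_pos (hSS hf)]
  · rw [if_neg hf]; split_ifs; exacts [this, le_rfl]

lemma sieve {Φ M κ} (h : Tst Φ M κ) (h0 : ∀ v, 0 ≤ Φ v) (C : ℝ) (hC : 0 < C) (ε : ℝ) (hε : 0 < ε) :
    ∃ s0 : ℝ, 1 ≤ s0 ∧ ∀ s, s0 ≤ s → T Φ C s {f | ¬ f.Irred} ≤ ε * s ^ 4 := by
  obtain ⟨K, s1, hK, hs1, hb⟩ := T_univ_bound h C hC
  obtain ⟨k, hk⟩ := exists_pow_lt_of_lt_one (show 0 < ε / (2 * K) by positivity) (show (29/32:ℝ) < 1 by norm_num)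
  obtain ⟨m, hm, S, hS, hi, hd⟩ := sieve_set k
  obtain ⟨s2, hs2, he⟩ := equidist h C hC m hm S hS (ε / 2) (by positivity)
  refine ⟨max s1 s2, le_max_of_le_left hs1, fun s hs => ?_⟩
  have k1 := hb s (le_of_max_le_left hs)
  have k2 := he s (le_of_max_le_right hs)
  have hsp : 0 < s := by linarith [le_of_max_le_left hs]
  have k3 : T Φ C s {f | ¬ f.Irred} ≤ T Φ C s S := T_mono h h0 hsp fun f hf => hi f hf
  have hd0 : 0 ≤ dens m S := by unfold dens; positivity
  have k4 : dens m S * T Φ C s Set.univ ≤ ε / (2 * K) * (K * s ^ 4) :=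
    mul_le_mul_of_nonneg (hd.trans hk.le) ((le_abs_self _).trans k1) hd0 (by positivity)
  have k5 : ε / (2 * K) * (K * s ^ 4) = ε / 2 * s ^ 4 := by field_simp
  have := (le_abs_self _).trans k2
  linarith

end BQFC


namespace BQFC

lemma fib {α β : Type*} (B : Set α) (φ : α → β) (t : Finset β) (N : β → ℝ) (h : ∀ x ∈ B, φ x ∈ t)
    (hN : ∀ b ∈ t, {x ∈ B | φ x = b}.Finite ∧ ({x ∈ B | φ x = b}.ncard : ℝ) ≤ N b) :
    B.Finite ∧ (B.ncard : ℝ) ≤ ∑ b ∈ t, N b := by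
  classical
  have e : B = ⋃ b ∈ t, {x ∈ B | φ x = b} := by
    ext x; simp only [Set.mem_iUnion, Set.mem_ofPred_eq, exists_prop]
    exact ⟨fun hx => ⟨φ x, h x hx, hx, rfl⟩, fun ⟨_, _, hx, _⟩ => hx⟩
  have hf : B.Finite := by
    rw [e]; exact Set.Finite.biUnion t.finite_toSet fun b hb => (hN b hb).1
  refine ⟨hf, ?_⟩
  rw [Set.ncard_eq_toFinset_card B hf, Finset.card_eq_sum_card_fiberwise (t := t) (f := φ) (by intro x hx; simpa using h x (by simpa using hx))]
  push_cast
  refine Finset.sum_le_sum fun b hb => ?_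
  refine le_trans (le_of_eq ?_) (hN b hb).2
  rw [← Set.ncard_coe_finset]
  congr 2
  ext x; simp

lemma icnt (x y : ℝ) (hxy : x ≤ y) (D : Set ℤ) (hD : ∀ z ∈ D, x ≤ z ∧ (z:ℝ) ≤ y) :
    D.Finite ∧ (D.ncard : ℝ) ≤ y - x + 1 := by
  have hs : D ⊆ ↑(Finset.Icc ⌈x⌉ ⌊y⌋) := by
    intro z hz; rw [Finset.mem_coe, Finset.mem_Icc]
    exact ⟨Int.ceil_le.mpr (hD z hz).1, Int.le_floor.mpr (hD z hz).2⟩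
  have h2 : D.ncard ≤ (Finset.Icc ⌈x⌉ ⌊y⌋).card := by
    rw [← Set.ncard_coe_finset]; exact Set.ncard_le_ncard hs (Finset.finite_toSet _)
  refine ⟨(Finset.finite_toSet _).subset hs, (Nat.cast_le.mpr h2).trans ?_⟩
  rw [Int.card_Icc]
  have h3 : ((⌊y⌋ + 1 - ⌈x⌉).toNat : ℝ) = max ((⌊y⌋:ℝ) + 1 - ⌈x⌉) 0 := by
    rw [← Int.cast_natCast, Int.toNat_eq_max]; push_cast; rfl
  rw [h3]
  exact max_le (by linarith [Int.floor_le y, Int.le_ceil x]) (by linarith)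

/-- integers `d` with `|u+v d|` within `R` of `t` -/
lemma dcnt (u v t R : ℝ) (hv : 0 < v) (hR : 0 ≤ R) (D : Set ℤ) (hD : ∀ z ∈ D, |(|u + v * z|) - t| ≤ R) :
    D.Finite ∧ (D.ncard : ℝ) ≤ 2 + 4 * R / v := by
  have h1 := icnt ((t - R - u) / v) ((t + R - u) / v) (by gcongr; linarith) {z ∈ D | 0 ≤ u + v * z} (by
    rintro z ⟨hz, h0⟩
    have := hD z hz
    rw [abs_of_nonneg h0, abs_le] at this
    rw [div_le_iff₀ hv, le_div_iff₀ hv]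
    constructor <;> linarith)
  have h2 := icnt ((-t - R - u) / v) ((-t + R - u) / v) (by gcongr; linarith) {z ∈ D | ¬ 0 ≤ u + v * z} (by
    rintro z ⟨hz, h0⟩
    have := hD z hz
    rw [abs_of_neg (not_le.mp h0), abs_le] at this
    rw [div_le_iff₀ hv, le_div_iff₀ hv]
    constructor <;> linarith)
  have e : D = {z ∈ D | 0 ≤ u + v * z} ∪ {z ∈ D | ¬ 0 ≤ u + v * z} := by
    ext z; simp only [Set.mem_union, Set.mem_ofPred_eq]; tauto
  constructor
  · rw [e]; exact h1.1.union h2.1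
  · have h3 : (D.ncard:ℝ) ≤ ({z ∈ D | 0 ≤ u + v * z}.ncard : ℝ) + ({z ∈ D | ¬ 0 ≤ u + v * z}.ncard:ℝ) := by
      conv_lhs => rw [e]
      exact_mod_cast Set.ncard_union_le _ _
    have e1 : (t + R - u) / v - (t - R - u) / v = 2 * R / v := by ring
    have e2 : (-t + R - u) / v - (-t - R - u) / v = 2 * R / v := by ring
    have h1' := h1.2; have h2' := h2.2
    rw [e1] at h1'; rw [e2] at h2'
    have : 4 * R / v = 2 * R / v + 2 * R / v := by ring
    linarith

lemma sq_close1 {g y H : ℝ} (h : |g ^ 2 - y| ≤ H) : |(|g|) - √y| ≤ √H := by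
  refine Real.abs_le_sqrt ?_
  have hg := abs_nonneg g
  have hg2 := sq_abs g
  rcases le_total 0 y with hy | hy
  · have hs := Real.sq_sqrt hy
    have hs0 := Real.sqrt_nonneg y
    rw [abs_le] at h
    rcases le_total (|g|) (√y) with h1 | h1 <;> nlinarith
  · rw [Real.sqrt_eq_zero'.mpr hy]
    rw [abs_le] at h
    nlinarith

lemma sq_close2 {g y H q : ℝ} (hq : 0 < q) (hy : q ^ 2 ≤ |y|) (h : |g ^ 2 - y| ≤ H) : |(|g|) - √y| ≤ H / q := by
  have hg := abs_nonneg g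
  have hg2 := sq_abs g
  have hH : 0 ≤ H := (abs_nonneg _).trans h
  rcases le_total 0 y with h0 | h0
  · rw [abs_of_nonneg h0] at hy
    have hs := Real.sq_sqrt h0
    have hs0 : q ≤ √y := Real.le_sqrt_of_sq_le hy
    rw [le_div_iff₀ hq]
    have e : |(|g|) - √y| * (|g| + √y) = |g ^ 2 - y| := by
      rw [← abs_of_nonneg (show 0 ≤ |g| + √y by positivity), ← abs_mul]; congr 1; nlinarith
    have := abs_nonneg (|g| - √y)
    nlinarith
  · rw [Real.sqrt_eq_zero'.mpr h0, sub_zero, abs_of_nonneg hg, le_div_iff₀ hq]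
    rw [abs_of_nonpos h0] at hy
    rw [abs_le] at h
    have h1 : |g| ^ 2 + q ^ 2 ≤ H := by linarith
    nlinarith [sq_nonneg (|g| - q)]

end BQFC


namespace BQFC

noncomputable def gg (f : BQF) : ℝ := (f.b:ℝ) ^ 3 - 4 * f.a * f.b * f.c + 8 * f.a ^ 2 * f.d
noncomputable def IR (f : BQF) : ℝ := Ir f.a f.b f.c f.d f.e
noncomputable def JR (f : BQF) : ℝ := Jr f.a f.b f.c f.d f.e
noncomputable def pR (f : BQF) : ℝ := pf f.a f.b f.c

lemma syz (f : BQF) : 27 * gg f ^ 2 = pR f ^ 3 - 48 * f.a ^ 2 * pR f * IR f - 64 * f.a ^ 3 * JR f := by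
  unfold gg pR IR JR pf Ir Jr; ring

lemma syz_close (f : BQF) {I0 δ T : ℝ} (hI : |IR f - I0| ≤ δ) (hJ : |JR f| ≤ T) :
    |gg f ^ 2 - (pR f ^ 3 - 48 * f.a ^ 2 * pR f * I0) / 27| ≤ (48 * |(f.a:ℝ)| ^ 2 * |pR f| * δ + 64 * |(f.a:ℝ)| ^ 3 * T) / 27 := by
  have e : gg f ^ 2 - (pR f ^ 3 - 48 * f.a ^ 2 * pR f * I0) / 27 =
    (-(48 * (f.a:ℝ) ^ 2 * pR f * (IR f - I0)) - 64 * f.a ^ 3 * JR f) / 27 := by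
    have := syz f; linarith
  rw [e, abs_div, abs_of_pos (show (0:ℝ) < 27 by norm_num)]
  gcongr
  refine (abs_sub _ _).trans ?_
  rw [abs_neg]; simp only [abs_mul, abs_pow, abs_of_pos (show (0:ℝ) < 48 by norm_num), abs_of_pos (show (0:ℝ) < 64 by norm_num)]
  gcongr

lemma fibd (B : Set BQF) (a b c : ℤ) (ha : a ≠ 0) (hB : ∀ f ∈ B, f.a = a ∧ f.b = b ∧ f.c = c) (t R I0 δ T E : ℝ)
    (hR : 0 ≤ R) (hE : 0 ≤ E)
    (hd : ∀ f ∈ B, |(|gg f|) - t| ≤ R) (hI : ∀ f ∈ B, |IR f - I0| ≤ δ) (hJ : ∀ f ∈ B, |JR f| ≤ T)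
    (he : (pf a b c ≠ 0 ∧ 2 * T ≤ 9 * |pf a b c| * E) ∨ 2 * δ ≤ 12 * |(a:ℝ)| * E) :
    B.Finite ∧ (B.ncard:ℝ) ≤ (2 + R / (2 * a ^ 2)) * (1 + E) := by
  have ha' : (0:ℝ) < |(a:ℝ)| := by rw [abs_pos]; exact_mod_cast ha
  have haR : (a:ℝ) ≠ 0 := by exact_mod_cast ha
  have hD := dcnt ((b:ℝ) ^ 3 - 4 * a * b * c) (8 * (a:ℝ) ^ 2) t R (by positivity) hR (BQF.d '' B) (by
    rintro _ ⟨f, hf, rfl⟩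
    have := hd f hf
    obtain ⟨h1, h2, h3⟩ := hB f hf
    unfold gg at this; rwa [h1, h2, h3] at this)
  have key := fib B BQF.d hD.1.toFinset (fun _ => 1 + E) (fun f hf => by simpa using ⟨f, hf, rfl⟩) (by
    intro d0 _
    have inj : Set.InjOn BQF.e {f ∈ B | f.d = d0} := by
      rintro ⟨a1, b1, c1, d1, e1⟩ ⟨h1, h2⟩ ⟨a2, b2, c2, d2, e2⟩ ⟨h3, h4⟩ h
      obtain ⟨k1, k2, k3⟩ := hB _ h1
      obtain ⟨k4, k5, k6⟩ := hB _ h3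
      simp only at *
      subst_vars; rfl
    have main : (BQF.e '' {f ∈ B | f.d = d0}).Finite ∧ ((BQF.e '' {f ∈ B | f.d = d0}).ncard : ℝ) ≤ 1 + E := by
      rcases he with ⟨hp, he⟩ | he
      · have hp' : 0 < |pf a b c| := abs_pos.mpr hp
        have := icnt (qn a b c d0 / (9 * pf a b c) - E / 2) (qn a b c d0 / (9 * pf a b c) + E / 2) (by linarith) (BQF.e '' {f ∈ B | f.d = d0}) (by
          rintro _ ⟨f, ⟨hf, h4⟩, rfl⟩
          obtain ⟨h1, h2, h3⟩ := hB f hf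
          have h := hJ f hf
          unfold JR at h
          rw [h1, h2, h3, h4, Jr_eq] at h
          have e : qn a b c d0 - 9 * pf a b c * f.e = -(9 * pf a b c * (f.e - qn a b c d0 / (9 * pf a b c))) := by
            field_simp; ring
          rw [e, abs_neg, abs_mul, abs_mul, abs_of_pos (show (0:ℝ) < 9 by norm_num)] at h
          have : |f.e - qn a b c d0 / (9 * pf a b c)| ≤ E / 2 := by
            have : 9 * |pf a b c| * |f.e - qn a b c d0 / (9 * pf a b c)| ≤ 9 * |pf a b c| * (E / 2) := by linarith
            exact le_of_mul_le_mul_left this (by positivity)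
          rw [abs_le] at this
          constructor <;> linarith)
        exact ⟨this.1, this.2.trans (by linarith)⟩
      · have := icnt ((I0 + 3 * b * d0 - c ^ 2) / (12 * a) - E / 2) ((I0 + 3 * b * d0 - c ^ 2) / (12 * a) + E / 2) (by linarith) (BQF.e '' {f ∈ B | f.d = d0}) (by
          rintro _ ⟨f, ⟨hf, h4⟩, rfl⟩
          obtain ⟨h1, h2, h3⟩ := hB f hf
          have h := hI f hf
          unfold IR Ir at h
          rw [h1, h2, h3, h4] at h
          have e : 12 * (a:ℝ) * f.e - 3 * b * d0 + c ^ 2 - I0 = 12 * a * (f.e - (I0 + 3 * b * d0 - c ^ 2) / (12 * a)) := by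
            field_simp; ring
          rw [e, abs_mul, abs_mul, abs_of_pos (show (0:ℝ) < 12 by norm_num)] at h
          have : |f.e - (I0 + 3 * b * d0 - c ^ 2) / (12 * a)| ≤ E / 2 := by
            refine le_of_mul_le_mul_left (a := 12 * |(a:ℝ)|) ?_ (by positivity)
            linarith
          rw [abs_le] at this
          constructor <;> linarith)
        exact ⟨this.1, this.2.trans (by linarith)⟩
    exact ⟨Set.Finite.of_finite_image main.1 inj, by rw [← inj.ncard_image]; exact main.2⟩)
  refine ⟨key.1, key.2.trans ?_⟩
  rw [Finset.sum_const, nsmul_eq_mul, ← Set.ncard_eq_toFinset_card _ hD.1]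
  gcongr
  refine hD.2.trans (le_of_eq ?_)
  field_simp; ring

lemma sum_inv_sqrt (N : ℕ) : ∑ n ∈ Finset.range N, 1 / √((n:ℝ) + 1) ≤ 2 * √N := by
  induction N with
  | zero => simp
  | succ N ih =>
    rw [Finset.sum_range_succ]
    have h1 : 0 < √((N:ℝ) + 1) := Real.sqrt_pos.mpr (by positivity)
    have h2 := Real.sqrt_nonneg (N:ℝ)
    have e1 := Real.sq_sqrt (show (0:ℝ) ≤ N by positivity)
    have e2 := Real.sq_sqrt (show (0:ℝ) ≤ (N:ℝ) + 1 by positivity)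
    have : 1 / √((N:ℝ) + 1) ≤ 2 * √((N:ℝ) + 1) - 2 * √N := by
      rw [div_le_iff₀ h1]; linarith [sq_nonneg (√((N:ℝ) + 1) - √N)]
    push_cast
    linarith

lemma sum_inv_32 (k N : ℕ) (hk : 1 ≤ k) (hN : k ≤ N) :
    ∑ n ∈ Finset.Ico k N, 1 / (√((n:ℝ) + 1) * ((n:ℝ) + 1)) ≤ 2 / √k - 2 / √N := by
  induction N, hN using Nat.le_induction with
  | base => simp
  | succ N hN ih =>
    rw [Finset.sum_Ico_succ_top hN]
    have hN0 : (0:ℝ) < N := by exact_mod_cast (by omega : 0 < N)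
    have h1 : 0 < √((N:ℝ) + 1) := Real.sqrt_pos.mpr (by positivity)
    have h2 : 0 < √(N:ℝ) := Real.sqrt_pos.mpr hN0
    have e1 := Real.sq_sqrt hN0.le
    have e2 := Real.sq_sqrt (show (0:ℝ) ≤ (N:ℝ) + 1 by positivity)
    have h3 : √(N:ℝ) ≤ √((N:ℝ) + 1) := Real.sqrt_le_sqrt (by linarith)
    have : 1 / (√((N:ℝ) + 1) * ((N:ℝ) + 1)) ≤ 2 / √N - 2 / √((N:ℝ) + 1) := by
      rw [← e2, Real.sqrt_sq h1.le, div_sub_div _ _ h2.ne' h1.ne', div_le_div_iff₀ (by positivity) (by positivity)]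
      set x := √(N:ℝ)
      set y := √((N:ℝ) + 1)
      have e : y ^ 2 = x ^ 2 + 1 := by linarith
      have : x ≤ 2 * y ^ 2 * (y - x) := by
        have : (y - x) * (y + x) = 1 := by linarith
        have h4 : x * (y + x) ≤ 2 * y ^ 2 := by nlinarith
        have h5 : 0 ≤ y - x := by linarith
        calc x = (y - x) * (x * (y + x)) := by linear_combination (-x) * this
          _ ≤ (y - x) * (2 * y ^ 2) := by gcongr
          _ = _ := by ring
      nlinarith
    push_cast
    linarith

lemma sum_min (s : ℝ) (hs : 1 ≤ s) (N : ℕ) :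
    ∑ n ∈ Finset.range N, min (1 / √((n:ℝ) + 1)) (s / (√((n:ℝ) + 1) * ((n:ℝ) + 1))) ≤ 6 * √s := by
  have hsp : 0 < √s := Real.sqrt_pos.mpr (by linarith)
  have hk : 1 ≤ ⌊s⌋₊ := Nat.le_floor (by simpa using hs)
  have hk1 : (⌊s⌋₊:ℝ) ≤ s := Nat.floor_le (by linarith)
  have hk2 : s / 2 ≤ ⌊s⌋₊ := by
    have := Nat.lt_floor_add_one s
    have : (1:ℝ) ≤ ⌊s⌋₊ := by exact_mod_cast hk
    linarith
  set k := ⌊s⌋₊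
  have h0 : ∑ n ∈ Finset.range (max N k), min (1 / √((n:ℝ) + 1)) (s / (√((n:ℝ) + 1) * ((n:ℝ) + 1))) ≤ 6 * √s := by
    rw [← Finset.sum_range_add_sum_Ico _ (le_max_right N k)]
    have a1 : ∑ n ∈ Finset.range k, min (1 / √((n:ℝ) + 1)) (s / (√((n:ℝ) + 1) * ((n:ℝ) + 1))) ≤ 2 * √s :=
      (Finset.sum_le_sum fun n _ => min_le_left _ _).trans ((sum_inv_sqrt k).trans (by gcongr))
    have a2 : ∑ n ∈ Finset.Ico k (max N k), min (1 / √((n:ℝ) + 1)) (s / (√((n:ℝ) + 1) * ((n:ℝ) + 1))) ≤ 4 * √s := by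
      refine (Finset.sum_le_sum fun n _ => min_le_right _ _).trans ?_
      have := sum_inv_32 k (max N k) hk (le_max_right N k)
      have e : ∀ n : ℕ, s / (√((n:ℝ) + 1) * ((n:ℝ) + 1)) = s * (1 / (√((n:ℝ) + 1) * ((n:ℝ) + 1))) := fun n => by ring
      simp only [e, ← Finset.mul_sum]
      have h3 : 2 / √(k:ℝ) ≤ 4 / √s := by
        rw [div_le_div_iff₀ (Real.sqrt_pos.mpr (by exact_mod_cast hk)) hsp]
        have : √s ≤ 2 * √(k:ℝ) := by
          rw [Real.sqrt_le_left (by positivity), mul_pow, Real.sq_sqrt (by positivity)]; linarith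
        linarith
      calc _ ≤ s * (4 / √s) := by
            gcongr
            have : 0 ≤ 2 / √((max N k : ℕ):ℝ) := by positivity
            linarith
        _ = 4 * √s := by
            rw [mul_div_assoc', div_eq_iff hsp.ne', mul_assoc, Real.mul_self_sqrt (by linarith)]; ring
    linarith
  refine le_trans (Finset.sum_le_sum_of_subset_of_nonneg (Finset.range_mono (le_max_left N k)) fun n _ _ => ?_) h0
  positivity

end BQFC


namespace BQFC

def Cus (C M s : ℝ) : Set BQF := {f | f.a ≠ 0 ∧ |(f.a:ℝ)| ≤ s ∧ |f.b| ≤ 2 * |f.a| ∧ |pR f| ≤ M * s ^ 2 ∧ |IR f| ≤ s ^ 2 ∧ |JR f| ≤ C * s ^ 2}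

set_option maxHeartbeats 1600000 in
lemma cusp_abc {C M s : ℝ} (hC : 0 < C) (hM : 0 < M) (hs : 1 ≤ s) (B : Set BQF) (hBC : B ⊆ Cus C M s) (a b c : ℤ)
    (hB : ∀ f ∈ B, f.a = a ∧ f.b = b ∧ f.c = c) (n : ℕ) (hn1 : 8 * |(a:ℝ)| * n ≤ |pf a b c|)
    (hn2 : |pf a b c| ≤ 8 * |(a:ℝ)| * (n + 1)) :
    B.Finite ∧ (B.ncard : ℝ) ≤ (2 * (M + 1) + (16 + 3 * C)) * ((M + 1) + (C + 1)) * (s ^ 3 / √|(a:ℝ)| ^ 3) *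
      min (1 / √((n:ℝ) + 1)) (s / (√((n:ℝ) + 1) * ((n:ℝ) + 1))) := by
  rcases B.eq_empty_or_nonempty with rfl | ⟨f0, hf0⟩
  · simp; positivity
  obtain ⟨h1, h2, h3⟩ := hB f0 hf0
  obtain ⟨k1, k2, k3, k4, k5, k6⟩ := hBC hf0
  have hpe : ∀ f ∈ B, pR f = pf a b c := fun f hf => by
    obtain ⟨h1, h2, h3⟩ := hB f hf
    unfold pR; rw [h1, h2, h3]
  rw [hpe f0 hf0] at k4
  rw [h1] at k1 k2
  have ha1 : (1:ℝ) ≤ |(a:ℝ)| := by exact_mod_cast Int.one_le_abs k1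
  set x := √|(a:ℝ)| with hx
  set z := √((n:ℝ) + 1) with hz
  have hx2 : x ^ 2 = |(a:ℝ)| := Real.sq_sqrt (by positivity)
  have hz2 : z ^ 2 = (n:ℝ) + 1 := Real.sq_sqrt (by positivity)
  have hx1 : 1 ≤ x := Real.one_le_sqrt.mpr ha1
  have hz1 : 1 ≤ z := Real.one_le_sqrt.mpr (by linarith [Nat.cast_nonneg (α := ℝ) n])
  have hx0 : 0 < x := by linarith
  have hz0 : 0 < z := by linarith
  have hs0 : 0 < s := by linarith
  set P := |pf a b c| with hP
  rw [← hz2, ← hx2] at hn2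
  rw [← hx2] at hn1 k2
  have hnz : (n:ℝ) = z ^ 2 - 1 := by linarith
  rw [hnz] at hn1
  have hM1 : x ^ 2 * z ^ 2 ≤ (M + 1) * s ^ 2 := by
    linarith [mul_le_mul_of_nonneg_left hs hs0.le, show 0 ≤ M * s ^ 2 by positivity]
  set H := (16 + 3 * C) * (x ^ 6 * z ^ 2 * s ^ 2) with hH
  set μ := min z (s / z) with hμ
  have hμ0 : 0 < μ := lt_min hz0 (by positivity)
  have hclose : ∀ f ∈ B, |gg f ^ 2 - pf a b c ^ 3 / 27| ≤ H := by
    intro f hf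
    obtain ⟨h1, h2, h3⟩ := hB f hf
    have := syz_close f (I0 := 0) (δ := s ^ 2) (T := C * s ^ 2) (by simpa using (hBC hf).2.2.2.2.1) (hBC hf).2.2.2.2.2
    rw [hpe f hf, h1] at this
    rw [mul_zero, sub_zero, ← hP, ← hx2] at this
    refine this.trans ?_
    rw [hH]
    have a1 : 48 * (x ^ 2) ^ 2 * P * s ^ 2 ≤ 48 * (x ^ 2) ^ 2 * (8 * x ^ 2 * z ^ 2) * s ^ 2 := by gcongr
    have a2 : 64 * (x ^ 2) ^ 3 * (C * s ^ 2) ≤ 64 * (x ^ 2) ^ 3 * (C * s ^ 2) * z ^ 2 :=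
      le_mul_of_one_le_right (by positivity) (one_le_pow₀ hz1)
    have a3 : 0 ≤ x ^ 6 * z ^ 2 * s ^ 2 := by positivity
    have a4 : 0 ≤ C * (x ^ 6 * z ^ 2 * s ^ 2) := by positivity
    rw [div_le_iff₀ (by norm_num)]
    linarith
  have hk : 1 ≤ 16 + 3 * C := by linarith
  have hR1 : √H ≤ (16 + 3 * C) * (x ^ 3 * s * z) := by
    rw [Real.sqrt_le_left (by positivity), hH]
    have : (16 + 3 * C) * 1 ≤ (16 + 3 * C) * (16 + 3 * C) := by gcongr
    have a3 : 0 ≤ x ^ 6 * z ^ 2 * s ^ 2 := by positivity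
    linarith [mul_le_mul_of_nonneg_right this a3]
  have hcl : ∀ f ∈ B, |(|gg f|) - √(pf a b c ^ 3 / 27)| ≤ (16 + 3 * C) * (x ^ 3 * s * μ) := by
    intro f hf
    have b1 := (sq_close1 (hclose f hf)).trans hR1
    have b2 : |(|gg f|) - √(pf a b c ^ 3 / 27)| ≤ (16 + 3 * C) * (x ^ 3 * s * (s / z)) := by
      rcases Nat.eq_zero_or_pos n with h0 | h0
      · refine b1.trans ?_
        have : z = 1 := by rw [hz, h0]; simp
        rw [this]; gcongr; simpa using hs
      · have h0' : (1:ℝ) ≤ n := by exact_mod_cast h0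
        have hPl : 4 * x ^ 2 * z ^ 2 ≤ P := by linarith [mul_le_mul_of_nonneg_left (show 2 ≤ z ^ 2 by linarith) (sq_nonneg x)]
        have := sq_close2 (q := x ^ 3 * z ^ 3) (by positivity) (by
          rw [abs_div, abs_pow, ← hP, abs_of_pos (show (0:ℝ) < 27 by norm_num), le_div_iff₀ (by norm_num)]
          calc (x ^ 3 * z ^ 3) ^ 2 * 27 ≤ (4 * x ^ 2 * z ^ 2) ^ 3 := by
                have a3 : 0 ≤ x ^ 6 * z ^ 6 := by positivity
                linarith
            _ ≤ _ := by gcongr) (hclose f hf)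
        refine this.trans (le_of_eq ?_)
        rw [hH]; field_simp
    rcases min_choice z (s / z) with h | h
    · rw [hμ, h]; exact b1
    · rw [hμ, h]; exact b2
  have main := fibd B a b c k1 hB _ _ 0 (s ^ 2) (C * s ^ 2) ((C + 1) * s ^ 2 / (x ^ 2 * z ^ 2)) (by positivity) (by positivity) hcl
    (fun f hf => by simpa using (hBC hf).2.2.2.2.1) (fun f hf => (hBC hf).2.2.2.2.2) (by
      rcases Nat.eq_zero_or_pos n with h0 | h0
      · right
        have : z = 1 := by rw [hz, h0]; simp
        rw [← hx2, this]
        have : 12 * x ^ 2 * ((C + 1) * s ^ 2 / (x ^ 2 * 1 ^ 2)) = 12 * (C + 1) * s ^ 2 := by field_simp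
        rw [this]
        linarith [sq_nonneg s, mul_pos hC (pow_pos hs0 2)]
      · left
        have h0' : (1:ℝ) ≤ n := by exact_mod_cast h0
        have hPl : 4 * x ^ 2 * z ^ 2 ≤ P := by linarith [mul_le_mul_of_nonneg_left (show 2 ≤ z ^ 2 by linarith) (sq_nonneg x)]
        have hP0 : 0 < P := lt_of_lt_of_le (by positivity) hPl
        refine ⟨abs_pos.mp hP0, ?_⟩
        calc 2 * (C * s ^ 2) ≤ 36 * ((C + 1) * s ^ 2) := by linarith [sq_nonneg s, mul_pos hC (pow_pos hs0 2)]
          _ = 9 * (4 * x ^ 2 * z ^ 2) * ((C + 1) * s ^ 2 / (x ^ 2 * z ^ 2)) := by field_simp; ring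
          _ ≤ _ := by gcongr)
  refine ⟨main.1, main.2.trans ?_⟩
  have hxs : x ≤ s := by linarith [mul_le_mul_of_nonneg_left hx1 hx0.le]
  have e0 : (a:ℝ) ^ 2 = x ^ 4 := by rw [← sq_abs, ← hx2]; ring
  have c1 : 2 ≤ 2 * (M + 1) * (s * μ / x) := by
    have : x ≤ (M + 1) * (s * μ) := by
      rcases min_choice z (s / z) with h | h
      · rw [hμ, h]
        have : x ≤ s * z := by linarith [mul_le_mul_of_nonneg_left hz1 hs0.le]
        linarith [show 0 ≤ M * (s * z) by positivity]
      · rw [hμ, h, mul_div_assoc', mul_div_assoc', le_div_iff₀ hz0]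
        have : (x * z) ^ 2 ≤ ((M + 1) * (s * s)) ^ 2 := by
          calc (x * z) ^ 2 = x ^ 2 * z ^ 2 := by ring
            _ ≤ (M + 1) * s ^ 2 := hM1
            _ ≤ (M + 1) * s ^ 2 * ((M + 1) * s ^ 2) := by
              refine le_mul_of_one_le_right (by positivity) ?_
              linarith [one_le_pow₀ hs (n := 2), show 0 ≤ M * s ^ 2 by positivity]
            _ = _ := by ring
        exact abs_le_of_sq_le_sq' this (by positivity) |>.2
    rw [mul_div_assoc', le_div_iff₀ hx0]; linarith
  have c2 : 1 ≤ (M + 1) * (s ^ 2 / (x ^ 2 * z ^ 2)) := by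
    rw [mul_div_assoc', le_div_iff₀ (by positivity)]; linarith
  have c3 : (16 + 3 * C) * (x ^ 3 * s * μ) / (2 * (a:ℝ) ^ 2) ≤ (16 + 3 * C) * (s * μ / x) := by
    rw [e0, mul_div_assoc]
    refine mul_le_mul_of_nonneg_left ?_ (by positivity)
    rw [div_le_div_iff₀ (by positivity) hx0]
    linarith [show 0 ≤ s * μ * x ^ 4 by positivity]
  calc _ ≤ ((2 * (M + 1) + (16 + 3 * C)) * (s * μ / x)) * (((M + 1) + (C + 1)) * (s ^ 2 / (x ^ 2 * z ^ 2))) := by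
        gcongr
        · linarith
        · rw [add_mul ( M + 1), mul_div_assoc (C + 1)]; linarith
    _ = (2 * (M + 1) + (16 + 3 * C)) * ((M + 1) + (C + 1)) * (s ^ 3 / x ^ 3) * (μ / z ^ 2) := by field_simp
    _ = _ := by
        congr 1
        rw [hμ, ← min_div_div_right (by positivity)]
        congr 1
        · field_simp
        · rw [← hz2]; field_simp

lemma cusp_ab {C M s : ℝ} (hC : 0 < C) (hM : 0 < M) (hs : 1 ≤ s) (B : Set BQF) (hBC : B ⊆ Cus C M s) (a b : ℤ)
    (hB : ∀ f ∈ B, f.a = a ∧ f.b = b) :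
    B.Finite ∧ (B.ncard : ℝ) ≤ (2 * (M + 1) + (16 + 3 * C)) * ((M + 1) + (C + 1)) * (s ^ 3 / √|(a:ℝ)| ^ 3) * (12 * √s) := by
  rcases eq_or_ne a 0 with ha | ha
  · have : B = ∅ := by
      ext f; simp only [Set.mem_empty_iff_false, iff_false]
      exact fun hf => (hBC hf).1 ((hB f hf).1.trans ha)
    rw [this]; simp; positivity
  set pz : BQF → ℤ := fun f => 3 * f.b ^ 2 - 8 * f.a * f.c with hpz
  have hpR : ∀ f, ((pz f : ℤ) : ℝ) = pR f := fun f => by simp [hpz, pR, pf]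
  set N := ⌊M * s ^ 2⌋₊ + 1
  have ha1 : 1 ≤ |a| := Int.one_le_abs ha
  have hna : (a.natAbs : ℤ) = |a| := Int.natCast_natAbs a
  have key := fib B (fun f => (decide (0 ≤ pz f), (pz f).natAbs / (8 * a.natAbs)))
    (Finset.univ ×ˢ Finset.range N) (fun x => (2 * (M + 1) + (16 + 3 * C)) * ((M + 1) + (C + 1)) * (s ^ 3 / √|(a:ℝ)| ^ 3) *
      min (1 / √((x.2:ℝ) + 1)) (s / (√((x.2:ℝ) + 1) * ((x.2:ℝ) + 1)))) (by
    intro f hf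
    simp only [Finset.mem_product, Finset.mem_univ, true_and, Finset.mem_range, N]
    refine Nat.lt_succ_of_le ((Nat.div_le_self _ _).trans (Nat.le_floor ?_))
    rw [Nat.cast_natAbs, Int.cast_abs, hpR]
    exact (hBC hf).2.2.2.1) (by
    rintro ⟨σ, n⟩ _
    rcases Set.eq_empty_or_nonempty {f ∈ B | (decide (0 ≤ pz f), (pz f).natAbs / (8 * a.natAbs)) = (σ, n)} with h | ⟨f0, hf0⟩
    · rw [h]; simp; positivity
    have hh : 8 * a.natAbs * n ≤ (pz f0).natAbs ∧ (pz f0).natAbs < 8 * a.natAbs * (n + 1) := by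
      have h2 := (Prod.mk.inj hf0.2).2
      have h8 : 0 < 8 * a.natAbs := by omega
      rw [← h2]
      exact ⟨Nat.mul_div_le _ _, Nat.lt_mul_div_succ _ h8⟩
    have hpf : |pf a b f0.c| = ((pz f0).natAbs : ℝ) := by
      rw [Nat.cast_natAbs, Int.cast_abs, hpR]; unfold pR; rw [(hB f0 hf0.1).1, (hB f0 hf0.1).2]
    have haR : |(a:ℝ)| = (a.natAbs : ℝ) := by rw [Nat.cast_natAbs, Int.cast_abs]
    refine cusp_abc hC hM hs _ (fun f hf => hBC hf.1) a b f0.c ?_ n ?_ ?_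
    · intro f hf
      refine ⟨(hB f hf.1).1, (hB f hf.1).2, ?_⟩
      have e := hf.2.trans hf0.2.symm
      have e1 := (Prod.mk.inj e).1
      have e2 := (Prod.mk.inj hf.2).2
      have h8 : 0 < 8 * a.natAbs := by omega
      have hh' : 8 * a.natAbs * n ≤ (pz f).natAbs ∧ (pz f).natAbs < 8 * a.natAbs * (n + 1) := by
        rw [← e2]; exact ⟨Nat.mul_div_le _ _, Nat.lt_mul_div_succ _ h8⟩
      have e3 : |pz f - pz f0| < 8 * |a| := by
        rw [← hna]
        have e1' : (0 ≤ pz f) ↔ (0 ≤ pz f0) := by simpa using e1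
        zify at hh hh'
        rw [hna] at *
        rw [mul_add] at hh hh'
        rw [abs_lt]
        rcases le_or_gt 0 (pz f0) with h0 | h0
        · rw [abs_of_nonneg h0] at hh
          rw [abs_of_nonneg (e1'.mpr h0)] at hh'
          constructor <;> linarith
        · rw [abs_of_neg h0] at hh
          have hneg : pz f < 0 := by rw [← not_le, e1', not_le]; exact h0
          rw [abs_of_neg hneg] at hh'
          constructor <;> linarith
      have e4 : pz f - pz f0 = 8 * a * (f0.c - f.c) := by
        simp only [hpz]; rw [(hB f0 hf0.1).1, (hB f0 hf0.1).2, (hB f hf.1).1, (hB f hf.1).2]; ring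
      rw [e4, abs_mul, abs_mul, abs_of_pos (show (0:ℤ) < 8 by norm_num)] at e3
      have : |f0.c - f.c| < 1 := by
        by_contra h; push Not at h; nlinarith
      have := Int.abs_lt_one_iff.mp this
      omega
    · rw [hpf, haR]; exact_mod_cast hh.1
    · rw [hpf, haR]; exact_mod_cast hh.2.le)
  refine ⟨key.1, key.2.trans ?_⟩
  rw [Finset.sum_product]
  simp only [← Finset.mul_sum]
  rw [Finset.sum_const, nsmul_eq_mul]
  have := sum_min s hs N
  simp only [Finset.card_univ, Fintype.card_bool]
  rw [show ∀ q r : ℝ, q * (12 * r) = q * (((2:ℕ):ℝ) * (6 * r)) by intros; push_cast; ring]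
  gcongr

lemma cusp (C M : ℝ) (hC : 0 < C) (hM : 0 < M) : ∃ K : ℝ, 0 < K ∧ ∀ η s : ℝ, 0 < η → η ≤ 1 → 1 ≤ s →
    {f ∈ Cus C M s | |(f.a:ℝ)| ≤ η * s}.Finite ∧ ({f ∈ Cus C M s | |(f.a:ℝ)| ≤ η * s}.ncard : ℝ) ≤ K * √η * s ^ 4 := by
  set K0 := (2 * (M + 1) + (16 + 3 * C)) * ((M + 1) + (C + 1)) with hK0
  have hK0p : 0 < K0 := by positivity
  refine ⟨240 * K0, by positivity, fun η s hη hη1 hs => ?_⟩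
  have hs0 : 0 < s := by linarith
  set N := ⌊η * s⌋₊
  have key := fib {f ∈ Cus C M s | |(f.a:ℝ)| ≤ η * s} (fun f => (decide (0 ≤ f.a), f.a.natAbs - 1)) (Finset.univ ×ˢ Finset.range N)
    (fun x => 60 * K0 * s ^ 3 * √s * (1 / √((x.2:ℝ) + 1))) (by
    intro f hf
    simp only [Finset.mem_product, Finset.mem_univ, true_and, Finset.mem_range]
    have h1 : 1 ≤ f.a.natAbs := Int.natAbs_pos.mpr hf.1.1
    have : f.a.natAbs ≤ N := Nat.le_floor (by rw [Nat.cast_natAbs, Int.cast_abs]; exact hf.2)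
    omega) (by
    rintro ⟨σ, n⟩ _
    rcases Set.eq_empty_or_nonempty {f ∈ {f ∈ Cus C M s | |(f.a:ℝ)| ≤ η * s} | (decide (0 ≤ f.a), f.a.natAbs - 1) = (σ, n)} with h | ⟨f0, hf0⟩
    · rw [h]; simp; positivity
    set A := f0.a with hA
    have hAn : A.natAbs = n + 1 := by
      have h2 := (Prod.mk.inj hf0.2).2
      have h1 : 1 ≤ f0.a.natAbs := Int.natAbs_pos.mpr hf0.1.1.1
      omega
    have hall : ∀ f ∈ {f ∈ {f ∈ Cus C M s | |(f.a:ℝ)| ≤ η * s} | (decide (0 ≤ f.a), f.a.natAbs - 1) = (σ, n)}, f.a = A := by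
      intro f hf
      have e1 : (0 ≤ f.a) ↔ (0 ≤ f0.a) := by simpa using (Prod.mk.inj (hf.2.trans hf0.2.symm)).1
      have e2 := (Prod.mk.inj hf.2).2
      have h1 : 1 ≤ f.a.natAbs := Int.natAbs_pos.mpr hf.1.1.1
      omega
    have haR : |(A:ℝ)| = (n:ℝ) + 1 := by rw [← Int.cast_abs, ← Nat.cast_natAbs, hAn]; push_cast; rfl
    have k := fib _ BQF.b (Finset.Icc (-(2 * (A.natAbs:ℤ))) (2 * A.natAbs)) (fun _ => K0 * (s ^ 3 / √|(A:ℝ)| ^ 3) * (12 * √s)) (by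
      intro f hf
      rw [Finset.mem_Icc, ← abs_le, Int.natCast_natAbs, ← hall f hf]
      exact hf.1.1.2.2.1) (fun b _ => cusp_ab hC hM hs {f ∈ {f ∈ {f ∈ Cus C M s | |(f.a:ℝ)| ≤ η * s} | (decide (0 ≤ f.a), f.a.natAbs - 1) = (σ, n)} | f.b = b} (fun f hf => hf.1.1.1) A b fun f hf => ⟨hall f hf.1, hf.2⟩)
    refine ⟨k.1, k.2.trans ?_⟩
    rw [Finset.sum_const, nsmul_eq_mul, Int.card_Icc, hAn, haR]
    have e : (((2 * ((n + 1 : ℕ):ℤ) + 1 - -(2 * ((n + 1 : ℕ):ℤ))).toNat : ℕ) : ℝ) = 4 * ((n:ℝ) + 1) + 1 := by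
      rw [show (2 * ((n + 1 : ℕ):ℤ) + 1 - -(2 * ((n + 1 : ℕ):ℤ))).toNat = 4 * (n + 1) + 1 by omega]; push_cast; rfl
    rw [e]
    have hn0 : (0:ℝ) ≤ n := Nat.cast_nonneg n
    set z := √((n:ℝ) + 1)
    have hz : 0 < z := Real.sqrt_pos.mpr (by positivity)
    have hz2 : z ^ 2 = (n:ℝ) + 1 := Real.sq_sqrt (by positivity)
    calc _ ≤ (5 * z ^ 2) * (K0 * (s ^ 3 / z ^ 3) * (12 * √s)) := by gcongr; linarith
      _ = _ := by field_simp; ring)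
  refine ⟨key.1, key.2.trans ?_⟩
  rw [Finset.sum_product]
  simp only [← Finset.mul_sum]
  rw [Finset.sum_const, nsmul_eq_mul]
  simp only [Finset.card_univ, Fintype.card_bool]
  have h1 : ∑ n ∈ Finset.range N, 1 / √((n:ℝ) + 1) ≤ 2 * (√η * √s) := by
    refine (sum_inv_sqrt N).trans ?_
    rw [← Real.sqrt_mul hη.le]
    gcongr
    exact Nat.floor_le (by positivity)
  have hss : √s * √s = s := Real.mul_self_sqrt hs0.le
  calc _ ≤ 60 * K0 * s ^ 3 * √s * (((2:ℕ):ℝ) * (2 * (√η * √s))) := by gcongr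
    _ = 240 * K0 * √η * s ^ 3 * (√s * √s) := by push_cast; ring
    _ = _ := by rw [hss]; ring

end BQFC


namespace BQFC

lemma box3 (M s : ℝ) (hM : 1 ≤ M) (hs : 1 ≤ s) (B : Set BQF) (φ1 φ2 φ3 : BQF → ℤ) (N : ℝ) (hN0 : 0 ≤ N)
    (h1 : ∀ f ∈ B, |(φ1 f:ℝ)| ≤ M * s ∧ |(φ2 f:ℝ)| ≤ M * s ∧ |(φ3 f:ℝ)| ≤ M * s)
    (hN : ∀ x y z : ℤ, {f ∈ B | φ1 f = x ∧ φ2 f = y ∧ φ3 f = z}.Finite ∧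
      ({f ∈ B | φ1 f = x ∧ φ2 f = y ∧ φ3 f = z}.ncard : ℝ) ≤ N) :
    B.Finite ∧ (B.ncard : ℝ) ≤ 27 * M ^ 3 * s ^ 3 * N := by
  set L := ⌊M * s⌋₊
  have hL : (L:ℝ) ≤ M * s := Nat.floor_le (by positivity)
  have hI : ∀ z : ℤ, |(z:ℝ)| ≤ M * s → z ∈ Finset.Icc (-(L:ℤ)) L := by
    intro z hz
    rw [Finset.mem_Icc, ← abs_le, ← Int.natCast_natAbs, Nat.cast_le]
    exact Nat.le_floor (by rw [Nat.cast_natAbs, Int.cast_abs]; exact hz)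
  have key := fib B (fun f => (φ1 f, φ2 f, φ3 f)) (Finset.Icc (-(L:ℤ)) L ×ˢ Finset.Icc (-(L:ℤ)) L ×ˢ Finset.Icc (-(L:ℤ)) L) (fun _ => N)
    (fun f hf => by
      simp only [Finset.mem_product]
      exact ⟨hI _ (h1 f hf).1, hI _ (h1 f hf).2.1, hI _ (h1 f hf).2.2⟩)
    (by rintro ⟨x, y, z⟩ _; simpa using hN x y z)
  refine ⟨key.1, key.2.trans ?_⟩
  rw [Finset.sum_const, nsmul_eq_mul, Finset.card_product, Finset.card_product, Int.card_Icc]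
  have e : ((((L:ℤ) + 1 - -(L:ℤ)).toNat : ℕ) : ℝ) = 2 * L + 1 := by
    rw [show ((L:ℤ) + 1 - -(L:ℤ)).toNat = 2 * L + 1 by omega]; push_cast; rfl
  push_cast [e]
  have : 2 * (L:ℝ) + 1 ≤ 3 * (M * s) := by nlinarith
  calc _ ≤ (3 * (M * s)) * ((3 * (M * s)) * (3 * (M * s))) * N := by gcongr
    _ = _ := by ring

lemma thin (C M κ : ℝ) (hC : 0 < C) (hM : 1 ≤ M) (hκ : 0 < κ) : ∃ K : ℝ, 0 < K ∧ ∀ δ s I0 : ℝ, 0 < δ → δ ≤ 1 → 1 / δ ≤ s →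
    ∀ B : Set BQF, (∀ f ∈ B, |(f.a:ℝ)| ≤ M * s ∧ |(f.b:ℝ)| ≤ M * s ∧ |(f.c:ℝ)| ≤ M * s ∧ κ * s ≤ |(f.a:ℝ)| ∧
      κ * s ^ 2 ≤ |pR f| ∧ |JR f| ≤ C * s ^ 2 ∧ |IR f - I0| ≤ δ * s ^ 2) →
    B.Finite ∧ (B.ncard : ℝ) ≤ K * √δ * s ^ 4 := by
  set k := (48 * M ^ 2 * (11 * M ^ 2) + 64 * M ^ 3 * C) / 27 with hk
  have hk0 : 0 < k := by positivity
  set K0 := (2 + √k / (2 * κ ^ 2)) * (1 + 2 * C / (9 * κ)) with hK0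
  refine ⟨27 * M ^ 3 * K0, by positivity, fun δ s I0 hδ hδ1 hs B hB => ?_⟩
  have hs1 : 1 ≤ s := le_trans (by rw [le_div_iff₀ hδ]; linarith) hs
  have hs0 : 0 < s := by linarith
  have hδs : 1 ≤ δ * s := by rwa [div_le_iff₀' hδ] at hs
  have hds : 0 < √δ := Real.sqrt_pos.mpr hδ
  have hd2 : √δ ^ 2 = δ := Real.sq_sqrt hδ.le
  have hd1 : √δ ≤ 1 := Real.sqrt_le_one.mpr hδ1
  have := box3 M s hM hs1 B BQF.a BQF.b BQF.c (K0 * √δ * s) (by positivity)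
    (fun f hf => ⟨(hB f hf).1, (hB f hf).2.1, (hB f hf).2.2.1⟩) (by
    intro a b c
    rcases Set.eq_empty_or_nonempty {f ∈ B | f.a = a ∧ f.b = b ∧ f.c = c} with h | ⟨f0, hf0, h1, h2, h3⟩
    · rw [h]; simp; positivity
    obtain ⟨k1, k2, k3, k4, k5, k6, k7⟩ := hB f0 hf0
    have hp0 : pR f0 = pf a b c := by unfold pR; rw [h1, h2, h3]
    rw [hp0] at k5
    rw [h1] at k1 k4; rw [h2] at k2; rw [h3] at k3
    have ha0 : (0:ℝ) < |(a:ℝ)| := lt_of_lt_of_le (by positivity) k4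
    have hpp : 0 < |pf a b c| := lt_of_lt_of_le (by positivity) k5
    have hpu : |pf a b c| ≤ 11 * M ^ 2 * s ^ 2 := by
      unfold pf
      refine (abs_sub _ _).trans ?_
      simp only [abs_mul, abs_pow, abs_of_pos (show (0:ℝ) < 3 by norm_num), abs_of_pos (show (0:ℝ) < 8 by norm_num)]
      calc _ ≤ 3 * (M * s) ^ 2 + 8 * (M * s) * (M * s) := by gcongr
        _ = _ := by ring
    have main := fibd {f ∈ B | f.a = a ∧ f.b = b ∧ f.c = c} a b c (by rintro rfl; simp at ha0) (fun f hf => hf.2)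
      (√((pf a b c ^ 3 - 48 * a ^ 2 * pf a b c * I0) / 27)) (√k * √δ * s ^ 3) I0 (δ * s ^ 2) (C * s ^ 2) (2 * C / (9 * κ))
      (by positivity) (by positivity) (by
        intro f hf
        obtain ⟨l1, l2, l3, l4, l5, l6, l7⟩ := hB f hf.1
        have := syz_close f l7 l6
        have hp : pR f = pf a b c := by unfold pR; rw [hf.2.1, hf.2.2.1, hf.2.2.2]
        rw [hp, hf.2.1] at this
        refine (sq_close1 this).trans ?_
        rw [Real.sqrt_le_left (by positivity), mul_pow, mul_pow, Real.sq_sqrt hk0.le, hd2]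
        calc _ ≤ (48 * (M * s) ^ 2 * (11 * M ^ 2 * s ^ 2) * (δ * s ^ 2) + 64 * (M * s) ^ 3 * (C * s ^ 2) * (δ * s)) / 27 := by
              have t1 : 48 * |(a:ℝ)| ^ 2 * |pf a b c| * (δ * s ^ 2) ≤ 48 * (M * s) ^ 2 * (11 * M ^ 2 * s ^ 2) * (δ * s ^ 2) := by
                gcongr
              have t2 : 64 * |(a:ℝ)| ^ 3 * (C * s ^ 2) ≤ 64 * (M * s) ^ 3 * (C * s ^ 2) := by gcongr
              have t3 := t2.trans (le_mul_of_one_le_right (by positivity) hδs)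
              exact div_le_div_of_nonneg_right (add_le_add t1 t3) (by norm_num)
          _ = _ := by rw [hk]; ring) (fun f hf => (hB f hf.1).2.2.2.2.2.2) (fun f hf => (hB f hf.1).2.2.2.2.2.1) (by
        left
        refine ⟨abs_pos.mp hpp, ?_⟩
        calc 2 * (C * s ^ 2) = 9 * (κ * s ^ 2) * (2 * C / (9 * κ)) := by field_simp
          _ ≤ _ := by gcongr)
    refine ⟨main.1, main.2.trans ?_⟩
    rw [hK0]
    have e1 : √k * √δ * s ^ 3 / (2 * (a:ℝ) ^ 2) ≤ √k / (2 * κ ^ 2) * (√δ * s) := by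
      rw [← sq_abs (a:ℝ)]
      calc _ ≤ √k * √δ * s ^ 3 / (2 * (κ * s) ^ 2) := by gcongr
        _ = _ := by field_simp
    have e2 : 1 ≤ √δ * s := by
      have := mul_le_mul_of_nonneg_right hd1 (mul_pos hds hs0).le
      rw [← mul_assoc, ← sq, hd2] at this
      linarith
    calc _ ≤ ((2 + √k / (2 * κ ^ 2)) * (√δ * s)) * (1 + 2 * C / (9 * κ)) := by
          gcongr
          rw [add_mul]; linarith
      _ = _ := by ring)
  refine ⟨this.1, this.2.trans (le_of_eq ?_)⟩
  ring

/-- the substitution action on coefficient vectors -/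
def act5 {R : Type*} [CommRing R] (p q r t : R) (v : R × R × R × R × R) : R × R × R × R × R :=
  let ⟨a, b, c, d, e⟩ := v
  (a * p ^ 4 + b * p ^ 3 * q + c * p ^ 2 * q ^ 2 + d * p * q ^ 3 + e * q ^ 4,
   4 * a * p ^ 3 * r + b * (p ^ 3 * t + 3 * p ^ 2 * r * q) + c * (2 * p ^ 2 * q * t + 2 * p * r * q ^ 2) +
     d * (3 * p * q ^ 2 * t + r * q ^ 3) + 4 * e * q ^ 3 * t,
   6 * a * p ^ 2 * r ^ 2 + b * (3 * p ^ 2 * r * t + 3 * p * r ^ 2 * q) + c * (p ^ 2 * t ^ 2 + 4 * p * r * q * t + r ^ 2 * q ^ 2) +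
     d * (3 * p * q * t ^ 2 + 3 * r * q ^ 2 * t) + 6 * e * q ^ 2 * t ^ 2,
   4 * a * p * r ^ 3 + b * (3 * p * r ^ 2 * t + r ^ 3 * q) + c * (2 * p * r * t ^ 2 + 2 * r ^ 2 * q * t) +
     d * (p * t ^ 3 + 3 * r * q * t ^ 2) + 4 * e * q * t ^ 3,
   a * r ^ 4 + b * r ^ 3 * t + c * r ^ 2 * t ^ 2 + d * r * t ^ 3 + e * t ^ 4)

lemma act5_act5 {R : Type*} [CommRing R] (p q r t p' q' r' t' : R) (v : R × R × R × R × R) :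
    act5 p' q' r' t' (act5 p q r t v) = act5 (p' * p + q' * r) (p' * q + q' * t) (r' * p + t' * r) (r' * q + t' * t) v := by
  obtain ⟨a, b, c, d, e⟩ := v
  simp only [act5, Prod.mk.injEq]
  refine ⟨?_, ?_, ?_, ?_, ?_⟩ <;> ring

abbrev G := Matrix.GeneralLinearGroup (Fin 2) ℤ

instance : MulAction G BQF where
  smul γ f := mk5 (act5 (γ 0 0) (γ 0 1) (γ 1 0) (γ 1 1) (mk5.symm f))
  one_smul f := by
    change mk5 (act5 _ _ _ _ (mk5.symm f)) = f
    rw [← Equiv.eq_symm_apply]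
    obtain ⟨a, b, c, d, e⟩ := f
    simp [act5, mk5]
  mul_smul γ δ f := by
    change mk5 (act5 _ _ _ _ (mk5.symm f)) = mk5 (act5 _ _ _ _ (mk5.symm (mk5 (act5 _ _ _ _ (mk5.symm f)))))
    rw [Equiv.symm_apply_apply, act5_act5]
    simp [Matrix.mul_apply, Fin.sum_univ_two]

lemma smul_def' (γ : G) (f : BQF) : γ • f = mk5 (act5 (γ 0 0) (γ 0 1) (γ 1 0) (γ 1 1) (mk5.symm f)) := rfl

lemma eval_smul (γ : G) (f : BQF) (x y : ℤ) :
    (γ • f).evalZ x y = f.evalZ (x * γ 0 0 + y * γ 1 0) (x * γ 0 1 + y * γ 1 1) := by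
  obtain ⟨a, b, c, d, e⟩ := f
  simp only [smul_def', mk5, act5, BQF.evalZ, Equiv.coe_fn_mk, Equiv.coe_fn_symm_mk]
  ring

lemma ext_eval {f g : BQF} (h : ∀ x y, f.evalZ x y = g.evalZ x y) : f = g := by
  obtain ⟨a, b, c, d, e⟩ := f
  obtain ⟨a', b', c', d', e'⟩ := g
  have h1 := h 1 0
  have h2 := h 0 1
  have h3 := h 1 1
  have h4 := h 1 (-1)
  have h5 := h 2 1
  simp only [BQF.evalZ] at *
  rw [BQF.mk.injEq]
  refine ⟨?_, ?_, ?_, ?_, ?_⟩ <;> linarith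

lemma equiv_iff {f g : BQF} : f.Equivalent g ↔ ∃ γ : G, γ • f = g := by
  constructor
  · rintro ⟨γ, h, h2⟩
    refine ⟨Matrix.GeneralLinearGroup.mk'' γ h, ext_eval fun x y => ?_⟩
    rw [eval_smul, h2]; rfl
  · rintro ⟨γ, rfl⟩
    exact ⟨γ.1, (Matrix.isUnit_iff_isUnit_det _).mp γ.isUnit, fun x y => eval_smul γ f x y⟩

lemma det_pm (γ : G) : γ 0 0 * γ 1 1 - γ 0 1 * γ 1 0 = 1 ∨ γ 0 0 * γ 1 1 - γ 0 1 * γ 1 0 = -1 := by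
  have := (Matrix.isUnit_iff_isUnit_det _).mp γ.isUnit
  rw [Matrix.det_fin_two] at this
  exact Int.isUnit_iff.mp this

lemma neg_smul' (γ : G) (f : BQF) : (-γ) • f = γ • f := by
  obtain ⟨a, b, c, d, e⟩ := f
  have h : ∀ i j, (-γ : G) i j = -(γ i j) := fun i j => rfl
  simp only [smul_def', mk5, act5, Equiv.coe_fn_mk, Equiv.coe_fn_symm_mk, h, BQF.mk.injEq]
  refine ⟨?_, ?_, ?_, ?_, ?_⟩ <;> ring

lemma G_ext {γ δ : G} (h1 : γ 0 0 = δ 0 0) (h2 : γ 0 1 = δ 0 1) (h3 : γ 1 0 = δ 1 0) (h4 : γ 1 1 = δ 1 1) : γ = δ := by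
  ext i j; fin_cases i <;> fin_cases j <;> assumption

lemma stab (M : ℝ) (hM : 1 ≤ M) (s : ℝ) (hs : 1 ≤ s) (γ : G) (h1 : γ ≠ 1) (h2 : γ ≠ -1) (B : Set BQF)
    (hB : ∀ f ∈ B, γ • f = f ∧ |(f.a:ℝ)| ≤ M * s ∧ |(f.b:ℝ)| ≤ M * s ∧ |(f.c:ℝ)| ≤ M * s ∧ |(f.d:ℝ)| ≤ M * s ∧ |(f.e:ℝ)| ≤ M * s) :
    B.Finite ∧ (B.ncard : ℝ) ≤ 27 * M ^ 3 * s ^ 3 := by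
  have sub : ∀ S : Set BQF, S.Subsingleton → S.Finite ∧ (S.ncard : ℝ) ≤ 1 := fun S hS =>
    ⟨hS.finite, by exact_mod_cast (Set.ncard_le_one hS.finite).mpr fun a ha b hb => hS ha hb⟩
  have hdet := det_pm γ
  have hfix : ∀ f ∈ B, act5 (γ 0 0) (γ 0 1) (γ 1 0) (γ 1 1) (f.a, f.b, f.c, f.d, f.e) = (f.a, f.b, f.c, f.d, f.e) := by
    intro f hf
    have := (hB f hf).1
    rw [smul_def', ← Equiv.eq_symm_apply] at this
    exact this
  simp only [act5, Prod.mk.injEq] at hfix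
  rw [← mul_one (27 * M ^ 3 * s ^ 3)]
  have hne1 : ¬ (γ 0 0 = 1 ∧ γ 0 1 = 0 ∧ γ 1 0 = 0 ∧ γ 1 1 = 1) := fun h => h1 (G_ext h.1 h.2.1 h.2.2.1 h.2.2.2)
  have hne2 : ¬ (γ 0 0 = -1 ∧ γ 0 1 = 0 ∧ γ 1 0 = 0 ∧ γ 1 1 = -1) := fun h => h2 (G_ext h.1 h.2.1 h.2.2.1 h.2.2.2)
  generalize γ 0 0 = p at *
  generalize γ 0 1 = q at *
  generalize γ 1 0 = r at *
  generalize γ 1 1 = t at *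
  by_cases hq : q = 0
  · by_cases hr : r = 0
    · subst hq hr
      have hpt : p = 1 ∧ t = -1 ∨ p = -1 ∧ t = 1 := by
        have : IsUnit (p * t) := by rw [Int.isUnit_iff]; simpa using hdet
        rw [IsUnit.mul_iff, Int.isUnit_iff, Int.isUnit_iff] at this
        omega
      have hbd : ∀ f ∈ B, f.b = 0 ∧ f.d = 0 := by
        intro f hf
        obtain ⟨-, k2, -, k4, -⟩ := hfix f hf
        rcases hpt with ⟨rfl, rfl⟩ | ⟨rfl, rfl⟩ <;> simp at k2 k4 <;> omega
      refine box3 M s hM hs B BQF.a BQF.c BQF.e 1 (by norm_num)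
        (fun f hf => ⟨(hB f hf).2.1, (hB f hf).2.2.2.1, (hB f hf).2.2.2.2.2⟩) fun x y z => sub _ ?_
      rintro ⟨a, b, c, d, e⟩ ⟨hf, k1, k2, k3⟩ ⟨a', b', c', d', e'⟩ ⟨hf', k1', k2', k3'⟩
      have := hbd _ hf
      have := hbd _ hf'
      simp only [BQF.mk.injEq] at *
      omega
    · refine box3 M s hM hs B BQF.e BQF.d BQF.c 1 (by norm_num)
        (fun f hf => ⟨(hB f hf).2.2.2.2.2, (hB f hf).2.2.2.2.1, (hB f hf).2.2.2.1⟩) fun x y z => sub _ ?_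
      rintro ⟨a, b, c, d, e⟩ ⟨hf, k1, k2, k3⟩ ⟨a', b', c', d', e'⟩ ⟨hf', k1', k2', k3'⟩
      obtain ⟨-, -, -, l4, l5⟩ := hfix _ hf
      obtain ⟨-, -, -, l4', l5'⟩ := hfix _ hf'
      subst k1 k2 k3
      simp only at *
      subst k1' k2' k3'
      have m1 : r * (a - a') + t * (b - b') = 0 := by
        apply mul_left_cancel₀ (pow_ne_zero 3 hr); linear_combination l5 - l5'
      have m2 : (b - b') * (3 * p * t + r * q) + 4 * (a - a') * p * r = 0 := by
        apply mul_left_cancel₀ (pow_ne_zero 2 hr); linear_combination l4 - l4'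
      have m3 : (b - b') * (r * q - p * t) = 0 := by linear_combination m2 - 4 * p * m1
      have m4 : b - b' = 0 := by
        rcases mul_eq_zero.mp m3 with h | h
        · exact h
        · exfalso; rcases hdet with h' | h' <;> linarith
      have m5 : a - a' = 0 := by
        rw [m4, mul_zero, add_zero] at m1
        exact (mul_eq_zero.mp m1).resolve_left hr
      rw [BQF.mk.injEq]; omega
  · refine box3 M s hM hs B BQF.a BQF.b BQF.c 1 (by norm_num)
      (fun f hf => ⟨(hB f hf).2.1, (hB f hf).2.2.1, (hB f hf).2.2.2.1⟩) fun x y z => sub _ ?_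
    rintro ⟨a, b, c, d, e⟩ ⟨hf, k1, k2, k3⟩ ⟨a', b', c', d', e'⟩ ⟨hf', k1', k2', k3'⟩
    obtain ⟨l5, l4, -⟩ := hfix _ hf
    obtain ⟨l5', l4', -⟩ := hfix _ hf'
    subst k1 k2 k3
    simp only at *
    subst k1' k2' k3'
    have m1 : p * (d - d') + q * (e - e') = 0 := by
      apply mul_left_cancel₀ (pow_ne_zero 3 hq); linear_combination l5 - l5'
    have m2 : (d - d') * (3 * p * t + r * q) + 4 * (e - e') * q * t = 0 := by
      apply mul_left_cancel₀ (pow_ne_zero 2 hq); linear_combination l4 - l4'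
    have m3 : (d - d') * (r * q - p * t) = 0 := by linear_combination m2 - 4 * t * m1
    have m4 : d - d' = 0 := by
      rcases mul_eq_zero.mp m3 with h | h
      · exact h
      · exfalso; rcases hdet with h' | h' <;> linarith
    have m5 : e - e' = 0 := by
      rw [m4, mul_zero, zero_add] at m1
      exact (mul_eq_zero.mp m1).resolve_left hq
    rw [BQF.mk.injEq]; omega

end BQFC


namespace BQFC

def toV (f : BQF) : V := (f.a, f.b, f.c, f.d, f.e)

lemma toV_smul (γ : G) (f : BQF) : toV (γ • f) = act5 ((γ 0 0 : ℤ):ℝ) ((γ 0 1 : ℤ):ℝ) ((γ 1 0 : ℤ):ℝ) ((γ 1 1 : ℤ):ℝ) (toV f) := by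
  obtain ⟨a, b, c, d, e⟩ := f
  simp only [smul_def', mk5, act5, toV, Equiv.coe_fn_mk, Equiv.coe_fn_symm_mk]
  push_cast
  rfl

def IV (v : V) : ℝ := Ir v.1 v.2.1 v.2.2.1 v.2.2.2.1 v.2.2.2.2
def JV (v : V) : ℝ := Jr v.1 v.2.1 v.2.2.1 v.2.2.2.1 v.2.2.2.2

lemma IV_act (p q r t : ℝ) (v : V) : IV (act5 p q r t v) = (p * t - q * r) ^ 4 * IV v := by
  obtain ⟨a, b, c, d, e⟩ := v
  simp only [act5, IV, Ir]; ring

lemma JV_act (p q r t : ℝ) (v : V) : JV (act5 p q r t v) = (p * t - q * r) ^ 6 * JV v := by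
  obtain ⟨a, b, c, d, e⟩ := v
  simp only [act5, JV, Jr]; ring

lemma act5_smul (p q r t k : ℝ) (v : V) : act5 p q r t (k • v) = k • act5 p q r t v := by
  obtain ⟨a, b, c, d, e⟩ := v
  simp only [act5, Prod.smul_mk, smul_eq_mul, Prod.mk.injEq]
  refine ⟨?_, ?_, ?_, ?_, ?_⟩ <;> ring

lemma act5_cont (p q r t : ℝ) : Continuous (act5 p q r t : V → V) := by
  unfold act5; fun_prop

lemma IV_cont : Continuous IV := by unfold IV Ir; fun_prop
lemma JV_cont : Continuous JV := by unfold JV Jr; fun_prop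

lemma IV_smul (k : ℝ) (v : V) : IV (k • v) = k ^ 2 * IV v := by
  obtain ⟨a, b, c, d, e⟩ := v
  simp only [IV, Ir, Prod.smul_mk, smul_eq_mul]; ring

lemma JV_smul (k : ℝ) (v : V) : JV (k • v) = k ^ 3 * JV v := by
  obtain ⟨a, b, c, d, e⟩ := v
  simp only [JV, Jr, Prod.smul_mk, smul_eq_mul]; ring

lemma norm_le_iff {v : V} {M : ℝ} : ‖v‖ ≤ M ↔ |v.1| ≤ M ∧ |v.2.1| ≤ M ∧ |v.2.2.1| ≤ M ∧ |v.2.2.2.1| ≤ M ∧ |v.2.2.2.2| ≤ M := by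
  simp only [Prod.norm_def, max_le_iff, Real.norm_eq_abs]

/-- arbitrarily small representatives -/
def Nul (v : V) : Prop := ∀ ε > 0, ∃ p q r t : ℝ, p * t - q * r = 1 ∧ ‖act5 p q r t v‖ ≤ ε

lemma Nul_of {p q r t : ℝ} (h : p * t - q * r = 1) {v : V} (hn : Nul (act5 p q r t v)) : Nul v := by
  intro ε hε
  obtain ⟨p', q', r', t', h1, h2⟩ := hn ε hε
  rw [act5_act5] at h2
  exact ⟨_, _, _, _, by linear_combination (p' * t' - q' * r') * h + h1, h2⟩

lemma Nul_de (d e : ℝ) : Nul (0, 0, 0, d, e) := by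
  intro ε hε
  set k := max 1 ((|d| + |e|) / ε)
  have hk : 1 ≤ k := le_max_left _ _
  have hk2 : |d| + |e| ≤ k * ε := by rw [← div_le_iff₀ hε]; exact le_max_right _ _
  refine ⟨k, 0, 0, 1 / k, by field_simp; ring, ?_⟩
  have hd : |d * k * (1 / k) ^ 3| ≤ ε := by
    have : d * k * (1 / k) ^ 3 = d / k ^ 2 := by field_simp
    rw [this, abs_div, abs_of_pos (by positivity : (0:ℝ) < k ^ 2), div_le_iff₀ (by positivity)]
    nlinarith [abs_nonneg d, abs_nonneg e, mul_nonneg hε.le (by nlinarith : 0 ≤ k ^ 2 - k)]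
  have he : |e * (1 / k) ^ 4| ≤ ε := by
    have : e * (1 / k) ^ 4 = e / k ^ 4 := by field_simp
    rw [this, abs_div, abs_of_pos (by positivity : (0:ℝ) < k ^ 4), div_le_iff₀ (by positivity)]
    have : k ≤ k ^ 4 := le_self_pow₀ hk (by norm_num)
    nlinarith [abs_nonneg d, abs_nonneg e, mul_nonneg hε.le (sub_nonneg.mpr this)]
  rw [norm_le_iff]
  refine ⟨?_, ?_, ?_, ?_, ?_⟩
  · simpa [act5] using hε.le
  · simpa [act5] using hε.le
  · simpa [act5] using hε.le
  · convert hd using 2; simp only [act5]; ring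
  · convert he using 2; simp only [act5]; ring

lemma Nul_ab (a b : ℝ) : Nul (a, b, 0, 0, 0) := by
  refine Nul_of (p := 0) (q := 1) (r := -1) (t := 0) (by norm_num) ?_
  have : act5 0 1 (-1) 0 ((a, b, 0, 0, 0) : V) = (0, 0, 0, -b, a) := by
    simp only [act5, Prod.mk.injEq]; refine ⟨?_, ?_, ?_, ?_, ?_⟩ <;> ring
  rw [this]; exact Nul_de _ _

lemma null (v : V) (hI : IV v = 0) (hJ : JV v = 0) : Nul v := by
  obtain ⟨a, b, c, d, e⟩ := v
  by_cases ha : a = 0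
  · subst ha
    by_cases hb : b = 0
    · subst hb
      have : c = 0 := by simpa [IV, Ir] using hI
      subst this; exact Nul_de _ _
    · refine Nul_of (p := 1) (q := 0) (r := -c / (3 * b)) (t := 1) (by norm_num) ?_
      simp only [IV, Ir, JV, Jr] at hI hJ
      have hd : d = c ^ 2 / (3 * b) := by field_simp; linarith
      subst hd
      have he : e = c ^ 3 / (27 * b ^ 2) := by
        have h0 : 9 * b * c * (c ^ 2 / (3 * b)) = 3 * c ^ 3 := by field_simp; ring
        rw [h0] at hJ
        rw [eq_div_iff (by positivity)]; linarith
      subst he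
      convert Nul_ab 0 b using 1
      simp only [act5, Prod.mk.injEq]
      refine ⟨?_, ?_, ?_, ?_, ?_⟩ <;> field_simp <;> ring
  · refine Nul_of (p := 1) (q := 0) (r := -b / (4 * a)) (t := 1) (by norm_num) ?_
    set v' := act5 1 0 (-b / (4 * a)) 1 ((a, b, c, d, e) : V) with hv'
    have hI' : IV v' = 0 := by rw [hv', IV_act, hI, mul_zero]
    have hJ' : JV v' = 0 := by rw [hv', JV_act, hJ, mul_zero]
    have h1 : v'.1 = a := by simp [hv', act5]
    have h2 : v'.2.1 = 0 := by simp [hv', act5]; field_simp; ring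
    obtain ⟨a', b', c', d', e'⟩ := v'
    simp only at h1 h2
    subst h1 h2
    simp only [IV, Ir, JV, Jr] at hI' hJ'
    have he : e' = - c' ^ 2 / (12 * a') := by field_simp; linarith
    subst he
    have hJ2 : 8 * c' ^ 3 = - 27 * a' * d' ^ 2 := by
      have h0 : 72 * a' * c' * (-c' ^ 2 / (12 * a')) = - 6 * c' ^ 3 := by field_simp; ring
      rw [h0] at hJ'; linarith
    by_cases hc : c' = 0
    · subst hc
      have : d' = 0 := by simpa [ha] using hJ2
      subst this
      convert Nul_ab a' 0 using 1
      simp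
    · refine Nul_of (p := 1) (q := 0) (r := -3 * d' / (4 * c')) (t := 1) (by norm_num) ?_
      convert Nul_ab a' (-3 * a' * d' / c') using 1
      simp only [act5, Prod.mk.injEq]
      refine ⟨?_, ?_, ?_, ?_, ?_⟩
      · ring
      · field_simp; ring
      · field_simp; linear_combination 24 * a' * hJ2
      · field_simp
        linear_combination (- 48 * a' * d') * hJ2
      · field_simp
        linear_combination (36 * a' * d' ^ 2  - 32 * c' ^ 3) * hJ2

end BQFC


namespace BQFC

lemma real_red : ∃ M : ℝ, 1 ≤ M ∧ ∀ (v : V) (s : ℝ), 0 < s → |IV v| ≤ s ^ 2 → |JV v| ≤ s ^ 3 →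
    ∃ p q r t : ℝ, p * t - q * r = 1 ∧ ‖act5 p q r t v‖ ≤ M * s := by
  set K : Set V := {v | ‖v‖ = 1 ∧ ∀ p q r t : ℝ, p * t - q * r = 1 → 1 / 2 ≤ ‖act5 p q r t v‖} with hK
  have hKc : IsCompact K := by
    refine (isCompact_sphere (0:V) 1).of_isClosed_subset ?_ (fun v hv => by simpa using hv.1)
    rw [hK, Set.ofPred_and]
    refine (isClosed_eq continuous_norm continuous_const).inter ?_
    simp only [Set.ofPred_forall]
    exact isClosed_iInter fun p => isClosed_iInter fun q => isClosed_iInter fun r => isClosed_iInter fun t =>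
      isClosed_iInter fun _ => isClosed_le continuous_const (act5_cont p q r t).norm
  have hpos : ∀ v ∈ K, 0 < max |IV v| |JV v| := by
    intro v hv
    by_contra hh
    push Not at hh
    have hI : IV v = 0 := abs_eq_zero.mp (le_antisymm ((le_max_left _ _).trans hh) (abs_nonneg _))
    have hJ : JV v = 0 := abs_eq_zero.mp (le_antisymm ((le_max_right _ _).trans hh) (abs_nonneg _))
    obtain ⟨p, q, r, t, h1, h2⟩ := null v hI hJ (1/4) (by norm_num)
    have := hv.2 p q r t h1
    linarith
  obtain ⟨ε, hε, hε2⟩ : ∃ ε : ℝ, 0 < ε ∧ ∀ v ∈ K, ε ≤ max |IV v| |JV v| := by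
    rcases K.eq_empty_or_nonempty with h | h
    · exact ⟨1, one_pos, by simp [h]⟩
    · obtain ⟨v0, hv0, hm⟩ := hKc.exists_isMinOn h (f := fun v => max |IV v| |JV v|)
        (IV_cont.abs.max JV_cont.abs).continuousOn
      exact ⟨_, hpos v0 hv0, fun v hv => hm hv⟩
  refine ⟨max 1 (1 / ε), le_max_left _ _, fun v s hs hI hJ => ?_⟩
  set M := max 1 (1 / ε)
  have hM1 : 1 ≤ M := le_max_left _ _
  have hM2 : 1 ≤ M * ε := by rw [← div_le_iff₀ hε]; exact le_max_right _ _
  set A : Set ℝ := {x | ∃ p q r t : ℝ, p * t - q * r = 1 ∧ ‖act5 p q r t v‖ = x} with hA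
  have hAne : A.Nonempty := ⟨_, 1, 0, 0, 1, by norm_num, rfl⟩
  have hAb : BddBelow A := ⟨0, by rintro _ ⟨p, q, r, t, -, rfl⟩; positivity⟩
  by_cases hμ : sInf A < M * s
  · obtain ⟨x, ⟨p, q, r, t, h1, h2⟩, h3⟩ := (csInf_lt_iff hAb hAne).mp hμ
    exact ⟨p, q, r, t, h1, by rw [h2]; exact h3.le⟩
  push Not at hμ
  have hμ0 : 0 < sInf A := lt_of_lt_of_le (by positivity) hμ
  obtain ⟨x, ⟨p, q, r, t, h1, h2⟩, h3⟩ := (csInf_lt_iff hAb hAne).mp (show sInf A < 2 * sInf A by linarith)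
  refine ⟨p, q, r, t, h1, ?_⟩
  have hx : 0 < x := lt_of_lt_of_le hμ0 (csInf_le hAb ⟨p, q, r, t, h1, h2⟩)
  rw [h2]
  have hmem : x⁻¹ • act5 p q r t v ∈ K := by
    refine ⟨by rw [norm_smul, h2, norm_inv, Real.norm_of_nonneg hx.le, inv_mul_cancel₀ hx.ne'], ?_⟩
    intro p' q' r' t' h'
    rw [act5_smul, norm_smul, norm_inv, Real.norm_of_nonneg hx.le, inv_mul_eq_div, le_div_iff₀ hx, act5_act5]
    have : sInf A ≤ ‖act5 (p' * p + q' * r) (p' * q + q' * t) (r' * p + t' * r) (r' * q + t' * t) v‖ :=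
      csInf_le hAb ⟨_, _, _, _, by linear_combination (p' * t' - q' * r') * h1 + h', rfl⟩
    linarith
  have := hε2 _ hmem
  rw [IV_smul, JV_smul, IV_act, JV_act, h1, le_max_iff] at this
  simp only [one_pow, one_mul, abs_mul, abs_pow, abs_inv, abs_of_pos hx, inv_pow] at this
  by_contra hcon
  push Not at hcon
  rcases this with h | h
  · have : ε * x ^ 2 ≤ s ^ 2 := by
      rw [inv_mul_eq_div, le_div_iff₀ (by positivity)] at h; linarith
    have h5 : (M * s) ^ 2 < x ^ 2 := by gcongr
    have h6 : s ^ 2 ≤ ε * (M * s) ^ 2 := by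
      calc s ^ 2 ≤ (M * ε) * M * s ^ 2 := le_mul_of_one_le_left (by positivity) (by nlinarith)
        _ = _ := by ring
    nlinarith
  · have : ε * x ^ 3 ≤ s ^ 3 := by
      rw [inv_mul_eq_div, le_div_iff₀ (by positivity)] at h; linarith
    have h5 : (M * s) ^ 3 < x ^ 3 := by gcongr
    have h6 : s ^ 3 ≤ ε * (M * s) ^ 3 := by
      calc s ^ 3 ≤ (M * ε) * M ^ 2 * s ^ 3 := le_mul_of_one_le_left (by positivity) (by nlinarith)
        _ = _ := by ring
    nlinarith

lemma lat_alg (P Q R T' : ℝ) (hd : P * T' - Q * R = 1) (z : ℂ) (hz : z = (⟨P, -Q⟩ : ℂ) / ⟨R, -T'⟩) (h34 : 3 ≤ 4 * z.im ^ 2)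
    (hre : |z.re| ≤ 1 / 2) : (P ^ 2 + Q ^ 2) * (R ^ 2 + T' ^ 2) ≤ 4 / 3 ∧ R ^ 2 + T' ^ 2 ≤ 2 ∧ 0 < R ^ 2 + T' ^ 2 := by
  have hN : 0 < R ^ 2 + T' ^ 2 := by
    by_contra h0
    have h1 : R = 0 := by nlinarith [sq_nonneg R, sq_nonneg T']
    have h2 : T' = 0 := by nlinarith [sq_nonneg R, sq_nonneg T']
    rw [h1, h2] at hd; norm_num at hd
  have hzim : z.im = 1 / (R ^ 2 + T' ^ 2) := by
    rw [hz, Complex.div_im, Complex.normSq_mk, ← sub_div]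
    simp only
    rw [show -Q * R - P * -T' = 1 by linarith]; congr 1; ring
  have hzre : z.re = (P * R + Q * T') / (R ^ 2 + T' ^ 2) := by
    rw [hz, Complex.div_re, Complex.normSq_mk, ← add_div]
    simp only
    congr 1 <;> ring
  have hid : (P ^ 2 + Q ^ 2) * (R ^ 2 + T' ^ 2) = (P * R + Q * T') ^ 2 + 1 := by
    linear_combination (P * T' - Q * R + 1) * hd
  rw [hzim, div_pow, one_pow] at h34
  rw [hzre, abs_div, abs_of_pos hN, div_le_iff₀ hN] at hre
  have h3 : 3 * (R ^ 2 + T' ^ 2) ^ 2 ≤ 4 := by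
    rw [mul_one_div, le_div_iff₀ (by positivity)] at h34; exact h34
  have hre2 : (P * R + Q * T') ^ 2 ≤ (1 / 2 * (R ^ 2 + T' ^ 2)) ^ 2 := sq_le_sq' (by linarith [neg_abs_le (P * R + Q * T')]) (by linarith [le_abs_self (P * R + Q * T')])
  refine ⟨by rw [hid]; linarith, by nlinarith, hN⟩

lemma lat_red (p q r t : ℝ) (h : p * t - q * r = 1) : ∃ i j k l : ℤ, i * l - j * k = 1 ∧
    ((i * p + j * r) ^ 2 + (i * q + j * t) ^ 2) * ((k * p + l * r) ^ 2 + (k * q + l * t) ^ 2) ≤ 4 / 3 ∧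
    (k * p + l * r) ^ 2 + (k * q + l * t) ^ 2 ≤ 2 ∧ 0 < (k * p + l * r) ^ 2 + (k * q + l * t) ^ 2 := by
  have hw20 : (⟨r, -t⟩ : ℂ) ≠ 0 := by
    intro h0
    have h1 : r = 0 := congrArg Complex.re h0
    have h2 : -t = 0 := congrArg Complex.im h0
    have h2 : t = 0 := by linarith
    subst h1 h2; simp at h
  have him : 0 < ((⟨p, -q⟩ : ℂ) / ⟨r, -t⟩).im := by
    rw [Complex.div_im, ← sub_div]
    refine div_pos ?_ (Complex.normSq_pos.mpr hw20)
    simp only; linarith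
  obtain ⟨g, hg⟩ := ModularGroup.exists_smul_mem_fd ⟨(⟨p, -q⟩ : ℂ) / ⟨r, -t⟩, him⟩
  have hz := UpperHalfPlane.coe_specialLinearGroup_apply g ⟨(⟨p, -q⟩ : ℂ) / ⟨r, -t⟩, him⟩
  have h34 := ModularGroup.three_le_four_mul_im_sq_of_mem_fd hg
  have hre := hg.2
  have hdet : g 0 0 * g 1 1 - g 0 1 * g 1 0 = 1 := by
    have := g.det_coe; rwa [Matrix.det_fin_two] at this
  rw [← UpperHalfPlane.coe_im] at h34
  rw [← UpperHalfPlane.coe_re] at hre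
  generalize ((g • (⟨(⟨p, -q⟩ : ℂ) / ⟨r, -t⟩, him⟩ : UpperHalfPlane) : UpperHalfPlane) : ℂ) = z at *
  generalize g 0 0 = i at *
  generalize g 0 1 = j at *
  generalize g 1 0 = k at *
  generalize g 1 1 = l at *
  have hdet' : (i:ℝ) * l - j * k = 1 := by exact_mod_cast hdet
  refine ⟨i, j, k, l, hdet, lat_alg _ _ _ _ ?_ z ?_ h34 hre⟩
  · linear_combination (i * l - j * k : ℝ) * h + hdet'
  · rw [hz]
    have e1 : (⟨i * p + j * r, -(i * q + j * t)⟩ : ℂ) = (i : ℂ) * ⟨p, -q⟩ + j * ⟨r, -t⟩ := by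
      apply Complex.ext <;> simp; ring
    have e2 : (⟨k * p + l * r, -(k * q + l * t)⟩ : ℂ) = (k : ℂ) * ⟨p, -q⟩ + l * ⟨r, -t⟩ := by
      apply Complex.ext <;> simp; ring
    rw [e1, e2]
    generalize (⟨p, -q⟩ : ℂ) = w1 at *
    generalize (⟨r, -t⟩ : ℂ) = w2 at *
    simp
    field_simp

end BQFC


namespace BQFC

lemma act_bd (p q r t A B N : ℝ) (hp : |p| ≤ A) (hq : |q| ≤ A) (hr : |r| ≤ B) (ht : |t| ≤ B) (v : V) (hv : ‖v‖ ≤ N) :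
    |(act5 p q r t v).1| ≤ 5 * A ^ 4 * N ∧ |(act5 p q r t v).2.1| ≤ 20 * A ^ 3 * B * N ∧
    |(act5 p q r t v).2.2.1| ≤ 30 * A ^ 2 * B ^ 2 * N ∧ |(act5 p q r t v).2.2.2.1| ≤ 20 * A * B ^ 3 * N ∧
    |(act5 p q r t v).2.2.2.2| ≤ 5 * B ^ 4 * N := by
  have hA : 0 ≤ A := (abs_nonneg p).trans hp
  have hB : 0 ≤ B := (abs_nonneg r).trans hr
  have hN : 0 ≤ N := (norm_nonneg v).trans hv
  rw [norm_le_iff] at hv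
  obtain ⟨a, b, c, d, e⟩ := v
  obtain ⟨ha, hb, hc, hd, he⟩ := hv
  simp only at ha hb hc hd he
  have add : ∀ {x y X Y : ℝ}, |x| ≤ X → |y| ≤ Y → |x + y| ≤ X + Y := fun h1 h2 => (abs_add_le _ _).trans (add_le_add h1 h2)
  have mul : ∀ {x y X Y : ℝ}, |x| ≤ X → |y| ≤ Y → |x * y| ≤ X * Y := fun h1 h2 => by
    rw [abs_mul]; exact mul_le_mul h1 h2 (abs_nonneg _) ((abs_nonneg _).trans h1)
  have pw : ∀ {x X : ℝ} (n : ℕ), |x| ≤ X → |x ^ n| ≤ X ^ n := fun n h1 => by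
    rw [abs_pow]; exact pow_le_pow_left₀ (abs_nonneg _) h1 n
  have h2 : |(2:ℝ)| ≤ 2 := by norm_num
  have h3 : |(3:ℝ)| ≤ 3 := by norm_num
  have h4 : |(4:ℝ)| ≤ 4 := by norm_num
  have h6 : |(6:ℝ)| ≤ 6 := by norm_num
  refine ⟨?_, ?_, ?_, ?_, ?_⟩
  · refine (add (add (add (add (mul ha (pw 4 hp)) (mul (mul hb (pw 3 hp)) hq)) (mul (mul hc (pw 2 hp)) (pw 2 hq)))
      (mul (mul hd hp) (pw 3 hq))) (mul he (pw 4 hq))).trans (le_of_eq ?_)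
    ring
  · refine (add (add (add (add (mul (mul (mul h4 ha) (pw 3 hp)) hr) (mul hb (add (mul (pw 3 hp) ht) (mul (mul (mul h3 (pw 2 hp)) hr) hq))))
      (mul hc (add (mul (mul (mul h2 (pw 2 hp)) hq) ht) (mul (mul (mul h2 hp) hr) (pw 2 hq)))))
      (mul hd (add (mul (mul (mul h3 hp) (pw 2 hq)) ht) (mul hr (pw 3 hq))))) (mul (mul (mul h4 he) (pw 3 hq)) ht)).trans (le_of_eq ?_)
    ring
  · refine (add (add (add (add (mul (mul (mul h6 ha) (pw 2 hp)) (pw 2 hr)) (mul hb (add (mul (mul (mul h3 (pw 2 hp)) hr) ht) (mul (mul (mul h3 hp) (pw 2 hr)) hq))))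
      (mul hc (add (add (mul (pw 2 hp) (pw 2 ht)) (mul (mul (mul (mul h4 hp) hr) hq) ht)) (mul (pw 2 hr) (pw 2 hq)))))
      (mul hd (add (mul (mul (mul h3 hp) hq) (pw 2 ht)) (mul (mul (mul h3 hr) (pw 2 hq)) ht)))) (mul (mul (mul h6 he) (pw 2 hq)) (pw 2 ht))).trans (le_of_eq ?_)
    ring
  · refine (add (add (add (add (mul (mul (mul h4 ha) hp) (pw 3 hr)) (mul hb (add (mul (mul (mul h3 hp) (pw 2 hr)) ht) (mul (pw 3 hr) hq))))
      (mul hc (add (mul (mul (mul h2 hp) hr) (pw 2 ht)) (mul (mul (mul h2 (pw 2 hr)) hq) ht))))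
      (mul hd (add (mul hp (pw 3 ht)) (mul (mul (mul h3 hr) hq) (pw 2 ht))))) (mul (mul (mul h4 he) hq) (pw 3 ht))).trans (le_of_eq ?_)
    ring
  · refine (add (add (add (add (mul ha (pw 4 hr)) (mul (mul hb (pw 3 hr)) ht)) (mul (mul hc (pw 2 hr)) (pw 2 ht)))
      (mul (mul hd hr) (pw 3 ht))) (mul he (pw 4 ht))).trans (le_of_eq ?_)
    ring

/-- an element of `G` from its entries -/
noncomputable def gm (i j k l : ℤ) (h : i * l - j * k = 1) : G :=
  Matrix.GeneralLinearGroup.mk'' !![i, j; k, l] (by rw [Matrix.det_fin_two_of, h]; exact isUnit_one)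

lemma toV_gm (i j k l : ℤ) (h : i * l - j * k = 1) (f : BQF) : toV (gm i j k l h • f) = act5 (i:ℝ) j k l (toV f) := by
  rw [toV_smul]; rfl

lemma red_bd (M s A B : ℝ) (hM : 1 ≤ M) (hs : 0 < s) (hA0 : 0 < A) (hB0 : 0 ≤ B) (h2 : A ^ 2 ≤ 2) (hAB : A * B ≤ 2) (v : V)
    (bd : |v.1| ≤ 5 * A ^ 4 * (M * s) ∧ |v.2.1| ≤ 20 * A ^ 3 * B * (M * s) ∧ |v.2.2.1| ≤ 30 * A ^ 2 * B ^ 2 * (M * s) ∧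
      |v.2.2.2.1| ≤ 20 * A * B ^ 3 * (M * s) ∧ |v.2.2.2.2| ≤ 5 * B ^ 4 * (M * s)) :
    |v.1| ≤ 38400 * M ^ 2 * s * (A ^ 2) ^ 2 ∧ |pf v.1 v.2.1 v.2.2.1| ≤ 38400 * M ^ 2 * s ^ 2 ∧
      ‖v‖ ≤ 38400 * M ^ 2 * s / (A ^ 2) ^ 2 := by
  have hMs : 0 < M * s := by positivity
  have hMM : M ≤ M ^ 2 := le_self_pow₀ hM two_ne_zero
  have hτ2 : B ≤ 2 / A := by rw [le_div_iff₀ hA0]; linarith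
  obtain ⟨ba, bb, bc, bd, be⟩ := bd
  have ba' : |v.1| ≤ 5 * (A ^ 2) ^ 2 * (M * s) := ba.trans (le_of_eq (by ring))
  have bb' : |v.2.1| ≤ 40 * A ^ 2 * (M * s) := bb.trans (by
    calc _ = 20 * (A * B) * A ^ 2 * (M * s) := by ring
      _ ≤ 20 * 2 * A ^ 2 * (M * s) := by gcongr
      _ = _ := by ring)
  have bc' : |v.2.2.1| ≤ 120 * (M * s) := bc.trans (by
    calc _ = 30 * (A * B) ^ 2 * (M * s) := by ring
      _ ≤ 30 * 2 ^ 2 * (M * s) := by gcongr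
      _ = _ := by ring)
  have bd' : |v.2.2.2.1| ≤ 160 / A ^ 2 * (M * s) := bd.trans (by
    calc _ = 20 * (A * B) * B ^ 2 * (M * s) := by ring
      _ ≤ 20 * 2 * (2 / A) ^ 2 * (M * s) := by gcongr
      _ = _ := by ring)
  have be' : |v.2.2.2.2| ≤ 80 / A ^ 4 * (M * s) := be.trans (by
    calc _ ≤ 5 * (2 / A) ^ 4 * (M * s) := by gcongr
      _ = _ := by ring)
  have hθ2 : (A ^ 2) ^ 2 ≤ 4 := by linarith [mul_le_mul h2 h2 (sq_nonneg A) zero_le_two]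
  have hMs2 : M * s ≤ M ^ 2 * s := by gcongr
  refine ⟨?_, ?_, ?_⟩
  · refine ba'.trans ?_
    calc _ ≤ 38400 * (A ^ 2) ^ 2 * (M ^ 2 * s) := by gcongr; norm_num
      _ = _ := by ring
  · unfold pf
    refine (abs_sub _ _).trans ?_
    simp only [abs_mul, abs_pow, abs_of_pos (show (0:ℝ) < 3 by norm_num), abs_of_pos (show (0:ℝ) < 8 by norm_num)]
    calc _ ≤ 3 * (40 * A ^ 2 * (M * s)) ^ 2 + 8 * (5 * (A ^ 2) ^ 2 * (M * s)) * (120 * (M * s)) := by gcongr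
      _ = 9600 * (M * s) ^ 2 * (A ^ 2) ^ 2 := by ring
      _ ≤ 9600 * (M * s) ^ 2 * 4 := by gcongr
      _ = _ := by ring
  · rw [norm_le_iff]
    have key : ∀ x c : ℝ, |x| ≤ c * (M * s) → c * (A ^ 2) ^ 2 ≤ 38400 → |x| ≤ 38400 * M ^ 2 * s / (A ^ 2) ^ 2 := by
      intro x c hx hc
      rw [le_div_iff₀ (by positivity)]
      calc |x| * (A ^ 2) ^ 2 ≤ c * (M * s) * (A ^ 2) ^ 2 := by gcongr
        _ = (c * (A ^ 2) ^ 2) * (M * s) := by ring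
        _ ≤ 38400 * (M ^ 2 * s) := by gcongr
        _ = _ := by ring
    refine ⟨key _ _ ba' (by linarith [mul_le_mul hθ2 hθ2 (by positivity) zero_le_four]), key _ _ bb' (by linarith [mul_le_mul h2 hθ2 (by positivity) zero_le_two]), key _ _ bc' (by linarith), key _ _ bd' ?_, key _ _ be' ?_⟩
    · rw [show 160 / A ^ 2 * (A ^ 2) ^ 2 = 160 * A ^ 2 by field_simp]; linarith
    · rw [show 80 / A ^ 4 * (A ^ 2) ^ 2 = 80 by field_simp]; norm_num

lemma reduction : ∃ M1 : ℝ, 1 ≤ M1 ∧ ∀ (f : BQF) (s : ℝ), 0 < s → |IR f| ≤ s ^ 2 → |JR f| ≤ s ^ 3 →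
    ∃ γ : G, ∃ θ : ℝ, 0 < θ ∧ θ ≤ 2 ∧ |((γ • f).a : ℝ)| ≤ M1 * s * θ ^ 2 ∧ |pR (γ • f)| ≤ M1 * s ^ 2 ∧
      ‖toV (γ • f)‖ ≤ M1 * s / θ ^ 2 := by
  obtain ⟨M, hM, hred⟩ := real_red
  refine ⟨38400 * M ^ 2, by linarith [one_le_pow₀ hM (n := 2)], fun f s hs hI hJ => ?_⟩
  obtain ⟨p, q, r, t, hd, hn⟩ := hred (toV f) s hs hI hJ
  obtain ⟨i, j, k, l, hdet, h1, h2, h3⟩ := lat_red t (-q) (-r) p (by linarith)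
  set f0 := act5 p q r t (toV f) with hf0
  have e0 : toV f = act5 t (-q) (-r) p f0 := by
    rw [hf0, act5_act5]
    have e1 : t * p + -q * r = 1 := by linarith
    have e2 : t * q + -q * t = 0 := by ring
    have e3 : -r * p + p * r = 0 := by ring
    have e4 : -r * q + p * t = 1 := by linarith
    rw [e1, e2, e3, e4]
    simp [act5]
  have e2 := toV_gm k l (-i) (-j) (by linarith) f
  rw [e0, act5_act5] at e2
  generalize (gm k l (-i) (-j) _ : G) = γ at *
  push_cast at e2
  set R := (k:ℝ) * t + l * -r
  set T' := (k:ℝ) * -q + l * p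
  set P := (i:ℝ) * t + j * -r with hP
  set Q := (i:ℝ) * -q + j * p with hQ
  have eP : -(i:ℝ) * t + -j * -r = -P := by rw [hP]; ring
  have eQ : -(i:ℝ) * -q + -j * p = -Q := by rw [hQ]; ring
  rw [eP, eQ] at e2
  set θ := R ^ 2 + T' ^ 2 with hθ
  set τ := P ^ 2 + Q ^ 2 with hτ
  have hτ0 : 0 ≤ τ := by positivity
  have bd := act_bd R T' (-P) (-Q) (√θ) (√τ) (M * s) (Real.abs_le_sqrt (by rw [hθ]; linarith [sq_nonneg T'])) (Real.abs_le_sqrt (by rw [hθ]; linarith [sq_nonneg R]))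
    (by rw [abs_neg]; exact Real.abs_le_sqrt (by rw [hτ]; linarith [sq_nonneg Q])) (by rw [abs_neg]; exact Real.abs_le_sqrt (by rw [hτ]; linarith [sq_nonneg P])) f0 hn
  rw [← e2] at bd
  have hA : √θ ^ 2 = θ := Real.sq_sqrt h3.le
  have hB : √τ ^ 2 = τ := Real.sq_sqrt hτ0
  have hA0 := Real.sqrt_nonneg θ
  have hB0 := Real.sqrt_nonneg τ
  generalize √θ = A at *
  generalize √τ = B at *
  have hAB : A * B ≤ 2 := by
    have : (A * B) ^ 2 ≤ 2 ^ 2 := by rw [mul_pow, hA, hB]; linarith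
    exact le_of_sq_le_sq this (by norm_num)
  have hAp : 0 < A := lt_of_le_of_ne hA0 (by rintro rfl; rw [← hA] at h3; norm_num at h3)
  have key := red_bd M s A B hM hs hAp hB0 (hA.trans_le h2) hAB _ bd
  rw [hA] at key
  exact ⟨γ, θ, h3, h2, key.1, key.2.1, key.2.2⟩

end BQFC


namespace BQFC

def Dl (v : V) : ℝ := 4 * IV v ^ 3 - JV v ^ 2

lemma Dl_cont : Continuous Dl := by unfold Dl; exact (continuous_const.mul (IV_cont.pow 3)).sub (JV_cont.pow 2)

lemma Dl_act (p q r t : ℝ) (v : V) : Dl (act5 p q r t v) = (p * t - q * r) ^ 12 * Dl v := by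
  unfold Dl; rw [IV_act, JV_act]; ring

lemma proper1 (M δ : ℝ) (hM : 1 ≤ M) (hδ : 0 < δ) : ∃ R : ℝ, 1 ≤ R ∧ ∀ (v : V) (p q r t : ℝ), ‖v‖ ≤ M → δ ≤ |Dl v| →
    (p * t - q * r) ^ 2 = 1 → ‖act5 p q r t v‖ ≤ M → r ^ 2 + t ^ 2 ≤ p ^ 2 + q ^ 2 → p ^ 2 + q ^ 2 ≤ R := by
  set K : Set V := {v | ‖v‖ ≤ 30 * M ∧ δ ≤ |Dl v|} with hK
  have hKc : IsCompact K := by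
    refine (isCompact_closedBall (0:V) (30 * M)).of_isClosed_subset ?_ (fun v hv => by simpa using hv.1)
    rw [hK, Set.ofPred_and]
    exact (isClosed_le continuous_norm continuous_const).inter (isClosed_le continuous_const Dl_cont.abs)
  have hpos : ∀ v ∈ K, 0 < |v.1| + |v.2.1| := by
    intro v hv
    by_contra hh
    have h1 : v.1 = 0 := abs_eq_zero.mp (by linarith [abs_nonneg v.1, abs_nonneg v.2.1])
    have h2 : v.2.1 = 0 := abs_eq_zero.mp (by linarith [abs_nonneg v.1, abs_nonneg v.2.1])
    have := hv.2
    have h0 : Dl v = 0 := by unfold Dl IV JV Ir Jr; rw [h1, h2]; ring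
    rw [h0, abs_zero] at this; linarith
  obtain ⟨ε, hε, hε2⟩ : ∃ ε : ℝ, 0 < ε ∧ ∀ v ∈ K, ε ≤ |v.1| + |v.2.1| := by
    rcases K.eq_empty_or_nonempty with h | h
    · exact ⟨1, one_pos, by simp [h]⟩
    · obtain ⟨v0, hv0, hm⟩ := hKc.exists_isMinOn h (f := fun v => |v.1| + |v.2.1|) (by fun_prop)
      exact ⟨_, hpos v0 hv0, fun v hv => hm hv⟩
  refine ⟨max 1 (6 * M / ε), le_max_left _ _, fun v p q r t hv hD hdet hv' hle => ?_⟩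
  by_cases h1 : p ^ 2 + q ^ 2 ≤ 1
  · exact h1.trans (le_max_left _ _)
  push Not at h1
  refine le_trans ?_ (le_max_right _ _)
  rw [le_div_iff₀ hε]
  obtain ⟨ρ, hρ0, hρ⟩ : ∃ ρ : ℝ, 0 < ρ ∧ ρ ^ 2 = p ^ 2 + q ^ 2 := ⟨_, Real.sqrt_pos.mpr (by linarith), Real.sq_sqrt (by positivity)⟩
  set v1 := act5 (p / ρ) (q / ρ) (-q / ρ) (p / ρ) v with hv1
  have hd1 : p / ρ * (p / ρ) - q / ρ * (-q / ρ) = 1 := by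
    field_simp; linarith
  have pρ : |p / ρ| ≤ 1 := by rw [abs_div, abs_of_pos hρ0, div_le_one hρ0]; exact abs_le_of_sq_le_sq (by linarith [sq_nonneg q]) hρ0.le
  have qρ : |q / ρ| ≤ 1 := by rw [abs_div, abs_of_pos hρ0, div_le_one hρ0]; exact abs_le_of_sq_le_sq (by linarith [sq_nonneg p]) hρ0.le
  have qρ' : |-q / ρ| ≤ 1 := by rwa [neg_div, abs_neg]
  have b1 := act_bd _ _ _ _ 1 1 M pρ qρ qρ' pρ v hv
  rw [← hv1] at b1
  have hmem : v1 ∈ K := by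
    refine ⟨?_, by rw [hv1, Dl_act, hd1]; simpa using hD⟩
    rw [norm_le_iff]
    refine ⟨?_, ?_, ?_, ?_, ?_⟩ <;> linarith [b1.1, b1.2.1, b1.2.2.1, b1.2.2.2.1, b1.2.2.2.2]
  have := hε2 _ hmem
  set x := (r * p + t * q) / ρ with hx
  set y := (p * t - q * r) / ρ with hy
  have e : act5 p q r t v = act5 ρ 0 x y v1 := by
    rw [hv1, act5_act5]
    congr 1
    · field_simp; ring
    · field_simp; ring
    · rw [hx, hy]; field_simp; linear_combination r * hρ
    · rw [hx, hy]; field_simp; linear_combination t * hρ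
  rw [e, norm_le_iff] at hv'
  obtain ⟨n1, n2, -⟩ := hv'
  clear_value v1
  obtain ⟨a, b, c, d, e⟩ := v1
  simp only [act5] at n1 n2 this
  have hxρ : |x| ≤ ρ := by
    refine abs_le_of_sq_le_sq ?_ hρ0.le
    rw [hx, div_pow, div_le_iff₀ (by positivity)]
    rw [hρ]
    linarith [sq_nonneg (r * q - t * p), mul_le_mul_of_nonneg_right hle (add_nonneg (sq_nonneg p) (sq_nonneg q))]
  have m1 : |a| * ρ ^ 4 ≤ M := by
    rw [← abs_of_pos (by positivity : 0 < ρ ^ 4), ← abs_mul]; refine le_trans (le_of_eq ?_) n1; congr 1; ring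
  have hyy : |y| * ρ = 1 := by
    have : |p * t - q * r| = 1 := by rw [← sq_eq_sq₀ (abs_nonneg _) one_pos.le, sq_abs, hdet, one_pow]
    rw [hy, abs_div, this, abs_of_pos hρ0]; field_simp
  have m2 : |b| * ρ ^ 2 ≤ 5 * M := by
    have k1 : |b * (ρ ^ 3 * y)| ≤ M + |4 * a * ρ ^ 3 * x| := by
      have : b * (ρ ^ 3 * y) = (a * 0 + (4 * a * ρ ^ 3 * x + b * (ρ ^ 3 * y))) - 4 * a * ρ ^ 3 * x := by ring
      rw [this]
      refine (abs_sub _ _).trans (add_le_add ?_ le_rfl)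
      refine le_trans (le_of_eq ?_) n2; congr 1; ring
    have k2 : |b * (ρ ^ 3 * y)| = |b| * ρ ^ 2 := by
      rw [abs_mul, abs_mul, abs_of_pos (by positivity : 0 < ρ ^ 3)]; linear_combination |b| * ρ ^ 2 * hyy
    have k3 : |4 * a * ρ ^ 3 * x| ≤ 4 * M := by
      rw [abs_mul, abs_mul, abs_mul, abs_of_pos (by positivity : 0 < ρ ^ 3), abs_of_pos (show (0:ℝ) < 4 by norm_num)]
      calc _ ≤ 4 * |a| * ρ ^ 3 * ρ := by gcongr
        _ = 4 * (|a| * ρ ^ 4) := by ring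
        _ ≤ _ := by linarith
    linarith
  have m3 : |a| * ρ ^ 2 ≤ M := by
    refine le_trans ?_ m1
    have : ρ ^ 2 ≤ ρ ^ 4 := by linarith [mul_le_mul_of_nonneg_left (hρ ▸ h1.le : 1 ≤ ρ ^ 2) (sq_nonneg ρ)]
    gcongr
  rw [← hρ]
  linarith [mul_le_mul_of_nonneg_left this (sq_nonneg ρ)]

lemma proper (M δ : ℝ) (hM : 1 ≤ M) (hδ : 0 < δ) : ∃ R : ℝ, 1 ≤ R ∧ ∀ (v : V) (p q r t : ℝ), ‖v‖ ≤ M → δ ≤ |Dl v| →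
    (p * t - q * r) ^ 2 = 1 → ‖act5 p q r t v‖ ≤ M → |p| ≤ R ∧ |q| ≤ R ∧ |r| ≤ R ∧ |t| ≤ R := by
  obtain ⟨R, hR, h⟩ := proper1 M δ hM hδ
  refine ⟨R, hR, fun v p q r t hv hD hdet hv' => ?_⟩
  have key : p ^ 2 + q ^ 2 ≤ R ∧ r ^ 2 + t ^ 2 ≤ R := by
    rcases le_total (r ^ 2 + t ^ 2) (p ^ 2 + q ^ 2) with h1 | h1
    · have := h v p q r t hv hD hdet hv' h1
      exact ⟨this, h1.trans this⟩
    · have := h v r t p q hv hD (by rw [← hdet]; ring) (by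
        rw [norm_le_iff] at hv' ⊢
        obtain ⟨a, b, c, d, e⟩ := v
        obtain ⟨n1, n2, n3, n4, n5⟩ := hv'
        refine ⟨?_, ?_, ?_, ?_, ?_⟩
        · convert n5 using 2; simp only [act5]
        · convert n4 using 2; simp only [act5]; ring
        · convert n3 using 2; simp only [act5]; ring
        · convert n2 using 2; simp only [act5]; ring
        · convert n1 using 2; simp only [act5]) h1
      exact ⟨h1.trans this, this⟩
  have hRR : R ≤ R ^ 2 := le_self_pow₀ hR two_ne_zero
  refine ⟨?_, ?_, ?_, ?_⟩ <;> refine abs_le_of_sq_le_sq ?_ (by linarith) <;>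
    linarith [sq_nonneg p, sq_nonneg q, sq_nonneg r, sq_nonneg t]

/-- integral matrices with bounded entries -/
lemma bdG (R : ℝ) : {γ : G | ∀ i j, |((γ i j : ℤ) : ℝ)| ≤ R}.Finite := by
  have hf : (Set.Icc (-⌊R⌋) ⌊R⌋ ×ˢ Set.Icc (-⌊R⌋) ⌊R⌋ ×ˢ Set.Icc (-⌊R⌋) ⌊R⌋ ×ˢ Set.Icc (-⌊R⌋) ⌊R⌋).Finite :=
    (Set.finite_Icc _ _).prod ((Set.finite_Icc _ _).prod ((Set.finite_Icc _ _).prod (Set.finite_Icc _ _)))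
  refine Set.Finite.of_finite_image (f := fun γ : G => (γ 0 0, γ 0 1, γ 1 0, γ 1 1)) (hf.subset ?_) ?_
  · rintro _ ⟨γ, hγ, rfl⟩
    have : ∀ i j, γ i j ∈ Set.Icc (-⌊R⌋) ⌊R⌋ := fun i j => by
      rw [Set.mem_Icc, ← abs_le, Int.le_floor, Int.cast_abs]; exact hγ i j
    exact ⟨this _ _, this _ _, this _ _, this _ _⟩
  · intro γ _ δ _ h
    simp only [Prod.mk.injEq] at h
    exact G_ext h.1 h.2.1 h.2.2.1 h.2.2.2

end BQFC


namespace BQFC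

def ev (v : V) (x y : ℝ) : ℝ := v.1 * x ^ 4 + v.2.1 * x ^ 3 * y + v.2.2.1 * x ^ 2 * y ^ 2 + v.2.2.2.1 * x * y ^ 3 + v.2.2.2.2 * y ^ 4

lemma ev_act (p q r t : ℝ) (v : V) (x y : ℝ) : ev (act5 p q r t v) x y = ev v (x * p + y * r) (x * q + y * t) := by
  obtain ⟨a, b, c, d, e⟩ := v
  simp only [ev, act5]; ring

lemma ev_smul (k : ℝ) (v : V) (x y : ℝ) : ev (k • v) x y = k * ev v x y := by
  obtain ⟨a, b, c, d, e⟩ := v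
  simp only [ev, Prod.smul_mk, smul_eq_mul]; ring

lemma ev_hom (v : V) (k x y : ℝ) : ev v (k * x) (k * y) = k ^ 4 * ev v x y := by
  simp only [ev]; ring

/-- having a real zero -/
def Zr (v : V) : Prop := ∃ x y : ℝ, (x ≠ 0 ∨ y ≠ 0) ∧ ev v x y = 0

lemma Zr_unit {v : V} (h : Zr v) : ∃ x y : ℝ, x ^ 2 + y ^ 2 = 1 ∧ ev v x y = 0 := by
  obtain ⟨x, y, hxy, h0⟩ := h
  have hp : 0 < x ^ 2 + y ^ 2 := by rcases hxy with h | h <;> positivity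
  have hs := Real.sqrt_pos.mpr hp
  have h2 := Real.sq_sqrt hp.le
  refine ⟨(√(x ^ 2 + y ^ 2))⁻¹ * x, (√(x ^ 2 + y ^ 2))⁻¹ * y, ?_, by rw [ev_hom, h0, mul_zero]⟩
  rw [mul_pow, mul_pow, ← mul_add, inv_pow, h2, inv_mul_cancel₀ hp.ne']

lemma Zr_act {p q r t : ℝ} (h : p * t - q * r ≠ 0) (v : V) (hz : Zr (act5 p q r t v)) : Zr v := by
  obtain ⟨x, y, hxy, h0⟩ := hz
  rw [ev_act] at h0
  refine ⟨_, _, ?_, h0⟩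
  by_contra hh
  push Not at hh
  have h1 : x * (p * t - q * r) = 0 := by linear_combination t * hh.1 - r * hh.2
  have h2 : y * (p * t - q * r) = 0 := by linear_combination p * hh.2 - q * hh.1
  rcases hxy with hx | hy
  · exact hx ((mul_eq_zero.mp h1).resolve_right h)
  · exact hy ((mul_eq_zero.mp h2).resolve_right h)

lemma Zr_smul {k : ℝ} (hk : k ≠ 0) (v : V) : Zr (k • v) ↔ Zr v := by
  unfold Zr; simp [ev_smul, hk]

lemma ev_cont (x y : ℝ) : Continuous fun v : V => ev v x y := by unfold ev; fun_prop

lemma Zr_iff {v : V} (hD : Dl v ≠ 0) : Zr v ↔ (∃ x y, 0 < ev v x y) ∧ ∃ x y, ev v x y < 0 := by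
  constructor
  · intro h
    obtain ⟨x, y, h1, h0⟩ := Zr_unit h
    by_contra hcon
    have hv1 : ∀ z w, ev (act5 x y (-y) x v) z w = ev v (z * x + w * -y) (z * y + w * x) := ev_act _ _ _ _ _
    have hDl : Dl (act5 x y (-y) x v) = Dl v := by
      rw [Dl_act, show x * x - y * -y = 1 by linarith]; ring
    have ha : (act5 x y (-y) x v).1 = 0 := by
      have := hv1 1 0
      simp only [ev, one_mul, zero_mul, add_zero] at this h0
      simp only [one_pow, mul_one, mul_zero, add_zero, ne_eq, OfNat.ofNat_ne_zero, not_false_eq_true, zero_pow] at this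
      linarith
    generalize act5 x y (-y) x v = u at *
    have hder : HasDerivAt (fun w => ev u 1 w) u.2.1 0 := by
      have h2 : HasDerivAt (fun w : ℝ => u.1 + u.2.1 * w + u.2.2.1 * w ^ 2 + u.2.2.2.1 * w ^ 3 + u.2.2.2.2 * w ^ 4)
        (0 + u.2.1 * 1 + u.2.2.1 * (((2:ℕ):ℝ) * 0 ^ (2 - 1) * 1) + u.2.2.2.1 * (((3:ℕ):ℝ) * 0 ^ (3 - 1) * 1) + u.2.2.2.2 * (((4:ℕ):ℝ) * 0 ^ (4 - 1) * 1)) 0 :=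
        (((((hasDerivAt_const _ _).add ((hasDerivAt_id _).const_mul _)).add (((hasDerivAt_id _).pow 2).const_mul _)).add
          (((hasDerivAt_id _).pow 3).const_mul _)).add (((hasDerivAt_id _).pow 4).const_mul _))
      convert h2 using 1
      · funext w; simp only [ev]; ring
      · norm_num
    have h00 : ev u 1 0 = 0 := by simp [ev, ha]
    have hb : u.2.1 = 0 := by
      rw [not_and_or] at hcon
      rcases hcon with hc | hc
      · push Not at hc
        refine IsLocalMax.hasDerivAt_eq_zero (f := fun w => ev u 1 w) (a := 0) (Filter.Eventually.of_forall fun w => ?_) hder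
        change ev u 1 w ≤ ev u 1 0
        rw [h00, hv1]; exact hc _ _
      · push Not at hc
        refine IsLocalMin.hasDerivAt_eq_zero (f := fun w => ev u 1 w) (a := 0) (Filter.Eventually.of_forall fun w => ?_) hder
        change ev u 1 0 ≤ ev u 1 w
        rw [h00, hv1]; exact hc _ _
    apply hD
    rw [← hDl]
    unfold Dl IV JV Ir Jr; rw [ha, hb]; ring
  · rintro ⟨⟨x, y, h1⟩, ⟨x', y', h2⟩⟩
    have hc : Continuous fun t : ℝ => ev v (x + t * (x' - x)) (y + t * (y' - y)) := by unfold ev; fun_prop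
    obtain ⟨t, ht, h0⟩ : (0:ℝ) ∈ (fun t : ℝ => ev v (x + t * (x' - x)) (y + t * (y' - y))) '' Set.Icc 0 1 := by
      refine intermediate_value_Icc' zero_le_one hc.continuousOn ⟨?_, ?_⟩
      · simpa using h2.le
      · simpa using h1.le
    refine ⟨_, _, ?_, h0⟩
    by_contra hh
    push Not at hh
    have e : (1 - t) ^ 4 * ev v x y = t ^ 4 * ev v x' y' := by
      rw [← ev_hom, ← ev_hom, show (1 - t) * x = -t * x' by linarith [hh.1], show (1 - t) * y = -t * y' by linarith [hh.2], ev_hom, ev_hom]; ring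
    have e1 : (1 - t) ^ 4 * ev v x y = 0 := le_antisymm (by rw [e]; exact mul_nonpos_of_nonneg_of_nonpos (by positivity) h2.le) (by positivity)
    have e2 : t ^ 4 * ev v x' y' = 0 := by rw [← e, e1]
    have t1 : t = 1 := by
      have := pow_eq_zero_iff (by norm_num) |>.mp ((mul_eq_zero.mp e1).resolve_right h1.ne'); linarith
    have t2 : t = 0 := pow_eq_zero_iff (by norm_num) |>.mp ((mul_eq_zero.mp e2).resolve_right h2.ne)
    linarith

lemma Zr_closed : IsClosed {v : V | Zr v} := by
  have hs : IsCompact {u : ℝ × ℝ | u.1 ^ 2 + u.2 ^ 2 = 1} := by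
    refine (isCompact_closedBall (0 : ℝ × ℝ) 1).of_isClosed_subset (isClosed_eq (by fun_prop) continuous_const) ?_
    intro u hu
    have hu : u.1 ^ 2 + u.2 ^ 2 = 1 := hu
    rw [mem_closedBall_zero_iff, Prod.norm_def, max_le_iff, Real.norm_eq_abs, Real.norm_eq_abs]
    exact ⟨abs_le_of_sq_le_sq (by linarith [sq_nonneg u.2]) zero_le_one, abs_le_of_sq_le_sq (by linarith [sq_nonneg u.1]) zero_le_one⟩
  have := isCompact_iff_compactSpace.mp hs
  have hcl : IsClosed {w : {u : ℝ × ℝ | u.1 ^ 2 + u.2 ^ 2 = 1} × V | ev w.2 w.1.1.1 w.1.1.2 = 0} := by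
    refine isClosed_eq ?_ continuous_const
    unfold ev; fun_prop
  convert isClosedMap_snd_of_compactSpace _ hcl using 1
  ext v
  constructor
  · intro h
    obtain ⟨x, y, h1, h2⟩ := Zr_unit h
    exact ⟨(⟨(x, y), h1⟩, v), h2, rfl⟩
  · rintro ⟨⟨⟨⟨x, y⟩, h1⟩, v⟩, h2, rfl⟩
    refine ⟨x, y, ?_, h2⟩
    by_contra hh
    push Not at hh
    simp [hh.1, hh.2] at h1

/-- signature classes -/
def sig (i : ℕ) (v : V) : Prop := (i = 0 ∧ 0 < Dl v ∧ Zr v) ∨ (i = 1 ∧ Dl v < 0) ∨ (i = 2 ∧ 0 < Dl v ∧ ¬ Zr v)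

lemma sig_open (i : ℕ) : IsOpen {v | sig i v} := by
  have h1 : IsOpen {v : V | 0 < Dl v ∧ Zr v} := by
    have : {v : V | 0 < Dl v ∧ Zr v} = {v | 0 < Dl v} ∩ ((⋃ x, ⋃ y, {v | 0 < ev v x y}) ∩ ⋃ x, ⋃ y, {v | ev v x y < 0}) := by
      ext v
      simp only [Set.mem_ofPred_eq, Set.mem_inter_iff, Set.mem_iUnion]
      refine and_congr_right fun h => Zr_iff h.ne'
    rw [this]
    exact (isOpen_lt continuous_const Dl_cont).inter ((isOpen_iUnion fun x => isOpen_iUnion fun y => isOpen_lt continuous_const (ev_cont x y)).inter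
      (isOpen_iUnion fun x => isOpen_iUnion fun y => isOpen_lt (ev_cont x y) continuous_const))
  have h2 : IsOpen {v : V | Dl v < 0} := isOpen_lt Dl_cont continuous_const
  have h3 : IsOpen {v : V | 0 < Dl v ∧ ¬ Zr v} := (isOpen_lt continuous_const Dl_cont).inter Zr_closed.isOpen_compl
  unfold sig
  by_cases i0 : i = 0
  · subst i0; simpa using h1
  by_cases i1 : i = 1
  · subst i1; simpa using h2
  by_cases i2 : i = 2
  · subst i2; simpa using h3
  simp [i0, i1, i2]

lemma sig_cont (i : ℕ) (hi : i ≤ 2) (Ψ : V → ℝ) (hc : Continuous Ψ) (h0 : ∀ v, Dl v = 0 → Ψ v = 0) :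
    Continuous ({v | sig i v}.indicator Ψ) := by
  refine hc.indicator fun v hv => h0 v ?_
  by_contra hD
  have : sig 0 v ∨ sig 1 v ∨ sig 2 v := by
    unfold sig
    rcases lt_or_gt_of_ne hD with h | h
    · simp [h]
    · by_cases hz : Zr v <;> simp [h, hz]
  obtain ⟨j, hj⟩ : ∃ j, sig j v := by rcases this with h | h | h <;> exact ⟨_, h⟩
  by_cases hij : j = i
  · subst hij
    exact hv.2 ((sig_open j).interior_eq.symm ▸ hj)
  · obtain ⟨w, hw1, hw2⟩ := mem_closure_iff.mp hv.1 _ (sig_open j) hj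
    simp only [Set.mem_ofPred_eq, sig] at hw1 hw2
    rcases hw1 with ⟨rfl, h, h'⟩ | ⟨rfl, h⟩ | ⟨rfl, h, h'⟩ <;> rcases hw2 with ⟨rfl, k, k'⟩ | ⟨rfl, k⟩ | ⟨rfl, k, k'⟩ <;>
      first | exact hij rfl | exact h' k' | exact k' h' | linarith

lemma sig_act {p q r t : ℝ} (h : (p * t - q * r) ^ 2 = 1) (i : ℕ) (v : V) : sig i (act5 p q r t v) ↔ sig i v := by
  have hne : p * t - q * r ≠ 0 := by intro h0; rw [h0] at h; norm_num at h
  have hD : Dl (act5 p q r t v) = Dl v := by rw [Dl_act, show (p * t - q * r) ^ 12 = ((p * t - q * r) ^ 2) ^ 6 by ring, h]; ring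
  have hZ : Zr (act5 p q r t v) ↔ Zr v := by
    refine ⟨Zr_act hne v, fun hz => ?_⟩
    set k := p * t - q * r with hk
    refine Zr_act (p := t / k) (q := -q / k) (r := -r / k) (t := p / k) ?_ _ ?_
    · have : t / k * (p / k) - -q / k * (-r / k) = 1 / k := by field_simp; rw [hk]; ring
      rw [this]; positivity
    · rw [act5_act5]
      have e1 : t / k * p + -q / k * r = 1 := by field_simp; rw [hk]; ring
      have e2 : t / k * q + -q / k * t = 0 := by ring
      have e3 : -r / k * p + p / k * r = 0 := by ring
      have e4 : -r / k * q + p / k * t = 1 := by field_simp; rw [hk]; ring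
      rw [e1, e2, e3, e4]
      simpa [act5] using hz
  unfold sig; rw [hD, hZ]

lemma sig_smul {k : ℝ} (hk : 0 < k) (i : ℕ) (v : V) : sig i (k • v) ↔ sig i v := by
  have hD : Dl (k • v) = k ^ 6 * Dl v := by unfold Dl; rw [IV_smul, JV_smul]; ring
  have h1 : 0 < k ^ 6 * Dl v ↔ 0 < Dl v := mul_pos_iff_of_pos_left (by positivity)
  have h2 : k ^ 6 * Dl v < 0 ↔ Dl v < 0 := by rw [← not_le, ← not_le, not_iff_not]; exact mul_nonneg_iff_of_pos_left (by positivity)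
  unfold sig; rw [hD, Zr_smul hk.ne', h1, h2]

end BQFC


namespace BQFC

open Polynomial in
lemma quartic_fac (b c d e : ℝ) : ∃ p q r t : ℝ, b = p + r ∧ c = q + t + p * r ∧ d = p * t + r * q ∧ e = q * t := by
  have h : IsMonicOfDegree (X ^ 4 + (C b * X ^ 3 + C c * X ^ 2 + C d * X + C e) : ℝ[X]) (2 + 2) :=
    ⟨by compute_degree!, by monicity!⟩
  obtain ⟨f1, f2, h1, h2, h3⟩ := h.eq_isMonicOfDegree_two_mul_isMonicOfDegree
  obtain ⟨p, q, rfl⟩ := isMonicOfDegree_two_iff.mp h1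
  obtain ⟨r, t, rfl⟩ := isMonicOfDegree_two_iff.mp h2
  have h4 : C b * X ^ 3 + C c * X ^ 2 + C d * X + C e =
    (C (p + r) * X ^ 3 + C (q + t + p * r) * X ^ 2 + C (p * t + r * q) * X + C (q * t) : ℝ[X]) := by
    simp only [map_add, map_mul]
    linear_combination h3
  refine ⟨p, q, r, t, ?_⟩
  generalize p + r = b', q + t + p * r = c', p * t + r * q = d', q * t = e' at h4 ⊢
  refine ⟨?_, ?_, ?_, ?_⟩
  · simpa [coeff_X, coeff_C] using congrArg (fun g => coeff g 3) h4
  · simpa [coeff_X, coeff_C] using congrArg (fun g => coeff g 2) h4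
  · simpa [coeff_X, coeff_C] using congrArg (fun g => coeff g 1) h4
  · simpa [coeff_X, coeff_C] using congrArg (fun g => coeff g 0) h4

lemma quad_neg {p q : ℝ} (h : p ^ 2 - 4 * q < 0) : {z : ℝ | z ^ 2 + p * z + q = 0} = ∅ := by
  ext z
  simp only [Set.mem_ofPred_eq, Set.mem_empty_iff_false, iff_false]
  linarith [sq_nonneg (2 * z + p)]

lemma quad_pos {p q : ℝ} (h : 0 < p ^ 2 - 4 * q) : {z : ℝ | z ^ 2 + p * z + q = 0}.ncard = 2 := by
  have hs := Real.sqrt_pos.mpr h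
  have h2 := Real.sq_sqrt h.le
  have : {z : ℝ | z ^ 2 + p * z + q = 0} = {(-p + √(p ^ 2 - 4 * q)) / 2, (-p - √(p ^ 2 - 4 * q)) / 2} := by
    ext z
    simp only [Set.mem_ofPred_eq, Set.mem_insert_iff, Set.mem_singleton_iff]
    have e : z ^ 2 + p * z + q = (z - (-p + √(p ^ 2 - 4 * q)) / 2) * (z - (-p - √(p ^ 2 - 4 * q)) / 2) := by
      linear_combination (1 / 4) * h2
    rw [e, mul_eq_zero, sub_eq_zero, sub_eq_zero]
  rw [this, Set.ncard_pair]
  intro h3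
  linarith

lemma roots_sig (f : BQF) (ha : f.a ≠ 0) (hD : Dl (toV f) ≠ 0) (i : ℕ) (hi : i ≤ 2) :
    f.realRoots.ncard = 4 - 2 * i ↔ sig i (toV f) := by
  have ha' : (f.a : ℝ) ≠ 0 := by exact_mod_cast ha
  obtain ⟨p, q, r, t, h1, h2, h3, h4⟩ := quartic_fac (f.b / f.a) (f.c / f.a) (f.d / f.a) (f.e / f.a)
  rw [div_eq_iff ha'] at h1 h2 h3 h4
  have hDe : Dl (toV f) = 27 * (f.a : ℝ) ^ 6 * ((p ^ 2 - 4 * q) * (r ^ 2 - 4 * t)) * ((t - q) ^ 2 + (p - r) * (p * t - r * q)) ^ 2 := by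
    simp only [Dl, toV, IV, JV, Ir, Jr]
    rw [h1, h2, h3, h4]; ring
  have hroot : f.realRoots = {z | z ^ 2 + p * z + q = 0} ∪ {z | z ^ 2 + r * z + t = 0} := by
    ext z
    simp only [BQF.realRoots, BQF.evalR, Set.mem_ofPred_eq, Set.mem_union]
    rw [h1, h2, h3, h4, ← mul_eq_zero]
    have : (f.a:ℝ) * z ^ 4 + (p + r) * f.a * z ^ 3 * 1 + (q + t + p * r) * f.a * z ^ 2 * 1 ^ 2 + (p * t + r * q) * f.a * z * 1 ^ 3 + q * t * f.a * 1 ^ 4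
      = f.a * ((z ^ 2 + p * z + q) * (z ^ 2 + r * z + t)) := by ring
    rw [this, mul_eq_zero, or_iff_right ha']
  rw [hDe] at hD
  have hR : ((t - q) ^ 2 + (p - r) * (p * t - r * q)) ≠ 0 := by
    intro h0; rw [h0] at hD; apply hD; ring
  have hdis : Disjoint {z : ℝ | z ^ 2 + p * z + q = 0} {z | z ^ 2 + r * z + t = 0} := by
    rw [Set.disjoint_left]
    intro z hz hz'
    simp only [Set.mem_ofPred_eq] at hz hz'
    apply hR
    linear_combination ((p - r) ^ 2 * hz) - ((p - r) * z + (t - q) + (p - r) * p - 2 * (t-q) ) * (hz - hz') - 2 * (t - q) * (hz - hz')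
  have hZ : Zr (toV f) ↔ f.realRoots.Nonempty := by
    constructor
    · rintro ⟨x, y, hxy, h0⟩
      have hy : y ≠ 0 := by
        rintro rfl
        simp only [ev, toV] at h0
        have : (f.a:ℝ) * x ^ 4 = 0 := by linarith
        have hx := pow_eq_zero_iff (by norm_num) |>.mp ((mul_eq_zero.mp this).resolve_left ha')
        simp [hx] at hxy
      refine ⟨x / y, ?_⟩
      have := ev_hom (toV f) y (x / y) 1
      rw [mul_one, mul_div_cancel₀ _ hy, h0] at this
      exact (mul_eq_zero.mp this.symm).resolve_left (pow_ne_zero _ hy)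
    · rintro ⟨z, hz⟩
      exact ⟨z, 1, Or.inr one_ne_zero, hz⟩
  have hfin : ∀ p q : ℝ, {z : ℝ | z ^ 2 + p * z + q = 0}.Finite := by
    intro p q
    have := Polynomial.finite_setOfPred_isRoot (p := (Polynomial.X ^ 2 + Polynomial.C p * Polynomial.X + Polynomial.C q : Polynomial ℝ))
      (Polynomial.isMonicOfDegree_add_add_two p q).monic.ne_zero
    simpa [Polynomial.IsRoot] using this
  have hp1 : p ^ 2 - 4 * q ≠ 0 := by intro h0; rw [h0] at hD; apply hD; ring
  have hp2 : r ^ 2 - 4 * t ≠ 0 := by intro h0; rw [h0] at hD; apply hD; ring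
  have hpos : 0 < 27 * (f.a : ℝ) ^ 6 := by positivity
  have hR2 : 0 < ((t - q) ^ 2 + (p - r) * (p * t - r * q)) ^ 2 := by positivity
  have hi' : i = 0 ∨ i = 1 ∨ i = 2 := by omega
  unfold sig
  rw [hZ, hDe, hroot]
  have hn := Set.ncard_union_eq hdis (hfin _ _) (hfin _ _)
  rcases lt_or_gt_of_ne hp1 with c1 | c1 <;> rcases lt_or_gt_of_ne hp2 with c2 | c2
  · have hs : 0 < 27 * (f.a : ℝ) ^ 6 * ((p ^ 2 - 4 * q) * (r ^ 2 - 4 * t)) * ((t - q) ^ 2 + (p - r) * (p * t - r * q)) ^ 2 :=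
      mul_pos (mul_pos hpos (mul_pos_of_neg_of_neg c1 c2)) hR2
    rw [quad_neg c1, quad_neg c2]
    rcases hi' with rfl | rfl | rfl <;> simp [hs, hs.le]
  · have hs : 27 * (f.a : ℝ) ^ 6 * ((p ^ 2 - 4 * q) * (r ^ 2 - 4 * t)) * ((t - q) ^ 2 + (p - r) * (p * t - r * q)) ^ 2 < 0 :=
      mul_neg_of_neg_of_pos (mul_neg_of_pos_of_neg hpos (mul_neg_of_neg_of_pos c1 c2)) hR2
    rw [quad_neg c1, quad_pos c2, Set.ncard_empty] at hn
    rw [quad_neg c1, hn]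
    rcases hi' with rfl | rfl | rfl <;> simp [hs, hs.le]
  · have hs : 27 * (f.a : ℝ) ^ 6 * ((p ^ 2 - 4 * q) * (r ^ 2 - 4 * t)) * ((t - q) ^ 2 + (p - r) * (p * t - r * q)) ^ 2 < 0 :=
      mul_neg_of_neg_of_pos (mul_neg_of_pos_of_neg hpos (mul_neg_of_pos_of_neg c1 c2)) hR2
    rw [quad_pos c1, quad_neg c2, Set.ncard_empty] at hn
    rw [quad_neg c2, hn]
    rcases hi' with rfl | rfl | rfl <;> simp [hs, hs.le]
  · have hs : 0 < 27 * (f.a : ℝ) ^ 6 * ((p ^ 2 - 4 * q) * (r ^ 2 - 4 * t)) * ((t - q) ^ 2 + (p - r) * (p * t - r * q)) ^ 2 :=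
      mul_pos (mul_pos hpos (mul_pos c1 c2)) hR2
    rw [quad_pos c1, quad_pos c2] at hn
    have hne : ({z : ℝ | z ^ 2 + p * z + q = 0} ∪ {z | z ^ 2 + r * z + t = 0}).Nonempty :=
      Set.nonempty_of_ncard_ne_zero (by rw [hn]; norm_num)
    rw [hn]
    rcases hi' with rfl | rfl | rfl <;> simp [hs, hs.le, hne]

end BQFC


namespace BQFC

def pV (v : V) : ℝ := pf v.1 v.2.1 v.2.2.1

lemma pV_cont : Continuous pV := by unfold pV pf; fun_prop

open Polynomial in
lemma shear_ne (v : V) (h : ∀ n ∈ Finset.range 9, (act5 1 (n:ℝ) 0 1 v).1 * pV (act5 1 (n:ℝ) 0 1 v) = 0) : IV v = 0 := by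
  obtain ⟨a, b, c, d, e⟩ := v
  set A : ℝ[X] := C a + C b * X + C c * X ^ 2 + C d * X ^ 3 + C e * X ^ 4 with hA
  set p0 := 3 * b ^ 2 - 8 * a * c with h0
  set p1 := 4 * (b * c - 6 * a * d) with h1
  set p2 := 2 * (2 * c ^ 2 - 24 * a * e - 3 * b * d) with h2
  set p3 := 4 * (c * d - 6 * b * e) with h3
  set p4 := 3 * d ^ 2 - 8 * c * e with h4
  set B : ℝ[X] := C p0 + C p1 * X + C p2 * X ^ 2 + C p3 * X ^ 3 + C p4 * X ^ 4 with hB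
  have hAB : A * B = 0 := by
    by_contra hne
    have hd : (A * B).natDegree ≤ 8 := by
      refine natDegree_mul_le.trans ?_
      have : A.natDegree ≤ 4 := by rw [hA]; compute_degree
      have : B.natDegree ≤ 4 := by rw [hB]; compute_degree
      omega
    have hsub : ((Finset.range 9).image fun n : ℕ => (n:ℝ)) ⊆ (A * B).roots.toFinset := by
      intro x hx
      obtain ⟨n, hn, rfl⟩ := Finset.mem_image.mp hx
      rw [Multiset.mem_toFinset, mem_roots hne, IsRoot, ← h n hn]
      simp only [hA, hB, eval_mul, eval_add, eval_pow, eval_C, eval_X, pV, pf, act5, h0, h1, h2, h3, h4]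
      ring
    have hc := (Finset.card_le_card hsub).trans (Multiset.toFinset_card_le _) |>.trans (card_roots' _) |>.trans hd
    rw [Finset.card_image_of_injective _ Nat.cast_injective] at hc
    simp at hc
  have key : ∀ x0 x1 x2 x3 x4 : ℝ, (C x0 + C x1 * X + C x2 * X ^ 2 + C x3 * X ^ 3 + C x4 * X ^ 4 : ℝ[X]) = 0 →
      x0 = 0 ∧ x1 = 0 ∧ x2 = 0 ∧ x3 = 0 ∧ x4 = 0 := by
    intro x0 x1 x2 x3 x4 hx
    refine ⟨?_, ?_, ?_, ?_, ?_⟩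
    · simpa [coeff_X, coeff_C] using congrArg (fun g => coeff g 0) hx
    · simpa [coeff_X, coeff_C] using congrArg (fun g => coeff g 1) hx
    · simpa [coeff_X, coeff_C] using congrArg (fun g => coeff g 2) hx
    · simpa [coeff_X, coeff_C] using congrArg (fun g => coeff g 3) hx
    · simpa [coeff_X, coeff_C] using congrArg (fun g => coeff g 4) hx
  rcases mul_eq_zero.mp hAB with h' | h'
  · obtain ⟨k0, k1, k2, k3, k4⟩ := key _ _ _ _ _ h'
    simp [IV, Ir, k0, k1, k2, k3, k4]
  · obtain ⟨k0, k1, k2, k3, k4⟩ := key _ _ _ _ _ h'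
    have : (12 * a * e - 3 * b * d + c ^ 2) ^ 2 = 0 := by
      have : 12 * p0 * p4 - 3 * p1 * p3 + p2 ^ 2 = 16 * (12 * a * e - 3 * b * d + c ^ 2) ^ 2 := by
        simp only [h0, h1, h2, h3, h4]; ring
      rw [k0, k1, k2] at this
      linarith
    simpa [IV, Ir] using this

lemma shear (M δ : ℝ) (hδ : 0 < δ) : ∃ κ > 0, ∀ v : V, ‖v‖ ≤ M → δ ≤ |IV v| →
    ∃ n : ℕ, n ≤ 8 ∧ κ ≤ |(act5 1 (n:ℝ) 0 1 v).1 * pV (act5 1 (n:ℝ) 0 1 v)| := by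
  have hK : IsCompact {v : V | ‖v‖ ≤ M ∧ δ ≤ |IV v|} := by
    refine (isCompact_closedBall (0:V) M).of_isClosed_subset ?_ ?_
    · exact (isClosed_le continuous_norm continuous_const).inter (isClosed_le continuous_const IV_cont.abs)
    · intro v hv; simpa using hv.1
  have hc : Continuous fun v : V => ∑ n ∈ Finset.range 9, |(act5 1 (n:ℝ) 0 1 v).1 * pV (act5 1 (n:ℝ) 0 1 v)| := by
    refine continuous_finsetSum _ fun n _ => ?_
    have := act5_cont 1 (n:ℝ) 0 1
    exact ((continuous_fst.comp this).mul (pV_cont.comp this)).abs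
  obtain ⟨κ, h0, h⟩ := hK.exists_forall_le' hc.continuousOn (a := 0) (by
    rintro v ⟨-, hv⟩
    refine lt_of_le_of_ne (Finset.sum_nonneg fun _ _ => abs_nonneg _) fun h0 => ?_
    have := (Finset.sum_eq_zero_iff_of_nonneg fun _ _ => abs_nonneg _).mp h0.symm
    rw [shear_ne v fun n hn => abs_eq_zero.mp (this n hn)] at hv
    simp at hv; linarith)
  refine ⟨κ / 9, by positivity, fun v h1 h2 => ?_⟩
  by_contra hcon
  push Not at hcon
  have := h v ⟨h1, h2⟩
  have h3 := Finset.sum_lt_sum_of_nonempty (s := Finset.range 9) ⟨0, by simp⟩ fun n hn => hcon n (by simp at hn; omega)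
  rw [Finset.sum_const, Finset.card_range, nsmul_eq_mul] at h3
  push_cast at h3
  linarith

end BQFC


namespace BQFC

noncomputable def acG (γ : G) (v : V) : V := act5 ((γ 0 0 : ℤ):ℝ) ((γ 0 1 : ℤ):ℝ) ((γ 1 0 : ℤ):ℝ) ((γ 1 1 : ℤ):ℝ) v

lemma det_sq (γ : G) : (((γ 0 0 : ℤ):ℝ) * ((γ 1 1 : ℤ):ℝ) - ((γ 0 1 : ℤ):ℝ) * ((γ 1 0 : ℤ):ℝ)) ^ 2 = 1 := by
  have : (γ 0 0 * γ 1 1 - γ 0 1 * γ 1 0) ^ 2 = 1 := by rcases det_pm γ with h | h <;> rw [h] <;> norm_num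
  exact_mod_cast this

lemma IV_acG (γ : G) (v : V) : IV (acG γ v) = IV v := by
  unfold acG
  rw [IV_act, show ∀ x : ℝ, x ^ 4 = (x ^ 2) ^ 2 by intro x; ring, det_sq]; ring

lemma JV_acG (γ : G) (v : V) : JV (acG γ v) = JV v := by
  unfold acG
  rw [JV_act, show ∀ x : ℝ, x ^ 6 = (x ^ 2) ^ 3 by intro x; ring, det_sq]; ring

lemma sig_acG (γ : G) (i : ℕ) (v : V) : sig i (acG γ v) ↔ sig i v := sig_act (det_sq γ) i v

/-- normalized coefficient vector -/
noncomputable def nv (s : ℝ) (f : BQF) : V := s⁻¹ • toV f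

lemma nv_smul (s : ℝ) (γ : G) (f : BQF) : nv s (γ • f) = acG γ (nv s f) := by
  unfold nv acG; rw [toV_smul, act5_smul]

lemma IV_nv {s : ℝ} (f : BQF) : IV (nv s f) = IR f / s ^ 2 := by
  unfold nv; rw [IV_smul, inv_pow, inv_mul_eq_div]; rfl

lemma JV_nv {s : ℝ} (f : BQF) : JV (nv s f) = JR f / s ^ 3 := by
  unfold nv; rw [JV_smul, inv_pow, inv_mul_eq_div]; rfl

lemma IR_smul (γ : G) (f : BQF) : IR (γ • f) = IR f := by
  change IV (toV (γ • f)) = IV (toV f)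
  rw [toV_smul]; exact IV_acG _ _

lemma JR_smul (γ : G) (f : BQF) : JR (γ • f) = JR f := by
  change JV (toV (γ • f)) = JV (toV f)
  rw [toV_smul]; exact JV_acG _ _

lemma wf_eq (Φ : V → ℝ) (C s : ℝ) (f : BQF) : wf Φ C s f = if |JR f| < C * s ^ 2 then Φ (nv s f) else 0 := by
  simp only [wf, w, nv, toV, JR, Prod.smul_mk, smul_eq_mul, inv_mul_eq_div]

noncomputable def ph (N κ : ℝ) (v : V) : ℝ := max 0 (N + 1 - ‖v‖) * max 0 (|v.1 * pV v| - κ / 2)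
noncomputable def Den (F : Finset G) (N κ : ℝ) (v : V) : ℝ := ∑ γ ∈ F, ph N κ (acG γ v)
noncomputable def Wt (F : Finset G) (N κ : ℝ) (v : V) : ℝ := ph N κ v / max (Den F N κ v / 2) (κ / 2)
noncomputable def c01 (x : ℝ) : ℝ := max 0 (min 1 x)
noncomputable def psi (δ δ2 : ℝ) (v : V) : ℝ := c01 ((|IV v| - δ) / δ) * c01 ((1 - |IV v|) / δ2) * c01 (2 - 2 * |JV v| / δ ^ 2)
noncomputable def Ph (i : ℕ) (F : Finset G) (N κ δ δ2 : ℝ) : V → ℝ := {v | sig i v}.indicator fun v => Wt F N κ v * psi δ δ2 v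

lemma c01_nn (x : ℝ) : 0 ≤ c01 x := le_max_left _ _
lemma c01_le (x : ℝ) : c01 x ≤ 1 := max_le zero_le_one (min_le_left _ _)
lemma c01_one {x : ℝ} (h : 1 ≤ x) : c01 x = 1 := by simp [c01, h]
lemma c01_pos {x : ℝ} (h : c01 x ≠ 0) : 0 < x := by
  by_contra hx
  push Not at hx
  exact h (max_eq_left ((min_le_right _ _).trans hx))
lemma c01_cont : Continuous c01 := by unfold c01; fun_prop
lemma psi_nn (δ δ2 : ℝ) (v : V) : 0 ≤ psi δ δ2 v := mul_nonneg (mul_nonneg (c01_nn _) (c01_nn _)) (c01_nn _)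
lemma psi_le (δ δ2 : ℝ) (v : V) : psi δ δ2 v ≤ 1 :=
  mul_le_one₀ (mul_le_one₀ (c01_le _) (c01_nn _) (c01_le _)) (c01_nn _) (c01_le _)
lemma ph_nn (N κ : ℝ) (v : V) : 0 ≤ ph N κ v := mul_nonneg (le_max_left _ _) (le_max_left _ _)
lemma ph_cont (N κ : ℝ) : Continuous (ph N κ) := by
  have := pV_cont
  unfold ph; fun_prop

lemma ph_supp {N κ : ℝ} {v : V} (h : ph N κ v ≠ 0) : ‖v‖ ≤ N + 1 ∧ κ / 2 ≤ |v.1 * pV v| := by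
  obtain ⟨h1, h2⟩ := mul_ne_zero_iff.mp h
  constructor
  · by_contra hc; push Not at hc; exact h1 (max_eq_left (by linarith))
  · by_contra hc; push Not at hc; exact h2 (max_eq_left (by linarith))

lemma ph_ge {N κ : ℝ} (hκ : 0 < κ) {v : V} (h1 : ‖v‖ ≤ N) (h2 : κ ≤ |v.1 * pV v|) : κ / 2 ≤ ph N κ v := by
  have e1 : 1 ≤ max 0 (N + 1 - ‖v‖) := le_max_of_le_right (by linarith)
  have e2 : κ / 2 ≤ max 0 (|v.1 * pV v| - κ / 2) := le_max_of_le_right (by linarith)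
  unfold ph; nlinarith

lemma Wt_nn (F : Finset G) {N κ : ℝ} (hκ : 0 < κ) (v : V) : 0 ≤ Wt F N κ v :=
  div_nonneg (ph_nn _ _ _) (le_max_of_le_right (by positivity))

lemma Wt_cont (F : Finset G) {N κ : ℝ} (hκ : 0 < κ) : Continuous (Wt F N κ) := by
  have h := ph_cont N κ
  have h2 : Continuous (Den F N κ) := continuous_finsetSum _ fun γ _ => h.comp (act5_cont _ _ _ _)
  unfold Wt
  refine h.div (by fun_prop) fun v => ?_
  have : 0 < max (Den F N κ v / 2) (κ / 2) := lt_max_of_lt_right (by positivity)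
  exact this.ne'

lemma psi_supp {δ δ2 : ℝ} (h0 : 0 < δ) (h1 : δ ≤ 1) (h2 : 0 < δ2) {v : V} (h : psi δ δ2 v ≠ 0) :
    δ < |IV v| ∧ |IV v| < 1 ∧ |JV v| < δ ^ 2 ∧ 3 * δ ^ 3 ≤ |Dl v| := by
  obtain ⟨h', h3⟩ := mul_ne_zero_iff.mp h
  obtain ⟨h4, h5⟩ := mul_ne_zero_iff.mp h'
  have a1 := c01_pos h3
  have a2 := (div_pos_iff_of_pos_right h0).mp (c01_pos h4)
  have a3 := (div_pos_iff_of_pos_right h2).mp (c01_pos h5)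
  have a4 : |JV v| < δ ^ 2 := by
    have : 2 * |JV v| / δ ^ 2 < 2 := by linarith
    rw [div_lt_iff₀ (by positivity)] at this; linarith
  refine ⟨by linarith, by linarith, a4, ?_⟩
  have b1 : δ ^ 3 ≤ |IV v| ^ 3 := pow_le_pow_left₀ h0.le (by linarith) 3
  have b2 : JV v ^ 2 ≤ δ ^ 4 := by
    rw [← sq_abs]; calc |JV v| ^ 2 ≤ (δ ^ 2) ^ 2 := pow_le_pow_left₀ (abs_nonneg _) a4.le 2
      _ = _ := by ring
  have b3 : δ ^ 4 ≤ δ ^ 3 := pow_le_pow_of_le_one h0.le h1 (by norm_num)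
  have b4 := abs_sub_abs_le_abs_sub (4 * IV v ^ 3) (JV v ^ 2)
  rw [abs_mul, abs_pow, abs_of_nonneg (sq_nonneg (JV v)), abs_of_pos (by norm_num : (0:ℝ) < 4)] at b4
  unfold Dl; linarith

lemma psi_cont (δ δ2 : ℝ) : Continuous (psi δ δ2) := by
  have h1 := IV_cont
  have h2 := JV_cont
  have h3 := c01_cont
  unfold psi
  exact ((h3.comp (by fun_prop)).mul (h3.comp (by fun_prop))).mul (h3.comp (by fun_prop))

lemma ph_bd {M κ : ℝ} (hM : 1 ≤ M) {v : V} (h1 : ‖v‖ ≤ M) (h2 : κ / 2 ≤ |v.1 * pV v|) :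
    κ / (22 * M ^ 2) ≤ |v.1| ∧ κ / (22 * M ^ 2) ≤ |pV v| := by
  obtain ⟨ha, hb, hc, -⟩ := norm_le_iff.mp h1
  have hp : |pV v| ≤ 11 * M ^ 2 := by
    have e1 : v.2.1 ^ 2 ≤ M ^ 2 := by rw [← sq_abs]; exact pow_le_pow_left₀ (abs_nonneg _) hb 2
    have e2 : |v.1 * v.2.2.1| ≤ M * M := by rw [abs_mul]; exact mul_le_mul ha hc (abs_nonneg _) (by linarith)
    unfold pV pf
    rw [abs_le] at e2 ⊢
    constructor <;> nlinarith [sq_nonneg v.2.1]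
  rw [abs_mul] at h2
  have h3 : |v.1| * |pV v| ≤ |v.1| * (11 * M ^ 2) := mul_le_mul_of_nonneg_left hp (abs_nonneg _)
  have h4 : |v.1| * |pV v| ≤ M * |pV v| := mul_le_mul_of_nonneg_right ha (abs_nonneg _)
  have h5 : M * |pV v| ≤ (11 * M ^ 2) * |pV v| := mul_le_mul_of_nonneg_right (by nlinarith) (abs_nonneg _)
  constructor <;> rw [div_le_iff₀ (by positivity)] <;> linarith

lemma Ph_nn (i : ℕ) (F : Finset G) {N κ : ℝ} (δ δ2 : ℝ) (hκ : 0 < κ) (v : V) : 0 ≤ Ph i F N κ δ δ2 v :=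
  Set.indicator_nonneg (fun v _ => mul_nonneg (Wt_nn F hκ v) (psi_nn _ _ v)) v

lemma Ph_ne {i : ℕ} {F : Finset G} {N κ δ δ2 : ℝ} {v : V} (h : Ph i F N κ δ δ2 v ≠ 0) :
    sig i v ∧ ph N κ v ≠ 0 ∧ psi δ δ2 v ≠ 0 := by
  have h1 : v ∈ {v | sig i v} := Set.mem_of_indicator_ne_zero h
  rw [Ph, Set.indicator_of_mem h1] at h
  obtain ⟨h2, h3⟩ := mul_ne_zero_iff.mp h
  exact ⟨h1, (div_ne_zero_iff.mp h2).1, h3⟩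

lemma Ph_le (i : ℕ) (F : Finset G) {N κ : ℝ} (δ δ2 : ℝ) (hκ : 0 < κ) (v : V) : Ph i F N κ δ δ2 v ≤ Wt F N κ v :=
  Set.indicator_apply_le' (fun _ => mul_le_of_le_one_right (Wt_nn F hκ v) (psi_le _ _ v)) fun _ => Wt_nn F hκ v

lemma Ph_tst (i : ℕ) (hi : i ≤ 2) (F : Finset G) {N κ δ δ2 : ℝ} (hN : 0 ≤ N) (hκ : 0 < κ) (h0 : 0 < δ) (h1 : δ ≤ 1) (h2 : 0 < δ2) :
    Tst (Ph i F N κ δ δ2) (N + 1) (min 1 (κ / (22 * (N + 1) ^ 2))) where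
  cont := by
    refine sig_cont i hi _ ((Wt_cont F hκ).mul (psi_cont _ _)) fun v hv => ?_
    by_contra h
    have := (psi_supp h0 h1 h2 (mul_ne_zero_iff.mp h).2).2.2.2
    rw [hv, abs_zero] at this
    have : 0 < δ ^ 3 := by positivity
    linarith
  M1 := by linarith
  κ0 := by positivity
  κ1 := min_le_left _ _
  bd := fun a b c d e h => norm_le_iff.mp (ph_supp (Ph_ne h).2.1).1
  ka := fun a b c d e h => (min_le_right _ _).trans
    (ph_bd (by linarith) (ph_supp (Ph_ne h).2.1).1 (ph_supp (Ph_ne h).2.1).2).1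
  kp := fun a b c d e h => (min_le_right _ _).trans
    (ph_bd (by linarith) (ph_supp (Ph_ne h).2.1).1 (ph_supp (Ph_ne h).2.1).2).2

end BQFC


namespace BQFC

lemma ne_neg (γ : G) : γ ≠ -γ := by
  intro h
  have h' : ∀ i j, γ i j = 0 := by
    intro i j
    have h1 : (γ : Matrix (Fin 2) (Fin 2) ℤ) i j = (-γ : G) i j := by rw [← h]
    have h2 : (-γ : G) i j = -(γ i j) := by simp [Units.val_neg]
    omega
  have := det_pm γ
  simp [h'] at this

lemma Wt_upper (F : Finset G) (hF : ∀ γ ∈ F, -γ ∈ F) {N κ : ℝ} (s : ℝ) (H : Finset BQF)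
    (hH : ∀ g ∈ H, ∀ h ∈ H, ∃ γ ∈ F, γ • g = h) : ∑ g ∈ H, Wt F N κ (nv s g) ≤ 1 := by
  classical
  choose! k hk1 hk2 using hH
  set A := ∑ h ∈ H, ph N κ (nv s h) with hA
  have hA0 : 0 ≤ A := Finset.sum_nonneg fun _ _ => ph_nn _ _ _
  have hden : ∀ g ∈ H, A ≤ Den F N κ (nv s g) / 2 := by
    intro g hg
    have hinj : ∀ h ∈ H, ∀ h' ∈ H, k g h = k g h' → h = h' := by
      intro h hh h' hh' e
      rw [← hk2 g hg h hh, ← hk2 g hg h' hh', e]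
    have hd : Disjoint (H.image (k g)) (H.image fun h => -(k g h)) := by
      rw [Finset.disjoint_left]
      intro γ h1 h2
      obtain ⟨h, hh, rfl⟩ := Finset.mem_image.mp h1
      obtain ⟨h', hh', e⟩ := Finset.mem_image.mp h2
      have : h = h' := by
        rw [← hk2 g hg h hh, ← hk2 g hg h' hh', ← e, neg_smul']
      subst this
      exact ne_neg _ e.symm
    have e1 : ∑ γ ∈ H.image (k g), ph N κ (acG γ (nv s g)) = A := by
      rw [Finset.sum_image hinj]
      refine Finset.sum_congr rfl fun h hh => ?_
      rw [← nv_smul, hk2 g hg h hh]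
    have e2 : ∑ γ ∈ H.image (fun h => -(k g h)), ph N κ (acG γ (nv s g)) = A := by
      rw [Finset.sum_image fun h hh h' hh' e => hinj h hh h' hh' (neg_injective e)]
      refine Finset.sum_congr rfl fun h hh => ?_
      rw [← nv_smul, neg_smul', hk2 g hg h hh]
    have e3 : ∑ γ ∈ H.image (k g) ∪ H.image (fun h => -(k g h)), ph N κ (acG γ (nv s g)) ≤ Den F N κ (nv s g) := by
      refine Finset.sum_le_sum_of_subset_of_nonneg ?_ fun _ _ _ => ph_nn _ _ _
      intro γ hγ
      rcases Finset.mem_union.mp hγ with h1 | h1 <;> obtain ⟨h, hh, rfl⟩ := Finset.mem_image.mp h1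
      · exact hk1 g hg h hh
      · exact hF _ (hk1 g hg h hh)
    rw [Finset.sum_union hd, e1, e2] at e3
    linarith
  rcases hA0.eq_or_lt with h0 | h0
  · have := (Finset.sum_eq_zero_iff_of_nonneg fun h _ => ph_nn N κ (nv s h)).mp h0.symm
    rw [Finset.sum_eq_zero fun g hg => by unfold Wt; rw [this g hg, zero_div]]
    exact zero_le_one
  · calc _ ≤ ∑ g ∈ H, ph N κ (nv s g) / A := by
          refine Finset.sum_le_sum fun g hg => ?_
          exact div_le_div_of_nonneg_left (ph_nn _ _ _) h0 (le_max_of_le_left (hden g hg))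
      _ = 1 := by rw [← Finset.sum_div, ← hA, div_self h0.ne']

lemma Wt_lower (F : Finset G) {N κ : ℝ} (hκ : 0 < κ) (s : ℝ) (H : Finset BQF)
    (hs : ∀ g ∈ H, ∀ γ : G, γ • g = g → γ = 1 ∨ γ = -1)
    (hH : ∀ g ∈ H, ∀ γ ∈ F, ph N κ (nv s (γ • g)) ≠ 0 → γ • g ∈ H)
    (hc : ∃ h ∈ H, κ / 2 ≤ ph N κ (nv s h)) : 1 ≤ ∑ g ∈ H, Wt F N κ (nv s g) := by
  classical
  set A := ∑ h ∈ H, ph N κ (nv s h) with hA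
  have hAc : κ / 2 ≤ A := by
    obtain ⟨h, hh, h1⟩ := hc
    exact h1.trans (Finset.single_le_sum (f := fun h => ph N κ (nv s h)) (fun h _ => ph_nn N κ (nv s h)) hh)
  have h0 : 0 < A := by linarith
  have hden : ∀ g ∈ H, Den F N κ (nv s g) / 2 ≤ A := by
    intro g hg
    have e1 : Den F N κ (nv s g) = ∑ γ ∈ F.filter (fun γ => γ • g ∈ H), ph N κ (nv s (γ • g)) := by
      rw [Finset.sum_filter_of_ne fun γ hγ hne => hH g hg γ hγ hne]
      exact Finset.sum_congr rfl fun γ _ => by rw [nv_smul]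
    have e2 : ∑ γ ∈ F.filter (fun γ => γ • g ∈ H), ph N κ (nv s (γ • g)) =
        ∑ h ∈ H, ∑ γ ∈ (F.filter (fun γ => γ • g ∈ H)).filter (fun γ => γ • g = h), ph N κ (nv s (γ • g)) :=
      (Finset.sum_fiberwise_of_maps_to (fun γ hγ => (Finset.mem_filter.mp hγ).2) _).symm
    have e3 : ∀ h ∈ H, ∑ γ ∈ (F.filter (fun γ => γ • g ∈ H)).filter (fun γ => γ • g = h), ph N κ (nv s (γ • g)) ≤ 2 * ph N κ (nv s h) := by
      intro h _
      rw [Finset.sum_congr rfl fun γ hγ => by rw [(Finset.mem_filter.mp hγ).2], Finset.sum_const, nsmul_eq_mul]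
      refine mul_le_mul_of_nonneg_right ?_ (ph_nn _ _ _)
      by_cases hne : ((F.filter (fun γ => γ • g ∈ H)).filter (fun γ => γ • g = h)).Nonempty
      · obtain ⟨γ0, hγ0⟩ := hne
        have hγ0 := (Finset.mem_filter.mp hγ0).2
        have hsub : (F.filter (fun γ => γ • g ∈ H)).filter (fun γ => γ • g = h) ⊆ {γ0, -γ0} := by
          intro γ hγ
          have hγ := (Finset.mem_filter.mp hγ).2
          have : (γ0⁻¹ * γ) • g = g := by rw [mul_smul, hγ, ← hγ0, inv_smul_smul]
          rw [Finset.mem_insert, Finset.mem_singleton]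
          rcases hs g hg _ this with h1 | h1
          · left; rw [inv_mul_eq_one] at h1; exact h1.symm
          · right; rw [inv_mul_eq_iff_eq_mul] at h1; rw [h1, mul_neg, mul_one]
        have := (Finset.card_le_card hsub).trans Finset.card_le_two
        exact_mod_cast this
      · rw [Finset.not_nonempty_iff_eq_empty.mp hne]; simp
    have := Finset.sum_le_sum e3
    rw [← e2, ← e1, ← Finset.mul_sum] at this
    linarith
  calc 1 = ∑ g ∈ H, ph N κ (nv s g) / A := by rw [← Finset.sum_div, ← hA, div_self h0.ne']
    _ ≤ _ := by
      refine Finset.sum_le_sum fun g hg => ?_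
      exact div_le_div_of_nonneg_left (ph_nn _ _ _) (lt_max_of_lt_right (by positivity)) (max_le (hden g hg) hAc)

lemma classCount_eq (P : BQF → Prop) : classCount P = (MulAction.orbit G '' {f | P f}).ncard := by
  unfold classCount
  rw [← Nat.card_coe_set_eq]
  have hl : ∀ f g : {h // P h}, BQF.Equivalent f.1 g.1 → MulAction.orbit G f.1 = MulAction.orbit G g.1 := by
    intro f g h
    obtain ⟨γ, h⟩ := equiv_iff.mp h
    rw [← h, MulAction.orbit_smul]
  have hinj : Function.Injective (Quot.lift (fun f : {h // P h} => MulAction.orbit G f.1) hl) := by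
    rintro ⟨f⟩ ⟨g⟩ h
    refine Quot.sound (equiv_iff.mpr ?_)
    have h : MulAction.orbit G f.1 = MulAction.orbit G g.1 := h
    have := MulAction.orbit_eq_iff.mp h.symm
    exact this
  rw [Nat.card_congr (Equiv.ofInjective _ hinj)]
  congr 2
  ext o
  constructor
  · rintro ⟨⟨f⟩, rfl⟩; exact ⟨f.1, f.2, rfl⟩
  · rintro ⟨f, hf, rfl⟩; exact ⟨Quot.mk _ ⟨f, hf⟩, rfl⟩

end BQFC


namespace BQFC

lemma wf_ne {i : ℕ} {F : Finset G} {N κ δ δ2 C s : ℝ} {f : BQF} (h : wf (Ph i F N κ δ δ2) C s f ≠ 0) :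
    |JR f| < C * s ^ 2 ∧ sig i (nv s f) ∧ ph N κ (nv s f) ≠ 0 ∧ psi δ δ2 (nv s f) ≠ 0 := by
  rw [wf_eq] at h
  split_ifs at h with h1
  · exact ⟨h1, Ph_ne h⟩
  · exact absurd rfl h

lemma wf_nn {i : ℕ} {F : Finset G} {N κ δ δ2 : ℝ} (hκ : 0 < κ) (C s : ℝ) (f : BQF) : 0 ≤ wf (Ph i F N κ δ δ2) C s f := by
  rw [wf_eq]
  split_ifs
  · exact Ph_nn _ _ _ _ hκ _
  · exact le_rfl

lemma wf_le {i : ℕ} {F : Finset G} {N κ δ δ2 : ℝ} (hκ : 0 < κ) (C s : ℝ) (f : BQF) : wf (Ph i F N κ δ δ2) C s f ≤ Wt F N κ (nv s f) := by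
  rw [wf_eq]
  split_ifs
  · exact Ph_le _ _ _ _ hκ _
  · exact Wt_nn F hκ _

lemma upper {i : ℕ} (hi : i ≤ 2) {F : Finset G} (hF : ∀ γ ∈ F, -γ ∈ F) {N κ δ δ2 : ℝ} (hN : 0 ≤ N) (hκ : 0 < κ) (h0 : 0 < δ)
    (h1 : δ ≤ 1) (h2 : 0 < δ2) (hFp : ∀ v : V, ‖v‖ ≤ N + 1 → 3 * δ ^ 3 ≤ |Dl v| → ∀ γ : G, ‖acG γ v‖ ≤ N + 1 → γ ∈ F)
    {C s : ℝ} (hs : 0 < s) (S : Set BQF) (P : BQF → Prop)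
    (hP : ∀ f ∈ S, f.Irred → wf (Ph i F N κ δ δ2) C s f ≠ 0 → P f) (hfin : (MulAction.orbit G '' {f | P f}).Finite) :
    T (Ph i F N κ δ δ2) C s S ≤ (MulAction.orbit G '' {f | P f}).ncard + T (Ph i F N κ δ δ2) C s {f | ¬ f.Irred} := by
  classical
  obtain ⟨L, hL⟩ := exists_nat_ge ((N + 1) * s)
  have ht := Ph_tst i hi F hN hκ h0 h1 h2
  rw [T_eq ht hs hL, T_eq ht hs hL]
  set B := box (Finset.Icc (-(L:ℤ)) L)
  set w0 := wf (Ph i F N κ δ δ2) C s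
  set Y := B.filter fun f => f ∈ S ∧ f.Irred ∧ w0 f ≠ 0 with hY
  have e1 : ∑ f ∈ B, (if f ∈ S then w0 f else 0) ≤ ∑ f ∈ Y, w0 f + ∑ f ∈ B, (if f ∈ {f : BQF | ¬ f.Irred} then w0 f else 0) := by
    rw [hY, Finset.sum_filter, ← Finset.sum_add_distrib]
    refine Finset.sum_le_sum fun f _ => ?_
    have := wf_nn (i := i) (F := F) (N := N) (δ := δ) (δ2 := δ2) hκ C s f
    change 0 ≤ w0 f at this
    simp only [Set.mem_ofPred_eq]
    by_cases c1 : f ∈ S <;> by_cases c2 : f.Irred <;> by_cases c3 : w0 f = 0 <;> simp [c1, c2, c3, this]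
  refine e1.trans (add_le_add ?_ (Finset.sum_congr rfl fun f _ => by congr).le)
  rw [← Finset.sum_fiberwise_of_maps_to (t := Y.image (MulAction.orbit G)) (g := MulAction.orbit G) fun f hf => Finset.mem_image_of_mem _ hf]
  have e2 : ∀ o ∈ Y.image (MulAction.orbit G), ∑ f ∈ Y.filter (fun f => MulAction.orbit G f = o), w0 f ≤ 1 := by
    intro o _
    refine (Finset.sum_le_sum fun f _ => wf_le hκ C s f).trans (Wt_upper F hF s _ fun g hg h hh => ?_)
    obtain ⟨g1, g2⟩ := Finset.mem_filter.mp hg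
    obtain ⟨k1, k2⟩ := Finset.mem_filter.mp hh
    obtain ⟨γ, hγ⟩ := MulAction.orbit_eq_iff.mp (k2.trans g2.symm)
    have hγ : γ • g = h := hγ
    refine ⟨γ, ?_, hγ⟩
    obtain ⟨-, -, n1, n2⟩ := wf_ne (Finset.mem_filter.mp g1).2.2.2
    obtain ⟨-, -, n3, -⟩ := wf_ne (Finset.mem_filter.mp k1).2.2.2
    refine hFp _ (ph_supp n1).1 (psi_supp h0 h1 h2 n2).2.2.2 γ ?_
    rw [← nv_smul, hγ]; exact (ph_supp n3).1
  refine (Finset.sum_le_card_nsmul _ _ 1 e2).trans ?_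
  rw [nsmul_one, ← Set.ncard_coe_finset]
  refine Nat.cast_le.mpr (Set.ncard_le_ncard ?_ hfin)
  intro o ho
  obtain ⟨f, hf, rfl⟩ := Finset.mem_image.mp (Finset.mem_coe.mp ho)
  have := (Finset.mem_filter.mp hf).2
  exact ⟨f, hP f this.1 this.2.1 this.2.2, rfl⟩

lemma wf_good {i : ℕ} {F : Finset G} {N κ δ δ2 C s : ℝ} {f : BQF} (h1 : |JR f| < C * s ^ 2) (h2 : sig i (nv s f))
    (h3 : psi δ δ2 (nv s f) = 1) (γ : G) : wf (Ph i F N κ δ δ2) C s (γ • f) = Wt F N κ (nv s (γ • f)) := by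
  rw [wf_eq, JR_smul, if_pos h1, Ph, Set.indicator_of_mem]
  · have : psi δ δ2 (nv s (γ • f)) = psi δ δ2 (nv s f) := by unfold psi; rw [nv_smul, IV_acG, JV_acG]
    rw [this, h3, mul_one]
  · change sig i _
    rw [nv_smul, sig_acG]; exact h2

lemma lower {i : ℕ} (hi : i ≤ 2) {F : Finset G} {N κ δ δ2 : ℝ} (hN : 0 ≤ N) (hκ : 0 < κ) (h0 : 0 < δ)
    (h1 : δ ≤ 1) (h2 : 0 < δ2) {C s : ℝ} (hs : 0 < s) (S : Set BQF) (hS : ∀ γ : G, ∀ f ∈ S, γ • f ∈ S) (P : BQF → Prop)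
    (hP : ∀ f, P f → f ∈ S) (Bad : Set BQF) (hB : Bad.Finite)
    (hg : ∀ f, P f → (∃ γ : G, γ • f ∈ Bad) ∨ ((∃ γ : G, κ / 2 ≤ ph N κ (nv s (γ • f))) ∧ psi δ δ2 (nv s f) = 1 ∧
      sig i (nv s f) ∧ |JR f| < C * s ^ 2 ∧ ∀ γ : G, ph N κ (nv s (γ • f)) ≠ 0 → ∀ γ' : G, γ' • γ • f = γ • f → γ' = 1 ∨ γ' = -1)) :
    (MulAction.orbit G '' {f | P f}).Finite ∧
      ((MulAction.orbit G '' {f | P f}).ncard : ℝ) ≤ T (Ph i F N κ δ δ2) C s S + Bad.ncard := by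
  classical
  obtain ⟨L, hL⟩ := exists_nat_ge ((N + 1) * s)
  have ht := Ph_tst i hi F hN hκ h0 h1 h2
  rw [T_eq ht hs hL]
  set B := box (Finset.Icc (-(L:ℤ)) L) with hBx
  set w0 := wf (Ph i F N κ δ δ2) C s with hw0
  have hw0n : ∀ f, 0 ≤ w0 f := fun f => wf_nn hκ C s f
  set Y := B.filter fun f => f ∈ S ∧ w0 f ≠ 0 with hY
  set Z := (Y.image (MulAction.orbit G)).filter fun o => 1 ≤ ∑ f ∈ Y.filter (fun f => MulAction.orbit G f = o), w0 f with hZ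
  have hsub : MulAction.orbit G '' {f | P f} ⊆ (Z : Set (Set BQF)) ∪ MulAction.orbit G '' Bad := by
    rintro _ ⟨f, hf, rfl⟩
    rcases hg f hf with ⟨γ, hγ⟩ | ⟨⟨γ0, g0⟩, g1, g2, g3, g4⟩
    · exact Or.inr ⟨_, hγ, MulAction.orbit_smul _ _⟩
    left
    have hmemY : ∀ γ : G, ph N κ (nv s (γ • f)) ≠ 0 → γ • f ∈ Y := by
      intro γ hγ
      have hne : w0 (γ • f) ≠ 0 := by
        rw [hw0, wf_good g3 g2 g1, Wt]
        refine div_ne_zero hγ (lt_max_of_lt_right (by positivity)).ne'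
      refine Finset.mem_filter.mpr ⟨?_, hS γ f (hP f hf), hne⟩
      by_contra hb
      exact hne (wf_box ht hs hL hb)
    have hpos : ph N κ (nv s (γ0 • f)) ≠ 0 := by
      have : 0 < ph N κ (nv s (γ0 • f)) := by linarith
      exact this.ne'
    refine Finset.mem_coe.mpr (Finset.mem_filter.mpr ⟨?_, ?_⟩)
    · rw [← MulAction.orbit_smul γ0 f]; exact Finset.mem_image_of_mem _ (hmemY _ hpos)
    · have hrep : ∀ g ∈ Y.filter (fun g => MulAction.orbit G g = MulAction.orbit G f), ∃ γ : G, γ • f = g := by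
        intro g hg'
        exact MulAction.orbit_eq_iff.mp (Finset.mem_filter.mp hg').2
      have e : ∑ g ∈ Y.filter (fun g => MulAction.orbit G g = MulAction.orbit G f), w0 g =
          ∑ g ∈ Y.filter (fun g => MulAction.orbit G g = MulAction.orbit G f), Wt F N κ (nv s g) := by
        refine Finset.sum_congr rfl fun g hg' => ?_
        obtain ⟨γ, rfl⟩ := hrep g hg'
        exact wf_good g3 g2 g1 γ
      rw [e]
      refine Wt_lower F hκ s _ ?_ ?_ ⟨γ0 • f, ?_, g0⟩
      · intro g hg' γ' hγ'
        obtain ⟨γ, rfl⟩ := hrep g hg'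
        exact g4 γ (wf_ne (Finset.mem_filter.mp (Finset.mem_filter.mp hg').1).2.2).2.2.1 γ' hγ'
      · intro g hg' γ' _ hne
        obtain ⟨γ, rfl⟩ := hrep g hg'
        rw [smul_smul] at hne ⊢
        exact Finset.mem_filter.mpr ⟨hmemY _ hne, MulAction.orbit_smul _ _⟩
      · exact Finset.mem_filter.mpr ⟨hmemY _ hpos, MulAction.orbit_smul _ _⟩
  have hfu : ((Z : Set (Set BQF)) ∪ MulAction.orbit G '' Bad).Finite := Z.finite_toSet.union (hB.image _)
  refine ⟨hfu.subset hsub, ?_⟩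
  have c1 : (MulAction.orbit G '' {f | P f}).ncard ≤ Z.card + Bad.ncard := by
    refine (Set.ncard_le_ncard hsub hfu).trans ((Set.ncard_union_le _ _).trans ?_)
    rw [Set.ncard_coe_finset]
    exact Nat.add_le_add_left (Set.ncard_image_le hB) _
  have c2 : (Z.card : ℝ) ≤ ∑ f ∈ B, (if f ∈ S then w0 f else 0) := by
    calc (Z.card : ℝ) = ∑ o ∈ Z, (1:ℝ) := by simp
      _ ≤ ∑ o ∈ Z, ∑ f ∈ Y.filter (fun f => MulAction.orbit G f = o), w0 f :=
        Finset.sum_le_sum fun o ho => (Finset.mem_filter.mp ho).2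
      _ ≤ ∑ o ∈ Y.image (MulAction.orbit G), ∑ f ∈ Y.filter (fun f => MulAction.orbit G f = o), w0 f :=
        Finset.sum_le_sum_of_subset_of_nonneg (Finset.filter_subset _ _) fun _ _ _ => Finset.sum_nonneg fun f _ => hw0n f
      _ = ∑ f ∈ Y, w0 f := Finset.sum_fiberwise_of_maps_to (fun f hf => Finset.mem_image_of_mem _ hf) _
      _ ≤ _ := by
        rw [hY, Finset.sum_filter]
        refine Finset.sum_le_sum fun f _ => ?_
        by_cases k1 : f ∈ S <;> by_cases k2 : w0 f = 0 <;> simp [k1, k2]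
  have c1' : ((MulAction.orbit G '' {f | P f}).ncard : ℝ) ≤ Z.card + Bad.ncard := by exact_mod_cast c1
  linarith

end BQFC


namespace BQFC

open Polynomial in
lemma irred_ne {f : BQF} (hf : f.Irred) {x y : ℤ} (h : x ≠ 0 ∨ y ≠ 0) : f.evalZ x y ≠ 0 := by
  intro h0
  by_cases hy : y = 0
  · subst hy
    have hx : x ≠ 0 := by simpa using h
    simp only [BQF.evalZ] at h0
    have : f.a * x ^ 4 = 0 := by linarith
    exact hf.1 ((mul_eq_zero.mp this).resolve_right (pow_ne_zero _ hx))
  · have hy' : (y:ℚ) ≠ 0 := by exact_mod_cast hy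
    have hr : IsRoot (C (f.a : ℚ) * X ^ 4 + C (f.b : ℚ) * X ^ 3 + C (f.c : ℚ) * X ^ 2 + C (f.d : ℚ) * X + C (f.e : ℚ)) ((x:ℚ) / y) := by
      have h0' : (f.a:ℚ) * x ^ 4 + f.b * x ^ 3 * y + f.c * x ^ 2 * y ^ 2 + f.d * x * y ^ 3 + f.e * y ^ 4 = 0 := by exact_mod_cast h0
      simp only [IsRoot, eval_add, eval_mul, eval_pow, eval_C, eval_X]
      field_simp
      linarith
    have hd := degree_eq_one_of_irreducible_of_root hf.2 hr
    have ha : (f.a : ℚ) ≠ 0 := by exact_mod_cast hf.1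
    have : (C (f.a : ℚ) * X ^ 4 + C (f.b : ℚ) * X ^ 3 + C (f.c : ℚ) * X ^ 2 + C (f.d : ℚ) * X + C (f.e : ℚ)).degree = 4 := by
      compute_degree!
      exact hf.1
    rw [this] at hd
    norm_num at hd

lemma irred_a {f : BQF} (hf : f.Irred) (γ : G) : (γ • f).a ≠ 0 := by
  have h := eval_smul γ f 1 0
  have h1 : (γ • f).evalZ 1 0 = (γ • f).a := by simp [BQF.evalZ]
  rw [← h1, h]
  apply irred_ne hf
  by_contra hc
  push Not at hc
  have := det_pm γ
  simp only [one_mul, zero_mul, add_zero] at hc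
  simp [hc.1, hc.2] at this

lemma to_cus {C M s η : ℝ} (hs : 0 < s) (hη : η ≤ 1) {g : BQF} (h0 : g.a ≠ 0) (h1 : |(g.a:ℝ)| ≤ η * s) (h2 : |pR g| ≤ M * s ^ 2)
    (h3 : |IR g| ≤ s ^ 2) (h4 : |JR g| ≤ C * s ^ 2) : ∃ γ : G, γ • g ∈ {f ∈ Cus C M s | |(f.a:ℝ)| ≤ η * s} := by
  have ha : (g.a:ℝ) ≠ 0 := by exact_mod_cast h0
  set n := -round ((g.b:ℝ) / (4 * g.a)) with hn
  have e := toV_gm 1 0 n 1 (by ring) g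
  have ea : ((gm 1 0 n 1 (by ring) • g).a : ℝ) = g.a := by
    have := congrArg (fun v : V => v.1) e
    simpa [toV, act5] using this
  have eb : ((gm 1 0 n 1 (by ring) • g).b : ℝ) = g.b + 4 * g.a * n := by
    have := congrArg (fun v : V => v.2.1) e
    simp only [toV, act5] at this
    rw [this]; push_cast; ring
  have ep : pR (gm 1 0 n 1 (by ring) • g) = pR g := by
    have := congrArg pV e
    change pR (gm 1 0 n 1 (by ring) • g) = _ at this
    rw [this]
    simp only [pV, pR, pf, toV, act5]; push_cast; ring
  refine ⟨gm 1 0 n 1 (by ring), ⟨?_, ?_, ?_, ?_, ?_, ?_⟩, ?_⟩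
  · intro h; rw [h] at ea; exact ha (by simpa using ea.symm)
  · rw [ea]; nlinarith
  · have hr := abs_sub_round ((g.b:ℝ) / (4 * g.a))
    have : |((gm 1 0 n 1 (by ring) • g).b : ℝ)| ≤ 2 * |((gm 1 0 n 1 (by ring) • g).a : ℝ)| := by
      rw [ea, eb]
      have : (g.b:ℝ) + 4 * g.a * n = (4 * g.a) * (g.b / (4 * g.a) - round ((g.b:ℝ) / (4 * g.a))) := by
        rw [hn]; push_cast; field_simp; ring
      rw [this, abs_mul, abs_mul, abs_of_pos (by norm_num : (0:ℝ) < 4)]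
      nlinarith [abs_nonneg (g.a:ℝ)]
    exact_mod_cast this
  · rw [ep]; exact h2
  · rw [IR_smul]; exact h3
  · rw [JR_smul]; exact h4
  · rw [ea]; exact h1

lemma Dl_acG (γ : G) (v : V) : Dl (acG γ v) = Dl v := by unfold Dl; rw [IV_acG, JV_acG]

lemma nv_bd {s M : ℝ} (hs : 0 < s) {f : BQF} : ‖nv s f‖ ≤ M ↔
    |(f.a:ℝ)| ≤ M * s ∧ |(f.b:ℝ)| ≤ M * s ∧ |(f.c:ℝ)| ≤ M * s ∧ |(f.d:ℝ)| ≤ M * s ∧ |(f.e:ℝ)| ≤ M * s := by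
  rw [norm_le_iff]
  simp only [nv, toV, Prod.smul_mk, smul_eq_mul, inv_mul_eq_div, abs_div, abs_of_pos hs, div_le_iff₀ hs]

/-- thin shell -/
def Thn (C M κ s δ I0 : ℝ) : Set BQF := {f | |(f.a:ℝ)| ≤ M * s ∧ |(f.b:ℝ)| ≤ M * s ∧ |(f.c:ℝ)| ≤ M * s ∧ κ * s ≤ |(f.a:ℝ)| ∧
      κ * s ^ 2 ≤ |pR f| ∧ |JR f| ≤ C * s ^ 2 ∧ |IR f - I0| ≤ δ * s ^ 2}

/-- forms with a given nontrivial automorphism -/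
def Sta (M s : ℝ) (γ : G) : Set BQF := {f | γ • f = f ∧ |(f.a:ℝ)| ≤ M * s ∧ |(f.b:ℝ)| ≤ M * s ∧ |(f.c:ℝ)| ≤ M * s ∧ |(f.d:ℝ)| ≤ M * s ∧ |(f.e:ℝ)| ≤ M * s}

/-- the bad forms -/
def Badd (F : Finset G) (C M1 η N κ δ2 s : ℝ) : Set BQF :=
  {f ∈ Cus C M1 s | |(f.a:ℝ)| ≤ η * s} ∪ (Thn C (N + 1) (κ / (22 * (N + 1) ^ 2)) s δ2 (s ^ 2) ∪
    Thn C (N + 1) (κ / (22 * (N + 1) ^ 2)) s δ2 (-s ^ 2)) ∪ ⋃ γ ∈ {γ ∈ F | γ ≠ 1 ∧ γ ≠ -1}, Sta (N + 1) s γ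

lemma thn_mem {C N κ s δ2 : ℝ} (hN : 0 ≤ N) (hs : 0 < s) {f : BQF} (h1 : ‖nv s f‖ ≤ N) (h2 : κ / 2 ≤ |(nv s f).1 * pV (nv s f)|)
    (h3 : |JR f| ≤ C * s ^ 2) (h4 : |IR f| ≤ s ^ 2) (h5 : (1 - δ2) * s ^ 2 ≤ |IR f|) :
    f ∈ Thn C (N + 1) (κ / (22 * (N + 1) ^ 2)) s δ2 (s ^ 2) ∪ Thn C (N + 1) (κ / (22 * (N + 1) ^ 2)) s δ2 (-s ^ 2) := by
  have h1' : ‖nv s f‖ ≤ N + 1 := by linarith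
  obtain ⟨a1, a2, a3, -⟩ := (nv_bd hs).mp h1'
  obtain ⟨b1, b2⟩ := ph_bd (by linarith) h1' h2
  have e1 : |(nv s f).1| = |(f.a:ℝ)| / s := by simp [nv, toV, inv_mul_eq_div, abs_div, abs_of_pos hs]
  have e2 : |pV (nv s f)| = |pR f| / s ^ 2 := by
    have : pV (nv s f) = pR f / s ^ 2 := by
      rw [pR, ← pf_scale _ _ _ _ hs.ne']
      simp only [nv, toV, pV, Prod.smul_mk, smul_eq_mul, inv_mul_eq_div]
    rw [this, abs_div, abs_of_pos (by positivity : 0 < s ^ 2)]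
  rw [e1, le_div_iff₀ hs] at b1
  rw [e2, le_div_iff₀ (by positivity)] at b2
  rcases le_total 0 (IR f) with h | h
  · rw [abs_of_nonneg h] at h4 h5
    exact Or.inl ⟨a1, a2, a3, b1, b2, h3, by rw [abs_le]; constructor <;> linarith⟩
  · rw [abs_of_nonpos h] at h4 h5
    exact Or.inr ⟨a1, a2, a3, b1, b2, h3, by rw [abs_le]; constructor <;> linarith⟩

lemma psi_one {δ δ2 s C : ℝ} (hδ : 0 < δ) (h2 : 0 < δ2) (hs : 0 < s) {f : BQF} (hI1 : 2 * δ * s ^ 2 < |IR f|)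
    (hI2 : |IR f| < (1 - δ2) * s ^ 2) (hJ : |JR f| < C * s ^ 2) (hsC : 2 * C ≤ δ ^ 2 * s) : psi δ δ2 (nv s f) = 1 := by
  have hI : |IV (nv s f)| = |IR f| / s ^ 2 := by rw [IV_nv, abs_div, abs_of_pos (by positivity : 0 < s ^ 2)]
  have hJ' : |JV (nv s f)| = |JR f| / s ^ 3 := by rw [JV_nv, abs_div, abs_of_pos (by positivity : 0 < s ^ 3)]
  have a1 : 2 * δ ≤ |IR f| / s ^ 2 := by rw [le_div_iff₀ (by positivity)]; exact hI1.le
  have a2 : |IR f| / s ^ 2 ≤ 1 - δ2 := by rw [div_le_iff₀ (by positivity)]; exact hI2.le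
  have a3 : |JR f| / s ^ 3 ≤ δ ^ 2 / 2 := by
    rw [div_le_iff₀ (by positivity)]
    linarith [mul_le_mul_of_nonneg_right hsC (sq_nonneg s)]
  unfold psi
  rw [hI, hJ', c01_one, c01_one, c01_one]
  · norm_num
  · have : 2 * (|JR f| / s ^ 3) / δ ^ 2 ≤ 1 := by rw [div_le_iff₀ (by positivity)]; linarith
    linarith
  · rw [le_div_iff₀ h2]; linarith
  · rw [le_div_iff₀ hδ]; linarith

lemma analysis {M1 : ℝ} (hM1 : 1 ≤ M1) (hred : ∀ (f : BQF) (s : ℝ), 0 < s → |IR f| ≤ s ^ 2 → |JR f| ≤ s ^ 3 →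
    ∃ γ : G, ∃ θ : ℝ, 0 < θ ∧ θ ≤ 2 ∧ |((γ • f).a : ℝ)| ≤ M1 * s * θ ^ 2 ∧ |pR (γ • f)| ≤ M1 * s ^ 2 ∧
      ‖toV (γ • f)‖ ≤ M1 * s / θ ^ 2) {C η δ κ δ2 s N : ℝ} (hη : 0 < η) (hη1 : η ≤ 1) (hδ : 0 < δ) (hδ1 : 2 * δ ≤ 1)
    (hδη : 4 * M1 * √(2 * δ) ≤ η) (hκ : 0 < κ) (hN : N = 20480 * (M1 ^ 2 / η))
    (hsh : ∀ v : V, ‖v‖ ≤ M1 ^ 2 / η → δ ≤ |IV v| → ∃ n : ℕ, n ≤ 8 ∧ κ ≤ |(act5 1 (n:ℝ) 0 1 v).1 * pV (act5 1 (n:ℝ) 0 1 v)|)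
    (h2 : 0 < δ2) {F : Finset G} (hFp : ∀ v : V, ‖v‖ ≤ N + 1 → 3 * δ ^ 3 ≤ |Dl v| → ∀ γ : G, ‖acG γ v‖ ≤ N + 1 → γ ∈ F)
    (hs : 1 ≤ s) (hs1 : C ≤ √(2 * δ) ^ 3 * s) (hs2 : 2 * C ≤ δ ^ 2 * s) {i : ℕ} (hi : i ≤ 2)
    {f : BQF} (hf : f.Irred) (hr : f.realRoots.ncard = 4 - 2 * i) (hI : |IR f| < s ^ 2) (hJ : |JR f| < C * s ^ 2) :
    (∃ γ : G, γ • f ∈ Badd F C M1 η N κ δ2 s) ∨ ((∃ γ : G, κ / 2 ≤ ph N κ (nv s (γ • f))) ∧ psi δ δ2 (nv s f) = 1 ∧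
      sig i (nv s f) ∧ |JR f| < C * s ^ 2 ∧ ∀ γ : G, ph N κ (nv s (γ • f)) ≠ 0 → ∀ γ' : G, γ' • γ • f = γ • f → γ' = 1 ∨ γ' = -1) := by
  have hs0 : 0 < s := by linarith
  have hcus : ∀ γ : G, |((γ • f).a:ℝ)| ≤ η * s → |pR (γ • f)| ≤ M1 * s ^ 2 → ∃ γ : G, γ • f ∈ Badd F C M1 η N κ δ2 s := by
    intro γ ha hp
    obtain ⟨γ', hγ'⟩ := to_cus (C := C) hs0 hη1 (irred_a hf γ) ha hp (by rw [IR_smul]; exact hI.le) (by rw [JR_smul]; exact hJ.le)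
    exact ⟨γ' * γ, by rw [mul_smul]; exact Or.inl (Or.inl hγ')⟩
  have hq0 : 0 < √(2 * δ) := Real.sqrt_pos.mpr (by positivity)
  have hq2 : √(2 * δ) ^ 2 = 2 * δ := Real.sq_sqrt (by positivity)
  have hq1 : √(2 * δ) ≤ 1 := Real.sqrt_le_one.mpr (by linarith)
  by_cases hI2 : |IR f| ≤ 2 * δ * s ^ 2
  · left
    obtain ⟨γ, θ, t0, t2, ha, hp, -⟩ := hred f (√(2 * δ) * s) (by positivity) (by rw [mul_pow, hq2]; exact hI2) (by
      refine hJ.le.trans ?_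
      rw [mul_pow]; linarith [mul_le_mul_of_nonneg_right hs1 (sq_nonneg s)])
    refine hcus γ (ha.trans ?_) (hp.trans ?_)
    · have : θ ^ 2 ≤ 4 := by linarith [mul_le_mul t2 t2 t0.le zero_le_two]
      have h3 : M1 * (√(2 * δ) * s) * θ ^ 2 ≤ M1 * (√(2 * δ) * s) * 4 := mul_le_mul_of_nonneg_left this (by positivity)
      have h4 := mul_le_mul_of_nonneg_right hδη hs0.le
      linarith
    · rw [mul_pow, hq2]
      refine mul_le_mul_of_nonneg_left ?_ (by positivity)
      nlinarith [sq_nonneg s]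
  push Not at hI2
  have hq3 : √(2 * δ) ^ 3 ≤ 1 := pow_le_one₀ hq0.le hq1
  obtain ⟨γ, θ, t0, t2, ha, hp, hnm⟩ := hred f s hs0 hI.le (by
    have : C ≤ s := hs1.trans (mul_le_of_le_one_left hs0.le hq3)
    linarith [mul_le_mul_of_nonneg_right this (sq_nonneg s)])
  by_cases hθ : M1 * θ ^ 2 ≤ η
  · exact Or.inl (hcus γ (ha.trans (by linarith [mul_le_mul_of_nonneg_right hθ hs0.le])) hp)
  push Not at hθ
  have hnv : ‖nv s (γ • f)‖ ≤ M1 ^ 2 / η := by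
    unfold nv
    rw [norm_smul, norm_inv, Real.norm_of_nonneg hs0.le, inv_mul_le_iff₀ hs0]
    refine hnm.trans ?_
    rw [div_le_iff₀ (by positivity)]
    have : 1 ≤ M1 * θ ^ 2 / η := by rw [le_div_iff₀ hη]; linarith
    calc M1 * s ≤ M1 * s * (M1 * θ ^ 2 / η) := le_mul_of_one_le_right (by positivity) this
      _ = _ := by ring
  have hIv : δ ≤ |IV (nv s (γ • f))| := by
    rw [IV_nv, IR_smul, abs_div, abs_of_pos (by positivity : 0 < s ^ 2), le_div_iff₀ (by positivity)]
    nlinarith [sq_nonneg s]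
  obtain ⟨n, hn, hκn⟩ := hsh _ hnv hIv
  have hM0 : 0 < M1 ^ 2 / η := by positivity
  have hN0 : 0 ≤ N := by rw [hN]; positivity
  obtain ⟨γ2, hγ2⟩ : ∃ γ2 : G, nv s (γ2 • γ • f) = act5 1 (n:ℝ) 0 1 (nv s (γ • f)) := by
    refine ⟨gm 1 n 0 1 (by ring), ?_⟩
    unfold nv
    rw [toV_gm, act5_smul]; push_cast; rfl
  have hnv2 : ‖nv s (γ2 • γ • f)‖ ≤ N := by
    rw [hγ2, norm_le_iff, hN]
    have hn' : (n:ℝ) ≤ 8 := by exact_mod_cast hn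
    obtain ⟨b1, b2, b3, b4, b5⟩ := act_bd 1 (n:ℝ) 0 1 8 1 (M1 ^ 2 / η) (by norm_num) (by rw [abs_of_nonneg (by positivity)]; exact hn')
      (by norm_num) (by norm_num) _ hnv
    refine ⟨?_, ?_, ?_, ?_, ?_⟩ <;> linarith
  rw [← hγ2] at hκn
  by_cases hI3 : (1 - δ2) * s ^ 2 ≤ |IR f|
  · left
    refine ⟨γ2 * γ, ?_⟩
    rw [mul_smul]
    refine Or.inl (Or.inr (thn_mem hN0 hs0 hnv2 (by linarith) ?_ ?_ ?_))
    · rw [JR_smul, JR_smul]; exact hJ.le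
    · rw [IR_smul, IR_smul]; exact hI.le
    · rw [IR_smul, IR_smul]; exact hI3
  push Not at hI3
  have hpsi := psi_one hδ h2 hs0 hI2 hI3 hJ hs2
  have hDl := (psi_supp hδ (by linarith) h2 (by rw [hpsi]; exact one_ne_zero)).2.2.2
  by_cases hst : ∃ γ : G, ph N κ (nv s (γ • f)) ≠ 0 ∧ ∃ γ' : G, γ' • γ • f = γ • f ∧ γ' ≠ 1 ∧ γ' ≠ -1
  · obtain ⟨γ3, n1, γ', n2, n3, n4⟩ := hst
    left
    refine ⟨γ3, Or.inr ?_⟩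
    have hb := (ph_supp n1).1
    have hmem : γ' ∈ F := by
      refine hFp _ hb ?_ γ' ?_
      · rw [nv_smul, Dl_acG]; exact hDl
      · rw [← nv_smul, n2]; exact hb
    simp only [Set.mem_iUnion]
    exact ⟨γ', Finset.mem_filter.mpr ⟨hmem, n3, n4⟩, n2, (nv_bd hs0).mp hb⟩
  · right
    push Not at hst
    refine ⟨⟨γ2 * γ, ?_⟩, hpsi, ?_, hJ, ?_⟩
    · rw [mul_smul]; exact ph_ge hκ hnv2 hκn
    · unfold nv
      rw [sig_smul (by positivity)]
      refine (roots_sig f hf.1 ?_ i hi).mp hr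
      intro h0
      have : Dl (nv s f) = 0 := by
        have : Dl (nv s f) = (s⁻¹) ^ 6 * Dl (toV f) := by unfold Dl nv; rw [IV_smul, JV_smul]; ring
        rw [this, h0, mul_zero]
      rw [this, abs_zero] at hDl
      have : 0 < δ ^ 3 := by positivity
      linarith
    · intro γ3 n1 γ' n2
      by_contra hc
      push Not at hc
      exact hc.2 (hst γ3 n1 γ' n2 hc.1)

end BQFC


namespace BQFC

lemma small (K ε : ℝ) (hK : 0 < K) (hε : 0 < ε) : ∃ η : ℝ, 0 < η ∧ η ≤ 1 ∧ K * √η ≤ ε := by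
  refine ⟨min 1 ((ε / K) ^ 2), by positivity, min_le_left _ _, ?_⟩
  have : √(min 1 ((ε / K) ^ 2)) ≤ ε / K := by
    rw [Real.sqrt_le_left (by positivity)]; exact min_le_right _ _
  rw [le_div_iff₀ hK] at this
  linarith

lemma bad_bd (F : Finset G) {C M1 η N κ δ2 s Kc Kt : ℝ} (hN : 0 ≤ N) (hs : 1 ≤ s)
    (hc : {f ∈ Cus C M1 s | |(f.a:ℝ)| ≤ η * s}.Finite ∧ ({f ∈ Cus C M1 s | |(f.a:ℝ)| ≤ η * s}.ncard : ℝ) ≤ Kc * √η * s ^ 4)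
    (ht : ∀ I0 : ℝ, (Thn C (N + 1) (κ / (22 * (N + 1) ^ 2)) s δ2 I0).Finite ∧
      ((Thn C (N + 1) (κ / (22 * (N + 1) ^ 2)) s δ2 I0).ncard : ℝ) ≤ Kt * √δ2 * s ^ 4) :
    (Badd F C M1 η N κ δ2 s).Finite ∧ ((Badd F C M1 η N κ δ2 s).ncard : ℝ) ≤
      Kc * √η * s ^ 4 + 2 * (Kt * √δ2 * s ^ 4) + F.card * (27 * (N + 1) ^ 3 * s ^ 3) := by
  have hst : ∀ γ ∈ {γ ∈ F | γ ≠ 1 ∧ γ ≠ -1}, (Sta (N + 1) s γ).Finite ∧ ((Sta (N + 1) s γ).ncard : ℝ) ≤ 27 * (N + 1) ^ 3 * s ^ 3 := by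
    intro γ hγ
    obtain ⟨-, h1, h2⟩ := Finset.mem_filter.mp hγ
    exact stab (N + 1) (by linarith) s hs γ h1 h2 _ fun f hf => hf
  have hU : (⋃ γ ∈ {γ ∈ F | γ ≠ 1 ∧ γ ≠ -1}, Sta (N + 1) s γ).Finite :=
    Set.Finite.biUnion (Finset.finite_toSet _) fun γ hγ => (hst γ hγ).1
  have hUc : ((⋃ γ ∈ {γ ∈ F | γ ≠ 1 ∧ γ ≠ -1}, Sta (N + 1) s γ).ncard : ℝ) ≤ F.card * (27 * (N + 1) ^ 3 * s ^ 3) := by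
    have h1 := Finset.set_ncard_biUnion_le {γ ∈ F | γ ≠ 1 ∧ γ ≠ -1} (Sta (N + 1) s)
    have h2 : ((⋃ γ ∈ {γ ∈ F | γ ≠ 1 ∧ γ ≠ -1}, Sta (N + 1) s γ).ncard : ℝ) ≤ ∑ γ ∈ {γ ∈ F | γ ≠ 1 ∧ γ ≠ -1}, ((Sta (N + 1) s γ).ncard : ℝ) := by
      exact_mod_cast h1
    refine h2.trans ((Finset.sum_le_card_nsmul _ _ _ fun γ hγ => (hst γ hγ).2).trans ?_)
    rw [nsmul_eq_mul]
    refine mul_le_mul_of_nonneg_right ?_ (by positivity)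
    exact_mod_cast Finset.card_filter_le _ _
  refine ⟨(hc.1.union ((ht _).1.union (ht _).1)).union hU, ?_⟩
  unfold Badd
  have n1 := Set.ncard_union_le ({f ∈ Cus C M1 s | |(f.a:ℝ)| ≤ η * s} ∪ (Thn C (N + 1) (κ / (22 * (N + 1) ^ 2)) s δ2 (s ^ 2) ∪
    Thn C (N + 1) (κ / (22 * (N + 1) ^ 2)) s δ2 (-s ^ 2))) (⋃ γ ∈ {γ ∈ F | γ ≠ 1 ∧ γ ≠ -1}, Sta (N + 1) s γ)
  have n2 := Set.ncard_union_le {f ∈ Cus C M1 s | |(f.a:ℝ)| ≤ η * s} (Thn C (N + 1) (κ / (22 * (N + 1) ^ 2)) s δ2 (s ^ 2) ∪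
    Thn C (N + 1) (κ / (22 * (N + 1) ^ 2)) s δ2 (-s ^ 2))
  have n3 := Set.ncard_union_le (Thn C (N + 1) (κ / (22 * (N + 1) ^ 2)) s δ2 (s ^ 2)) (Thn C (N + 1) (κ / (22 * (N + 1) ^ 2)) s δ2 (-s ^ 2))
  have n4 := n1.trans (Nat.add_le_add_right (n2.trans (Nat.add_le_add_left n3 _)) _)
  refine (Nat.cast_le.mpr n4).trans ?_
  push_cast
  linarith [hc.2, (ht (s ^ 2)).2, (ht (-s ^ 2)).2]

/-- the counting predicate -/
def PP (C : ℝ) (i : ℕ) (S : Set BQF) (X : ℝ) (f : BQF) : Prop := f ∈ S ∧ f.Irred ∧ f.realRoots.ncard = 4 - 2 * i ∧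
  max |(f.I : ℝ)| (|(f.J : ℝ)| / C) < X

lemma PP_iff {C : ℝ} (hC : 0 < C) {i : ℕ} {S : Set BQF} {X : ℝ} {f : BQF} : PP C i S X f ↔
    f ∈ S ∧ f.Irred ∧ f.realRoots.ncard = 4 - 2 * i ∧ |IR f| < X ∧ |JR f| < C * X := by
  have h1 : (f.I : ℝ) = IR f := by simp only [BQF.I, IR, Ir]; push_cast; ring
  have h2 : (f.J : ℝ) = JR f := by simp only [BQF.J, JR, Jr]; push_cast; ring
  unfold PP
  rw [max_lt_iff, h1, h2, div_lt_iff₀ hC, mul_comm X C]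

lemma approx (C : ℝ) (hC : 0 < C) (i : ℕ) (hi : i ≤ 2) (ε : ℝ) (hε : 0 < ε) : ∃ (Φ : V → ℝ) (M κ : ℝ), Tst Φ M κ ∧
    ∃ s0 ≥ 1, ∀ s ≥ s0, ∀ S : Set BQF, (∀ γ : G, ∀ f ∈ S, γ • f ∈ S) →
      |(classCount (PP C i S (s ^ 2)) : ℝ) - T Φ C s S| ≤ ε * s ^ 4 := by
  obtain ⟨M1, hM1, hred⟩ := reduction
  obtain ⟨Kc, hKc, hcusp⟩ := cusp C M1 hC (by linarith)
  obtain ⟨η, hη, hη1, hKη⟩ := small Kc (ε / 8) hKc (by positivity)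
  obtain ⟨δ', hδ', hδ'1, hKδ⟩ := small (4 * M1) η (by positivity) hη
  obtain ⟨δ, hδ, rfl⟩ : ∃ δ > 0, δ' = 2 * δ := ⟨δ' / 2, by positivity, by ring⟩
  obtain ⟨κ, hκ, hsh⟩ := shear (M1 ^ 2 / η) δ hδ
  obtain ⟨N, hN⟩ : ∃ N, N = 20480 * (M1 ^ 2 / η) := ⟨_, rfl⟩
  have hN0 : 0 ≤ N := by rw [hN]; positivity
  obtain ⟨R, -, hR⟩ := proper (N + 1) (3 * δ ^ 3) (by linarith) (by positivity)
  set F := (bdG R).toFinset with hF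
  have hFm : ∀ γ : G, γ ∈ F ↔ ∀ i j, |((γ i j : ℤ):ℝ)| ≤ R := by intro γ; rw [hF, Set.Finite.mem_toFinset]; rfl
  have hFn : ∀ γ ∈ F, -γ ∈ F := by
    intro γ h
    rw [hFm] at h ⊢
    intro i j
    have h2 : (-γ : G) i j = -(γ i j) := by simp [Units.val_neg]
    rw [h2]; push_cast; rw [abs_neg]; exact h i j
  have hFp : ∀ v : V, ‖v‖ ≤ N + 1 → 3 * δ ^ 3 ≤ |Dl v| → ∀ γ : G, ‖acG γ v‖ ≤ N + 1 → γ ∈ F := by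
    intro v h1 h2 γ h3
    obtain ⟨p, q, r, t⟩ := hR v _ _ _ _ h1 h2 (det_sq γ) h3
    rw [hFm]
    intro i j
    fin_cases i <;> fin_cases j
    · exact p
    · exact q
    · exact r
    · exact t
  obtain ⟨Kt, hKt, hthin⟩ := thin C (N + 1) (κ / (22 * (N + 1) ^ 2)) hC (by linarith) (by positivity)
  obtain ⟨δ2, h2, h21, hKδ2⟩ := small (2 * Kt) (ε / 8) (by positivity) (by positivity)
  have ht := Ph_tst i hi F hN0 hκ hδ (by linarith) h2
  obtain ⟨s1, hs1, hsieve⟩ := sieve ht (Ph_nn i F δ δ2 hκ) C hC (ε / 2) (by positivity)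
  refine ⟨_, _, _, ht, ?_⟩
  have hq0 : 0 < √(2 * δ) := Real.sqrt_pos.mpr (by positivity)
  set s0 := s1 + 1 / δ2 + C / √(2 * δ) ^ 3 + 2 * C / δ ^ 2 + F.card * (27 * (N + 1) ^ 3) / (ε / 8) with hs0
  have p1 : 0 ≤ 1 / δ2 := by positivity
  have p2 : 0 ≤ C / √(2 * δ) ^ 3 := by positivity
  have p3 : 0 ≤ 2 * C / δ ^ 2 := by positivity
  have p4 : 0 ≤ F.card * (27 * (N + 1) ^ 3) / (ε / 8) := by positivity
  refine ⟨s0, by linarith, fun s hs S hS => ?_⟩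
  have hs' : 1 ≤ s := by linarith
  have hsp : 0 < s := by linarith
  have q2 : C ≤ √(2 * δ) ^ 3 * s := by
    have : C / √(2 * δ) ^ 3 ≤ s := by linarith
    rw [div_le_iff₀ (by positivity)] at this; linarith
  have q3 : 2 * C ≤ δ ^ 2 * s := by
    have : 2 * C / δ ^ 2 ≤ s := by linarith
    rw [div_le_iff₀ (by positivity)] at this; linarith
  have q4 : F.card * (27 * (N + 1) ^ 3) ≤ s * (ε / 8) := by
    have : F.card * (27 * (N + 1) ^ 3) / (ε / 8) ≤ s := by linarith
    rwa [div_le_iff₀ (by positivity)] at this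
  obtain ⟨hBf, hBn⟩ := bad_bd F (κ := κ) (δ2 := δ2) hN0 hs' (hcusp η s hη hη1 hs')
    (fun I0 => hthin δ2 s I0 h2 h21 (by linarith) (Thn C (N + 1) (κ / (22 * (N + 1) ^ 2)) s δ2 I0) fun f hf => hf)
  rw [classCount_eq]
  obtain ⟨hfin, hlow⟩ := lower (F := F) hi hN0 hκ hδ (by linarith) h2 hsp S hS (PP C i S (s ^ 2)) (fun f hf => hf.1) _ hBf fun f hf => by
    obtain ⟨-, f1, f2, f3, f4⟩ := (PP_iff hC).mp hf
    exact analysis hM1 hred hη hη1 hδ hδ'1 hKδ hκ hN hsh h2 hFp hs' q2 q3 hi f1 f2 f3 f4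
  have hup := upper hi hFn hN0 hκ hδ (by linarith) h2 hFp hsp S (PP C i S (s ^ 2)) (C := C) (fun f f1 f2 f3 => by
    obtain ⟨g1, g2, g3, g4⟩ := wf_ne f3
    obtain ⟨-, k1, -, k3⟩ := psi_supp hδ (by linarith) h2 g4
    refine (PP_iff hC).mpr ⟨f1, f2, ?_, ?_, g1⟩
    · rw [nv, sig_smul (by positivity)] at g2
      refine (roots_sig f f2.1 ?_ i hi).mpr g2
      rcases g2 with ⟨-, h, -⟩ | ⟨-, h⟩ | ⟨-, h, -⟩
      · exact h.ne'
      · exact h.ne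
      · exact h.ne'
    · rwa [IV_nv, abs_div, abs_of_pos (by positivity : 0 < s ^ 2), div_lt_one (by positivity)] at k1) hfin
  have hsv := hsieve s (by linarith)
  have r1 := mul_le_mul_of_nonneg_right hKη (by positivity : 0 ≤ s ^ 4)
  have r2 := mul_le_mul_of_nonneg_right hKδ2 (by positivity : 0 ≤ s ^ 4)
  have r3 := mul_le_mul_of_nonneg_right q4 (by positivity : 0 ≤ s ^ 3)
  have r4 : 0 ≤ ε * s ^ 4 := by positivity
  rw [abs_le]
  constructor
  · linarith
  · have : s * (ε / 8) * s ^ 3 = ε / 8 * s ^ 4 := by ring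
    linarith

end BQFC


namespace BQFC

open Classical in
lemma dens_eq (m : ℕ) (S : Set BQF) :
    ({f : BQF | f ∈ S ∧ 0 ≤ f.a ∧ f.a < m ∧ 0 ≤ f.b ∧ f.b < m ∧ 0 ≤ f.c ∧ f.c < m ∧
      0 ≤ f.d ∧ f.d < m ∧ 0 ≤ f.e ∧ f.e < m}.ncard : ℝ) / (m : ℝ) ^ 5 = dens m S := by
  have : {f : BQF | f ∈ S ∧ 0 ≤ f.a ∧ f.a < m ∧ 0 ≤ f.b ∧ f.b < m ∧ 0 ≤ f.c ∧ f.c < m ∧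
      0 ≤ f.d ∧ f.d < m ∧ 0 ≤ f.e ∧ f.e < m} = (((rbox m).filter (· ∈ S) : Finset BQF) : Set BQF) := by
    ext f
    simp only [Set.mem_ofPred_eq, Finset.coe_filter, rbox, mem_box, Finset.mem_Ico]
    tauto
  rw [this, Set.ncard_coe_finset]
  unfold dens
  congr!

lemma dens_le (m : ℕ) (S : Set BQF) : 0 ≤ dens m S ∧ dens m S ≤ 1 := by
  classical
  unfold dens
  refine ⟨by positivity, div_le_one_of_le₀ ?_ (by positivity)⟩
  have h := card_rbox m
  have h2 := Finset.card_le_card (Finset.filter_subset (· ∈ S) (rbox m))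
  rw [h] at h2
  exact_mod_cast (by convert h2)

lemma fin_bd (C : ℝ) (hC : 0 < C) (m : ℕ) (hm : 1 ≤ m) (S : Set BQF) (hS : SMod m S)
    (hG : ∀ γ : G, ∀ f ∈ S, γ • f ∈ S) (i : ℕ) (hi : i ≤ 2) (ε : ℝ) (hε : 0 < ε) :
    ∃ X0 : ℝ, 1 ≤ X0 ∧ ∀ X ≥ X0, |(classCount (PP C i S X) : ℝ) - dens m S * classCount (PP C i Set.univ X)|
      ≤ 3 * ε * X ^ 2 := by
  obtain ⟨Φ, M, κ, hT, s0, hs0, H⟩ := approx C hC i hi ε hε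
  obtain ⟨s1, hs1, H1⟩ := equidist hT C hC m hm S hS ε hε
  refine ⟨max s0 s1 ^ 2, one_le_pow₀ (hs0.trans (le_max_left _ _)), fun X hX => ?_⟩
  have hm1 : 0 ≤ max s0 s1 := by linarith [le_max_left s0 s1]
  have hX0 : 0 ≤ X := le_trans (by positivity) hX
  have hs : max s0 s1 ≤ √X := Real.le_sqrt_of_sq_le hX
  have a1 := H (√X) ((le_max_left _ _).trans hs) S hG
  have a2 := H (√X) ((le_max_left _ _).trans hs) Set.univ (fun _ _ _ => trivial)
  have a3 := H1 (√X) ((le_max_right _ _).trans hs)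
  have e2 : √X ^ 2 = X := Real.sq_sqrt hX0
  have e4 : √X ^ 4 = X ^ 2 := by rw [show (4:ℕ) = 2 * 2 from rfl, pow_mul, e2]
  rw [e2, e4] at a1 a2
  rw [e4] at a3
  obtain ⟨d0, d1⟩ := dens_le m S
  have a4 : |dens m S * (T Φ C (√X) Set.univ - classCount (PP C i Set.univ X))| ≤ ε * X ^ 2 := by
    rw [abs_mul, abs_of_nonneg d0, abs_sub_comm]
    calc _ ≤ 1 * _ := mul_le_mul_of_nonneg_right d1 (abs_nonneg _)
      _ ≤ _ := by rw [one_mul]; exact a2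
  rw [abs_le] at *
  constructor <;> linarith [a1.1, a1.2, a3.1, a3.2, a4.1, a4.2]

end BQFC


/-- Counting classes in a set `S ⊆ ℤ⁵` defined by congruence conditions modulo `m` and
invariant under the `GL₂(ℤ)`-action: for each `i ∈ {0,1,2}`, the number of classes of
irreducible forms in `S` with `4 - 2i` distinct real roots and height
`h_C = max(|I|, |J|/C) < X` equals `d(S)` times the unrestricted count, up to `o(X²)`,
where `d(S)` is the density of `S`. -/
theorem congruence_class_counting (C : ℝ) (hC : 0 < C) (m : ℕ) (hm : 1 ≤ m)
    (S : Set BQF)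
    (hSmod : ∀ f g : BQF, (m : ℤ) ∣ f.a - g.a → (m : ℤ) ∣ f.b - g.b → (m : ℤ) ∣ f.c - g.c →
      (m : ℤ) ∣ f.d - g.d → (m : ℤ) ∣ f.e - g.e → (f ∈ S ↔ g ∈ S))
    (hSinv : ∀ f g : BQF, BQF.Equivalent f g → (f ∈ S ↔ g ∈ S))
    (i : ℕ) (hi : i ≤ 2) :
    Tendsto (fun X : ℝ =>
        (((classCount fun f => f ∈ S ∧ f.Irred ∧ f.realRoots.ncard = 4 - 2 * i ∧
              max |(f.I : ℝ)| (|(f.J : ℝ)| / C) < X) : ℝ) -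
          (({f : BQF | f ∈ S ∧ 0 ≤ f.a ∧ f.a < m ∧ 0 ≤ f.b ∧ f.b < m ∧ 0 ≤ f.c ∧ f.c < m ∧
                0 ≤ f.d ∧ f.d < m ∧ 0 ≤ f.e ∧ f.e < m}.ncard : ℝ) / (m : ℝ) ^ 5) *
            ((classCount fun f => f.Irred ∧ f.realRoots.ncard = 4 - 2 * i ∧
              max |(f.I : ℝ)| (|(f.J : ℝ)| / C) < X) : ℝ)) / X ^ 2)
      atTop (nhds 0) := by
  rw [Metric.tendsto_atTop]
  intro ε hε
  obtain ⟨X0, h1, H⟩ := BQFC.fin_bd C hC m hm S hSmod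
    (fun γ f hf => (hSinv f _ (BQFC.equiv_iff.mpr ⟨γ, rfl⟩)).mp hf) i hi (ε / 4) (by positivity)
  refine ⟨X0, fun X hX => ?_⟩
  have h := H X hX
  have e1 : BQFC.PP C i Set.univ X = fun f : BQF => f.Irred ∧ f.realRoots.ncard = 4 - 2 * i ∧
      max |(f.I : ℝ)| (|(f.J : ℝ)| / C) < X := by
    funext f
    simp [BQFC.PP]
  rw [e1, ← BQFC.dens_eq] at h
  have hX2 : 0 < X ^ 2 := by have : 1 ≤ X := h1.trans hX; positivity
  rw [Real.dist_eq, sub_zero, abs_div, abs_of_pos hX2, div_lt_iff₀ hX2]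
  refine lt_of_le_of_lt h ?_
  nlinarith
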